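/- arXiv:solv-int/9710023 — 4 statements merged into one kernel-verified Lean document; each statement's English description precedes it below -/
import Mathlib

section
/- Let z0 ∈ ℂ, let f be holomorphic on a neighborhood of z0, let r > 0 and let c : ℕ → ℂ with c_0 ≠ 0. Suppose the series u(z) = Σ_{n=0}^∞ c_n (z - z0)^{n-2} converges for 0 < |z - z0| < r and u satisfies u''(z) = 6 u(z)^2 + f(z) there. Then c_0 = 1, c_1 = c_2 = c_3 = 0, c_4 = -f(z0)/10, c_5 = -f'(z0)/6, and the resonance condition f''(z0) = 0 holds. -/
section Helpers
open Filter Topology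

lemma tail_analytic (z0 : ℂ) (r : ℝ) (hr : 0 < r) (d : ℕ → ℂ)
    (h : ∀ z : ℂ, 0 < ‖z - z0‖ → ‖z - z0‖ < r → Summable (fun n : ℕ => d n * (z - z0) ^ n)) :
    AnalyticAt ℂ (fun z => ∑' n : ℕ, d n * (z - z0) ^ n) z0 := by
  refine HasFPowerSeriesAt.analyticAt (p := FormalMultilinearSeries.ofScalars ℂ d) ?_
  rw [hasFPowerSeriesAt_iff]
  filter_upwards [Metric.ball_mem_nhds (0 : ℂ) hr] with w hw
  have hw' : ‖w‖ < r := by simpa using hw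
  have hs : Summable (fun n : ℕ => d n * w ^ n) := by
    by_cases h0 : w = 0
    · subst h0
      refine summable_of_ne_finset_zero (s := {0}) ?_
      intro b hb
      have : b ≠ 0 := by simpa using hb
      simp [this]
    · have := h (z0 + w) (by simpa using h0) (by simpa using hw')
      simpa using this
  have := hs.hasSum
  simpa [FormalMultilinearSeries.coeff_ofScalars, mul_comm] using this

lemma peel (z0 a : ℂ) (K : ℂ → ℂ) (hK : ContinuousAt K z0)
    (h : ∀ᶠ z in 𝓝[≠] z0, a + (z - z0) * K z = 0) :
    a = 0 ∧ ∀ᶠ z in 𝓝[≠] z0, K z = 0 := by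
  have ha : a = 0 := by
    have h1 : ContinuousAt (fun z => a + (z - z0) * K z) z0 := by fun_prop
    have h2 := h1.tendsto.mono_left (nhdsWithin_le_nhds (s := {z0}ᶜ))
    have h3 : Tendsto (fun z => a + (z - z0) * K z) (𝓝[≠] z0) (𝓝 0) :=
      tendsto_const_nhds.congr' (by filter_upwards [h] with z hz; exact hz.symm)
    simpa using tendsto_nhds_unique h2 h3
  refine ⟨ha, ?_⟩
  filter_upwards [h, self_mem_nhdsWithin] with z hz hne
  rw [ha, zero_add] at hz
  exact (mul_eq_zero.1 hz).resolve_left (sub_ne_zero.2 hne)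

lemma taylor2 (z0 : ℂ) (f : ℂ → ℂ) (hf : AnalyticAt ℂ f z0) :
    ∃ s : ℂ → ℂ, AnalyticAt ℂ s z0 ∧
      (∀ z, f z = f z0 + (z - z0) * (deriv f z0 + (z - z0) * s z)) ∧
      deriv (deriv f) z0 = 2 * s z0 := by
  have hd : ∀ g : ℂ → ℂ, AnalyticAt ℂ g z0 → AnalyticAt ℂ (dslope g z0) z0 := by
    rintro g ⟨p, hp⟩
    exact hp.has_fpower_series_dslope_fslope.analyticAt
  have he : ∀ (g : ℂ → ℂ) z, g z = g z0 + (z - z0) * dslope g z0 z := by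
    intro g z
    have := sub_smul_dslope g z0 z
    rw [smul_eq_mul] at this
    rw [this]; ring
  set s := dslope (dslope f z0) z0 with hs
  have hsa : AnalyticAt ℂ s z0 := hd _ (hd _ hf)
  have hfe : ∀ z, f z = f z0 + (z - z0) * (deriv f z0 + (z - z0) * s z) := by
    intro z
    have h1 := he f z
    have h2 := he (dslope f z0) z
    rw [dslope_same] at h2
    rw [← h2]; exact h1
  refine ⟨s, hsa, hfe, ?_⟩
  have hder : deriv f =ᶠ[𝓝 z0] fun z => deriv f z0 + (z - z0) * (2 * s z + (z - z0) * deriv s z) := by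
    filter_upwards [hsa.eventually_analyticAt] with z hz
    have e1 := hz.differentiableAt.hasDerivAt
    have e2 := (hasDerivAt_id z).sub_const z0
    have e3 := ((e2.mul ((e2.mul e1).const_add (deriv f z0))).const_add (f z0))
    have : f = fun z => f z0 + (z - z0) * (deriv f z0 + (z - z0) * s z) := funext hfe
    refine ((congrArg (fun g => deriv g z) this).trans (HasDerivAt.deriv e3)).trans ?_
    simp only [id, Pi.mul_apply]
    ring
  rw [hder.deriv_eq]
  have e1 := hsa.differentiableAt.hasDerivAt
  have e1' := hsa.deriv.differentiableAt.hasDerivAt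
  have e2 := (hasDerivAt_id z0).sub_const z0
  have e3 := ((e2.mul ((e1.const_mul 2).add (e2.mul e1'))).const_add (deriv f z0))
  have e4 : HasDerivAt (fun z => deriv f z0 + (z - z0) * (2 * s z + (z - z0) * deriv s z)) _ z0 := e3
  rw [e4.deriv]
  simp

lemma second_deriv (z0 : ℂ) (u g : ℂ → ℂ) (U : Set ℂ) (hU : IsOpen U) (hz : ∀ z ∈ U, z ≠ z0)
    (hg : ∀ z ∈ U, AnalyticAt ℂ g z) (hu : ∀ z ∈ U, u z = g z / (z - z0) ^ 2) :
    ∀ z ∈ U, (z - z0) ^ 4 * deriv (deriv u) z =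
      (z - z0) ^ 2 * deriv (deriv g) z - 4 * (z - z0) * deriv g z + 6 * g z := by
  have h1 : ∀ z ∈ U, deriv u z = deriv g z / (z - z0) ^ 2 - 2 * g z / (z - z0) ^ 3 := by
    intro z hzU
    have hne := sub_ne_zero.2 (hz z hzU)
    have e0 : u =ᶠ[𝓝 z] fun z => g z / (z - z0) ^ 2 := by
      filter_upwards [hU.mem_nhds hzU] with y hy using hu y hy
    rw [e0.deriv_eq]
    have e2 := ((hasDerivAt_id z).sub_const z0).pow 2
    have e3 := (hg z hzU).differentiableAt.hasDerivAt.div e2 (pow_ne_zero 2 hne)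
    refine (HasDerivAt.deriv e3).trans ?_
    simp
    field_simp
  intro z hzU
  have hne := sub_ne_zero.2 (hz z hzU)
  have e0 : deriv u =ᶠ[𝓝 z] fun z => deriv g z / (z - z0) ^ 2 - 2 * g z / (z - z0) ^ 3 := by
    filter_upwards [hU.mem_nhds hzU] with y hy using h1 y hy
  rw [e0.deriv_eq]
  have e2 := ((hasDerivAt_id z).sub_const z0).pow 2
  have e2' := ((hasDerivAt_id z).sub_const z0).pow 3
  have e3 := ((hg z hzU).deriv.differentiableAt.hasDerivAt.div e2 (pow_ne_zero 2 hne)).sub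
    (((hg z hzU).differentiableAt.hasDerivAt.const_mul 2).div e2' (pow_ne_zero 3 hne))
  rw [show deriv (fun z => deriv g z / (z - z0) ^ 2 - 2 * g z / (z - z0) ^ 3) z = _ from
    HasDerivAt.deriv e3]
  simp
  field_simp
  ring

lemma poly_step (z0 : ℂ) (T : ℂ → ℂ) (a : ℂ) (z : ℂ) (hT : AnalyticAt ℂ T z) :
    deriv (fun z => a + (z - z0) * T z) z = T z + (z - z0) * deriv T z ∧
    deriv (deriv (fun z => a + (z - z0) * T z)) z =
      2 * deriv T z + (z - z0) * deriv (deriv T) z := by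
  have h1 : ∀ y, AnalyticAt ℂ T y →
      deriv (fun z => a + (z - z0) * T z) y = T y + (y - z0) * deriv T y := by
    intro y hy
    have e2 := (hasDerivAt_id y).sub_const z0
    have e3 := (e2.mul hy.differentiableAt.hasDerivAt).const_add a
    refine (HasDerivAt.deriv e3).trans ?_
    simp
  refine ⟨h1 z hT, ?_⟩
  have e0 : deriv (fun z => a + (z - z0) * T z) =ᶠ[𝓝 z] fun y => T y + (y - z0) * deriv T y := by
    filter_upwards [hT.eventually_analyticAt] with y hy using h1 y hy
  rw [e0.deriv_eq]
  have e2 := (hasDerivAt_id z).sub_const z0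
  have e3 := hT.differentiableAt.hasDerivAt.add (e2.mul hT.deriv.differentiableAt.hasDerivAt)
  refine (HasDerivAt.deriv e3).trans ?_
  simp
  ring

end Helpers

/-- The Painlevé test for `u'' = 6u² + f(z)`: if a Laurent series
`u(z) = Σ cₙ (z - z0)^(n-2)` with `c₀ ≠ 0` converges on a punctured disk around
the movable singularity `z0` and solves the equation there, then
`c₀ = 1`, `c₁ = c₂ = c₃ = 0`, `c₄ = -f(z0)/10`, `c₅ = -f'(z0)/6`, and the
resonance condition `f''(z0) = 0` holds. -/
theorem painleve_test_for_PI_type_equation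
    (z0 : ℂ) (f : ℂ → ℂ) (hf : AnalyticAt ℂ f z0)
    (r : ℝ) (hr : 0 < r) (c : ℕ → ℂ) (hc0 : c 0 ≠ 0)
    (u : ℂ → ℂ)
    (hsum : ∀ z : ℂ, 0 < ‖z - z0‖ → ‖z - z0‖ < r →
      HasSum (fun n : ℕ => c n * (z - z0) ^ ((n : ℤ) - 2)) (u z))
    (hode : ∀ z : ℂ, 0 < ‖z - z0‖ → ‖z - z0‖ < r →
      deriv (deriv u) z = 6 * (u z) ^ 2 + f z) :
    c 0 = 1 ∧ c 1 = 0 ∧ c 2 = 0 ∧ c 3 = 0 ∧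
    c 4 = -f z0 / 10 ∧ c 5 = -deriv f z0 / 6 ∧
    deriv (deriv f) z0 = 0 := by
  classical
  -- Tails of the series
  let T : ℕ → ℂ → ℂ := fun k z => ∑' n : ℕ, c (n + k) * (z - z0) ^ n
  have hs0 : ∀ z : ℂ, 0 < ‖z - z0‖ → ‖z - z0‖ < r →
      HasSum (fun n : ℕ => c n * (z - z0) ^ n) ((z - z0) ^ 2 * u z) := by
    intro z h1 h2
    have hne : z - z0 ≠ 0 := norm_pos_iff.1 h1
    suffices e : (fun n : ℕ => c n * (z - z0) ^ n) =
        fun n : ℕ => (z - z0) ^ 2 * (c n * (z - z0) ^ ((n : ℤ) - 2)) by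
      rw [e]
      exact (hsum z h1 h2).mul_left ((z - z0) ^ 2)
    funext n
    rw [zpow_sub₀ hne]
    simp only [zpow_natCast, zpow_ofNat]
    field_simp
  have hsk : ∀ (k : ℕ) (z : ℂ), 0 < ‖z - z0‖ → ‖z - z0‖ < r →
      Summable (fun n : ℕ => c (n + k) * (z - z0) ^ n) := by
    intro k z h1 h2
    have hne : z - z0 ≠ 0 := norm_pos_iff.1 h1
    have := ((summable_nat_add_iff k).2 (hs0 z h1 h2).summable).mul_left (((z - z0) ^ k)⁻¹)
    refine this.congr fun n => ?_
    rw [pow_add]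
    field_simp
  have hTa : ∀ k, AnalyticAt ℂ (T k) z0 := fun k =>
    tail_analytic z0 r hr (fun n => c (n + k)) (hsk k)
  have hTs : ∀ k z, 0 < ‖z - z0‖ → ‖z - z0‖ < r → T k z = c k + (z - z0) * T (k + 1) z := by
    intro k z h1 h2
    simp only [T]
    rw [(hsk k z h1 h2).tsum_eq_zero_add, ← tsum_mul_left]
    simp only [zero_add, pow_zero, mul_one]
    congr 1
    refine tsum_congr fun n => ?_
    rw [pow_succ, show n + 1 + k = n + (k + 1) by ring]
    ring
  obtain ⟨s, hsa, hfe, hf2⟩ := taylor2 z0 f hf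
  -- a common open punctured neighbourhood
  have hev : ∀ᶠ z in nhds z0, ∀ k ∈ Finset.range 8, AnalyticAt ℂ (T k) z := by
    rw [Filter.eventually_all_finset]
    exact fun k _ => (hTa k).eventually_analyticAt
  obtain ⟨V, hVsub, hVo, hzV⟩ := mem_nhds_iff.1 hev
  let U : Set ℂ := V ∩ Metric.ball z0 r ∩ {z0}ᶜ
  have hUo : IsOpen U := (hVo.inter Metric.isOpen_ball).inter isOpen_compl_singleton
  have hUm : U ∈ nhdsWithin z0 {z0}ᶜ := by
    refine Filter.inter_mem ?_ self_mem_nhdsWithin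
    exact mem_nhdsWithin_of_mem_nhds
      (Filter.inter_mem (hVo.mem_nhds hzV) (Metric.ball_mem_nhds z0 hr))
  have hUr : ∀ z ∈ U, 0 < ‖z - z0‖ ∧ ‖z - z0‖ < r := by
    rintro z ⟨⟨_, h2⟩, h3⟩
    exact ⟨norm_pos_iff.2 (sub_ne_zero.2 h3), by simpa [dist_eq_norm] using h2⟩
  have hUT : ∀ z ∈ U, ∀ k < 8, AnalyticAt ℂ (T k) z := by
    rintro z ⟨⟨h1, _⟩, _⟩ k hk
    exact hVsub h1 k (Finset.mem_range.2 hk)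
  have hD := second_deriv z0 u (T 0) U hUo (fun z hz => hz.2) (fun z hz => hUT z hz 0 (by norm_num))
    (by
      intro z hz
      obtain ⟨h1, h2⟩ := hUr z hz
      have hne : z - z0 ≠ 0 := norm_pos_iff.1 h1
      have : T 0 z = (z - z0) ^ 2 * u z := by
        simpa [T] using (hs0 z h1 h2).tsum_eq
      rw [this]; field_simp)
  have hTd : ∀ k < 7, ∀ z ∈ U, deriv (T k) z = T (k+1) z + (z - z0) * deriv (T (k+1)) z ∧
      deriv (deriv (T k)) z = 2 * deriv (T (k+1)) z + (z - z0) * deriv (deriv (T (k+1))) z := by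
    intro k hk z hz
    have e : Filter.EventuallyEq (nhds z) (T k) (fun z => c k + (z - z0) * T (k + 1) z) := by
      filter_upwards [hUo.mem_nhds hz] with y hy
      exact hTs k y (hUr y hy).1 (hUr y hy).2
    have := poly_step z0 (T (k+1)) (c k) z (hUT z hz _ (by omega))
    exact ⟨e.deriv_eq.trans this.1, e.deriv.deriv_eq.trans this.2⟩
  have hmain : ∀ᶠ z in nhdsWithin z0 {z0}ᶜ, (z - z0) ^ 2 * deriv (deriv (T 0)) z
      - 4 * (z - z0) * deriv (T 0) z + 6 * T 0 z - 6 * (T 0 z) ^ 2 - (z - z0) ^ 4 * f z = 0 := by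
    filter_upwards [hUm] with z hz
    obtain ⟨h1, h2⟩ := hUr z hz
    have : T 0 z = (z - z0) ^ 2 * u z := by
      simpa [T] using (hs0 z h1 h2).tsum_eq
    have h3 := hD z hz
    rw [hode z h1 h2] at h3
    rw [this] at h3 ⊢
    linear_combination -h3
  have cT := fun k => (hTa k).continuousAt
  have cT' := fun k => (hTa k).deriv.continuousAt
  have cT'' := fun k => (hTa k).deriv.deriv.continuousAt
  have cs := hsa.continuousAt
  have cf := hf.continuousAt
  -- order 0
  have H0 := peel z0 (6 * c 0 - 6 * c 0 ^ 2)
    (fun z => (z - z0) * deriv (deriv (T 0)) z - 4 * deriv (T 0) z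
      + 6 * T 1 z - 12 * c 0 * T 1 z - 6 * (z - z0) * T 1 z ^ 2 - (z - z0) ^ 3 * f z)
    (by have a := cT 1; have b := cT' 0; have d := cT'' 0; fun_prop)
    (by
      filter_upwards [hmain, hUm] with z hm hz
      have e := hTs 0 z (hUr z hz).1 (hUr z hz).2
      simp only [zero_add] at e
      rw [← hm, e]; ring)
  have c0 : c 0 = 1 := by
    have := H0.1
    have h : c 0 * (1 - c 0) = 0 := by linear_combination this / 6
    exact (sub_eq_zero.1 ((mul_eq_zero.1 h).resolve_left hc0)).symm
  -- order 1
  have H1 := peel z0 (-10 * c 1)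
    (fun z => (z - z0) * deriv (deriv (T 1)) z - 2 * deriv (T 1) z
      - 10 * T 2 z - 6 * T 1 z ^ 2 - (z - z0) ^ 2 * f z)
    (by have a := cT 1; have a2 := cT 2; have b := cT' 1; have d := cT'' 1; fun_prop)
    (by
      filter_upwards [H0.2, hUm] with z hm hz
      have e := hTs 1 z (hUr z hz).1 (hUr z hz).2
      obtain ⟨e1, e2⟩ := hTd 0 (by norm_num) z hz
      simp only [zero_add, Nat.reduceAdd] at e e1 e2
      rw [e1, e2, c0] at hm
      linear_combination hm + 10 * e)
  have c1 : c 1 = 0 := by linear_combination -H1.1 / 10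
  -- order 2
  have H2 := peel z0 (-12 * c 2)
    (fun z => (z - z0) * deriv (deriv (T 2)) z
      - 12 * T 3 z - 6 * (z - z0) * T 2 z ^ 2 - (z - z0) * f z)
    (by have a := cT 2; have a2 := cT 3; have b := cT' 2; have d := cT'' 2; fun_prop)
    (by
      filter_upwards [H1.2, hUm] with z hm hz
      have e0 := hTs 1 z (hUr z hz).1 (hUr z hz).2
      have e := hTs 2 z (hUr z hz).1 (hUr z hz).2
      obtain ⟨e1, e2⟩ := hTd 1 (by norm_num) z hz
      simp only [Nat.reduceAdd] at e e1 e2 e0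
      rw [e1, e2, e0, c1] at hm
      linear_combination hm + 12 * e)
  have c2 : c 2 = 0 := by linear_combination -H2.1 / 12
  -- order 3
  have H3 := peel z0 (-12 * c 3)
    (fun z => (z - z0) * deriv (deriv (T 3)) z + 2 * deriv (T 3) z
      - 12 * T 4 z - 6 * (z - z0) ^ 2 * T 3 z ^ 2 - f z)
    (by have a := cT 3; have a2 := cT 4; have b := cT' 3; have d := cT'' 3; fun_prop)
    (by
      filter_upwards [H2.2, hUm] with z hm hz
      have e0 := hTs 2 z (hUr z hz).1 (hUr z hz).2
      have e := hTs 3 z (hUr z hz).1 (hUr z hz).2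
      obtain ⟨e1, e2⟩ := hTd 2 (by norm_num) z hz
      simp only [Nat.reduceAdd] at e e1 e2 e0
      rw [e2, e0, c2] at hm
      linear_combination hm + 12 * e)
  have c3 : c 3 = 0 := by linear_combination -H3.1 / 12
  -- order 4
  have H4 := peel z0 (-10 * c 4 - f z0)
    (fun z => (z - z0) * deriv (deriv (T 4)) z + 4 * deriv (T 4) z
      - 10 * T 5 z - 6 * (z - z0) ^ 3 * T 4 z ^ 2 - (deriv f z0 + (z - z0) * s z))
    (by have a := cT 4; have a2 := cT 5; have b := cT' 4; have d := cT'' 4; fun_prop)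
    (by
      filter_upwards [H3.2, hUm] with z hm hz
      have e0 := hTs 3 z (hUr z hz).1 (hUr z hz).2
      have e := hTs 4 z (hUr z hz).1 (hUr z hz).2
      obtain ⟨e1, e2⟩ := hTd 3 (by norm_num) z hz
      simp only [Nat.reduceAdd] at e e1 e2 e0
      rw [e1, e2, e0, c3, hfe z] at hm
      linear_combination hm + 10 * e)
  -- order 5
  have H5 := peel z0 (-6 * c 5 - deriv f z0)
    (fun z => (z - z0) * deriv (deriv (T 5)) z + 6 * deriv (T 5) z
      - 6 * T 6 z - 6 * (z - z0) ^ 2 * T 4 z ^ 2 - s z)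
    (by have a := cT 4; have a2 := cT 6; have b := cT' 5; have d := cT'' 5; fun_prop)
    (by
      filter_upwards [H4.2, hUm] with z hm hz
      have e := hTs 5 z (hUr z hz).1 (hUr z hz).2
      obtain ⟨e1, e2⟩ := hTd 4 (by norm_num) z hz
      simp only [Nat.reduceAdd] at e e1 e2
      rw [e1, e2] at hm
      linear_combination hm + 6 * e)
  -- order 6: the resonance
  obtain ⟨s', hs'⟩ : ∃ s' : ℂ → ℂ, s' = dslope s z0 := ⟨_, rfl⟩
  have H6 := peel z0 (- s z0)
    (fun z => (z - z0) * deriv (deriv (T 6)) z + 8 * deriv (T 6) z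
      - 6 * (z - z0) * T 4 z ^ 2 - s' z)
    (by
      have a := cT 4; have b := cT' 6; have d := cT'' 6
      have hh : ContinuousAt s' z0 := by
        rw [hs', continuousAt_dslope_same]; exact hsa.differentiableAt
      fun_prop)
    (by
      filter_upwards [H5.2, hUm] with z hm hz
      obtain ⟨e1, e2⟩ := hTd 5 (by norm_num) z hz
      have e := sub_smul_dslope s z0 z
      rw [smul_eq_mul, ← hs'] at e
      simp only [Nat.reduceAdd] at e1 e2
      rw [e1, e2] at hm
      linear_combination hm - e)
  refine ⟨c0, c1, c2, c3, ?_, ?_, ?_⟩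
  · linear_combination -H4.1 / 10
  · linear_combination -H5.1 / 6
  · rw [hf2]; linear_combination -2 * H6.1
end

section
/- Let ξ be holomorphic on a neighborhood of 0 ∈ ℂ with ξ(0) = 0, and let f4, f6 be holomorphic on a neighborhood of 0 ∈ ℂ. Then there exist a neighborhood V of (0,0) ∈ ℂ² and a holomorphic function h : V → ℂ such that the function w(x,t) := -12/(x - ξ(t))² + h(x,t) satisfies the KdV equation w_t + w w_x + w_{xxx} = 0 at every (x,t) ∈ V with x ≠ ξ(t), and for every t near 0: lim_{x→ξ(t)} (∂/∂x)^4 [ (x - ξ(t))² w(x,t) ] = f4(t) and lim_{x→ξ(t)} (∂/∂x)^6 [ (x - ξ(t))² w(x,t) ] = f6(t). -/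
open Filter

lemma nagumo_deriv {f : ℂ → ℂ} {R A : ℝ} {k : ℕ} (hf : DifferentiableOn ℂ f (Metric.ball 0 R))
    (hA : ∀ t ∈ Metric.ball (0 : ℂ) R, ‖f t‖ * (R - ‖t‖) ^ k ≤ A) :
    ∀ t ∈ Metric.ball (0 : ℂ) R, ‖deriv f t‖ * (R - ‖t‖) ^ (k + 1) ≤ 4 * (k + 1) * A := by
  intro t ht
  have ht' : ‖t‖ < R := by simpa using ht
  set d := R - ‖t‖ with hd
  have hdpos : 0 < d := by linarith
  have hk : (0 : ℝ) < k + 1 := by positivity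
  have hA0 : 0 ≤ A := le_trans (by positivity) (hA t ht)
  set s := d / (2 * (k + 1)) with hs
  have hspos : 0 < s := by positivity
  have hsd : s * (2 * (k + 1)) = d := by rw [hs]; field_simp
  have hsle : s ≤ d / 2 := by
    rw [hs]; apply div_le_div_of_nonneg_left hdpos.le <;> linarith [(Nat.cast_nonneg k : (0 : ℝ) ≤ k)]
  have hsub : Metric.closedBall t s ⊆ Metric.ball 0 R := by
    intro z hz
    have h1 : ‖z - t‖ ≤ s := by simpa [dist_eq_norm] using hz
    have h2 : ‖z‖ ≤ ‖z - t‖ + ‖t‖ := by simpa using norm_add_le (z - t) t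
    simp only [Metric.mem_ball, dist_zero_right]
    linarith
  have hb : (1 / 2 : ℝ) ≤ (1 - s / d) ^ k := by
    have h1 := one_add_mul_le_pow (a := - (s / d)) (n := k)
      (by rw [neg_le_neg_iff, div_le_iff₀ hdpos]; linarith)
    have h2 : (k : ℝ) * (s / d) ≤ 1 / 2 := by
      have : s / d = 1 / (2 * (k + 1)) := by rw [hs]; field_simp
      rw [this, mul_one_div, div_le_div_iff₀ (by positivity) (by positivity)]; linarith
    rw [sub_eq_add_neg]; linarith
  have key : ‖deriv f t‖ ≤ (2 * A / d ^ k) / s := by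
    apply Complex.norm_deriv_le_of_forall_mem_sphere_norm_le hspos
    · exact (hf.mono hsub).diffContOnCl_ball (subset_refl _)
    · intro z hz
      have hz' := hsub (Metric.sphere_subset_closedBall hz)
      have h1 : ‖z - t‖ = s := by simpa [dist_eq_norm] using hz
      have h2 : ‖z‖ ≤ ‖z - t‖ + ‖t‖ := by simpa using norm_add_le (z - t) t
      have h3 : d - s ≤ R - ‖z‖ := by linarith
      have h4 : d ^ k * (1 / 2) ≤ (R - ‖z‖) ^ k := by
        calc d ^ k * (1 / 2) ≤ d ^ k * (1 - s / d) ^ k := by gcongr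
          _ = (d - s) ^ k := by rw [← mul_pow]; congr 1; field_simp
          _ ≤ _ := by apply pow_le_pow_left₀ _ h3; linarith
      rw [le_div_iff₀ (by positivity)]
      have := hA z hz'
      nlinarith [mul_le_mul_of_nonneg_left h4 (norm_nonneg (f z))]
  calc ‖deriv f t‖ * d ^ (k + 1) ≤ ((2 * A / d ^ k) / s) * d ^ (k + 1) := by gcongr
    _ = 4 * (k + 1) * A := by rw [hs]; field_simp; ring

noncomputable def wtcG (a c b : ℂ → ℂ) : ℕ → ℂ → ℂ
  | 0 => fun _ => 0
  | 1 => fun _ => 0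
  | 2 => a
  | 3 => c
  | 4 => b
  | (n + 5) => fun t => -(deriv (wtcG a c b (n + 2)) t
      + ((n : ℂ) + 3) / 2 * ∑ i : Fin (n + 4), wtcG a c b i t * wtcG a c b (n + 3 - i) t)
        / (((n : ℂ) + 3) * (n + 1) * (n + 8))
  termination_by n => n
  decreasing_by all_goals omega

lemma wtcG_succ (a c b : ℂ → ℂ) (n : ℕ) (t : ℂ) : wtcG a c b (n + 5) t =
    -(deriv (wtcG a c b (n + 2)) t
      + ((n : ℂ) + 3) / 2 * ∑ p ∈ Finset.HasAntidiagonal.antidiagonal (n + 3), wtcG a c b p.1 t * wtcG a c b p.2 t)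
        / (((n : ℂ) + 3) * (n + 1) * (n + 8)) := by
  rw [wtcG, Finset.Nat.sum_antidiagonal_eq_sum_range_succ (fun i j => wtcG a c b i t * wtcG a c b j t),
    ← Fin.sum_univ_eq_sum_range (fun i => wtcG a c b i t * wtcG a c b (n + 3 - i) t)]

lemma wtcG_diff {a c b : ℂ → ℂ} {R : ℝ} (ha : DifferentiableOn ℂ a (Metric.ball 0 R))
    (hc : DifferentiableOn ℂ c (Metric.ball 0 R)) (hb : DifferentiableOn ℂ b (Metric.ball 0 R))
    (n : ℕ) : DifferentiableOn ℂ (wtcG a c b n) (Metric.ball 0 R) := by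
  induction n using Nat.strong_induction_on with
  | _ n ih =>
    match n, ih with
    | 0, _ => rw [wtcG]; fun_prop
    | 1, _ => rw [wtcG]; fun_prop
    | 2, _ => rwa [wtcG]
    | 3, _ => rwa [wtcG]
    | 4, _ => rwa [wtcG]
    | n + 5, ih =>
      have : wtcG a c b (n + 5) = _ := funext (wtcG_succ a c b n)
      rw [this]
      refine DifferentiableOn.div_const (DifferentiableOn.neg (DifferentiableOn.add ?_ ?_)) _
      · exact (ih (n + 2) (by omega)).deriv Metric.isOpen_ball
      · refine DifferentiableOn.const_mul (DifferentiableOn.fun_sum fun p hp => ?_) _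
        have := Finset.HasAntidiagonal.mem_antidiagonal.1 hp
        exact (ih _ (by omega)).mul (ih _ (by omega))

lemma wtcG_bound {a c b : ℂ → ℂ} {R K : ℝ} (hR1 : R ≤ 1) (hK : 1 ≤ K)
    (ha : DifferentiableOn ℂ a (Metric.ball 0 R))
    (hc : DifferentiableOn ℂ c (Metric.ball 0 R)) (hb : DifferentiableOn ℂ b (Metric.ball 0 R))
    (ha' : ∀ t ∈ Metric.ball (0 : ℂ) R, ‖a t‖ ≤ K)
    (hc' : ∀ t ∈ Metric.ball (0 : ℂ) R, ‖c t‖ ≤ K)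
    (hb' : ∀ t ∈ Metric.ball (0 : ℂ) R, ‖b t‖ ≤ K)
    (n : ℕ) : ∀ t ∈ Metric.ball (0 : ℂ) R, ‖wtcG a c b n t‖ * (R - ‖t‖) ^ n ≤ K ^ n := by
  have base : ∀ (f : ℂ → ℂ) (m : ℕ), (∀ t ∈ Metric.ball (0 : ℂ) R, ‖f t‖ ≤ K) →
      ∀ t ∈ Metric.ball (0 : ℂ) R, ‖f t‖ * (R - ‖t‖) ^ (m + 1) ≤ K ^ (m + 1) := by
    intro f m hf t ht
    have ht' : ‖t‖ < R := by simpa using ht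
    have h1 : (R - ‖t‖) ^ (m + 1) ≤ 1 := pow_le_one₀ (by linarith) (by linarith [norm_nonneg t])
    calc ‖f t‖ * (R - ‖t‖) ^ (m + 1) ≤ K * 1 := by
          apply mul_le_mul (hf t ht) h1 (pow_nonneg (by linarith) _) (by linarith)
      _ ≤ K ^ (m + 1) := by rw [mul_one]; exact le_self_pow₀ hK (by omega)
  induction n using Nat.strong_induction_on with
  | _ n ih =>
    match n, ih with
    | 0, _ => intro t _; simp [wtcG]
    | 1, _ => intro t _; simp [wtcG]; linarith
    | 2, _ => rw [wtcG]; exact base _ 1 ha'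
    | 3, _ => rw [wtcG]; exact base _ 2 hc'
    | 4, _ => rw [wtcG]; exact base _ 3 hb'
    | n + 5, ih =>
      intro t ht
      have ht' : ‖t‖ < R := by simpa using ht
      set d := R - ‖t‖ with hd
      have hd0 : 0 ≤ d := by linarith
      have hd1 : d ≤ 1 := by linarith [norm_nonneg t]
      have h1 := nagumo_deriv (wtcG_diff ha hc hb (n + 2)) (ih (n + 2) (by omega)) t ht
      rw [← hd] at h1
      have h1' : ‖deriv (wtcG a c b (n + 2)) t‖ * d ^ (n + 5) ≤ 4 * (n + 3) * K ^ (n + 5) := by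
        calc ‖deriv (wtcG a c b (n + 2)) t‖ * d ^ (n + 5)
            ≤ ‖deriv (wtcG a c b (n + 2)) t‖ * d ^ (n + 2 + 1) := by
              gcongr ?_ * ?_
              exact pow_le_pow_of_le_one hd0 hd1 (by omega)
          _ ≤ _ := h1
          _ ≤ 4 * (n + 3) * K ^ (n + 5) := by
              push_cast
              have : K ^ (n + 2) ≤ K ^ (n + 5) := pow_le_pow_right₀ hK (by omega)
              have hn : (0 : ℝ) ≤ 4 * (n + 3) := by positivity
              calc _ = 4 * (n + 3) * K ^ (n + 2) := by ring
                _ ≤ _ := by gcongr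
      have h2 : ‖∑ p ∈ Finset.HasAntidiagonal.antidiagonal (n + 3), wtcG a c b p.1 t * wtcG a c b p.2 t‖ * d ^ (n + 5)
          ≤ (n + 4) * K ^ (n + 5) := by
        calc _ ≤ (∑ p ∈ Finset.HasAntidiagonal.antidiagonal (n + 3), ‖wtcG a c b p.1 t * wtcG a c b p.2 t‖) * d ^ (n + 5) := by
              gcongr; exact norm_sum_le _ _
          _ = ∑ p ∈ Finset.HasAntidiagonal.antidiagonal (n + 3), ‖wtcG a c b p.1 t * wtcG a c b p.2 t‖ * d ^ (n + 5) := by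
              rw [Finset.sum_mul]
          _ ≤ ∑ p ∈ Finset.HasAntidiagonal.antidiagonal (n + 3), K ^ (n + 5) := by
              apply Finset.sum_le_sum
              intro p hp
              have hp' := Finset.HasAntidiagonal.mem_antidiagonal.1 hp
              have e1 := ih p.1 (by omega) t ht
              have e2 := ih p.2 (by omega) t ht
              rw [← hd] at e1 e2
              calc ‖wtcG a c b p.1 t * wtcG a c b p.2 t‖ * d ^ (n + 5)
                  ≤ ‖wtcG a c b p.1 t * wtcG a c b p.2 t‖ * d ^ (n + 3) := by
                    gcongr ?_ * ?_
                    exact pow_le_pow_of_le_one hd0 hd1 (by omega)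
                _ = (‖wtcG a c b p.1 t‖ * d ^ p.1) * (‖wtcG a c b p.2 t‖ * d ^ p.2) := by
                    rw [← hp', norm_mul, pow_add]; ring
                _ ≤ K ^ p.1 * K ^ p.2 := by gcongr
                _ = K ^ (n + 3) := by rw [← pow_add, hp']
                _ ≤ _ := pow_le_pow_right₀ hK (by omega)
          _ = _ := by
              simp only [Finset.sum_const, Finset.Nat.card_antidiagonal, nsmul_eq_mul]
              push_cast; ring
      rw [wtcG_succ, norm_div, norm_neg]
      have hden : ‖((n : ℂ) + 3) * (n + 1) * (n + 8)‖ = ((n : ℝ) + 3) * (n + 1) * (n + 8) := by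
        have : ((n : ℂ) + 3) * (n + 1) * (n + 8) = (((n + 3) * (n + 1) * (n + 8) : ℕ) : ℂ) := by
          push_cast; ring
        rw [this, Complex.norm_natCast]; push_cast; ring
      have hn3 : ‖((n : ℂ) + 3) / 2‖ = ((n : ℝ) + 3) / 2 := by
        have : ((n : ℂ) + 3) = ((n + 3 : ℕ) : ℂ) := by push_cast; ring
        rw [this, norm_div, Complex.norm_natCast]; push_cast; simp
      rw [hden, div_mul_eq_mul_div, div_le_iff₀ (by positivity)]
      have hKp : 0 ≤ K ^ (n + 5) := by positivity
      have hn0 : (0 : ℝ) ≤ n := Nat.cast_nonneg n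
      calc _ ≤ (‖deriv (wtcG a c b (n + 2)) t‖ + ‖((n : ℂ) + 3) / 2‖ *
              ‖∑ p ∈ Finset.HasAntidiagonal.antidiagonal (n + 3), wtcG a c b p.1 t * wtcG a c b p.2 t‖) * d ^ (n + 5) := by
            gcongr; rw [← norm_mul]; exact norm_add_le _ _
        _ = ‖deriv (wtcG a c b (n + 2)) t‖ * d ^ (n + 5) + ((n : ℝ) + 3) / 2 *
              (‖∑ p ∈ Finset.HasAntidiagonal.antidiagonal (n + 3), wtcG a c b p.1 t * wtcG a c b p.2 t‖ * d ^ (n + 5)) := by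
            rw [hn3]; ring
        _ ≤ 4 * (n + 3) * K ^ (n + 5) + ((n : ℝ) + 3) / 2 * ((n + 4) * K ^ (n + 5)) := by gcongr
        _ = K ^ (n + 5) * (4 * (n + 3) + ((n : ℝ) + 3) / 2 * (n + 4)) := by ring
        _ ≤ _ := by
            gcongr
            have e : 4 + ((n : ℝ) + 4) / 2 ≤ (n + 1) * (n + 8) := by nlinarith
            nlinarith [mul_le_mul_of_nonneg_left e (by positivity : (0:ℝ) ≤ n + 3)]

lemma HasSum.congr_funAux {f g : ℕ → ℂ} {a : ℂ} (h : HasSum f a) (hfg : ∀ n, g n = f n) :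
    HasSum g a := by
  rwa [funext hfg]

lemma ps_coeff {S : ℂ → ℂ} {c : ℕ → ℂ} {r : ℝ} (hr : 0 < r)
    (hS : ∀ z ∈ Metric.ball (0 : ℂ) r, HasSum (fun n => c n * z ^ n) (S z)) (n : ℕ) :
    iteratedDeriv n S 0 = (n.factorial : ℂ) * c n := by
  have h : HasFPowerSeriesAt S (FormalMultilinearSeries.ofScalars ℂ c) 0 := by
    rw [hasFPowerSeriesAt_iff]
    filter_upwards [Metric.ball_mem_nhds (0 : ℂ) hr] with z hz
    simpa [mul_comm] using hS z hz
  obtain ⟨ρ, hρ⟩ := h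
  have := hρ.factorial_smul (1 : ℂ) n
  rw [iteratedDeriv_eq_iteratedFDeriv, ← this]
  simp [FormalMultilinearSeries.ofScalars]

lemma ps_deriv {S : ℂ → ℂ} {c : ℕ → ℂ} {r : ℝ} (hr : 0 < r)
    (hd : DifferentiableOn ℂ S (Metric.ball 0 r))
    (hS : ∀ z ∈ Metric.ball (0 : ℂ) r, HasSum (fun n => c n * z ^ n) (S z)) :
    ∀ z ∈ Metric.ball (0 : ℂ) r, HasSum (fun n : ℕ => (((n : ℂ) + 1) * c (n + 1)) * z ^ n) (deriv S z) := by
  intro z hz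
  have h := Complex.hasSum_taylorSeries_on_ball (hd.deriv Metric.isOpen_ball) hz
  refine h.congr_funAux fun n => ?_
  rw [← iteratedDeriv_succ', ps_coeff hr hS, Nat.factorial_succ, sub_zero]
  have : (n.factorial : ℂ) ≠ 0 := by exact_mod_cast n.factorial_ne_zero
  simp only [smul_eq_mul]; push_cast; field_simp

def psShift (k : ℕ) (c : ℕ → ℂ) (n : ℕ) : ℂ := if n < k then 0 else c (n - k)

lemma ps_shift {c : ℕ → ℂ} {z s : ℂ} (k : ℕ) (h : HasSum (fun n => c n * z ^ n) s) :
    HasSum (fun n => psShift k c n * z ^ n) (z ^ k * s) := by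
  rw [← hasSum_nat_add_iff' k]
  have : ∑ i ∈ Finset.range k, psShift k c i * z ^ i = 0 := by
    apply Finset.sum_eq_zero
    intro i hi
    simp [psShift, Finset.mem_range.1 hi]
  rw [this, sub_zero]
  refine (h.mul_left (z ^ k)).congr_funAux fun n => ?_
  simp [psShift, pow_add]; ring

lemma ps_pde {S : ℂ → ℂ} {c c' : ℕ → ℂ} {r : ℝ} {e T z : ℂ} (hr : 0 < r)
    (hd : DifferentiableOn ℂ S (Metric.ball 0 r))
    (hS : ∀ z ∈ Metric.ball (0 : ℂ) r, HasSum (fun n => c n * z ^ n) (S z))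
    (hSn : ∀ z ∈ Metric.ball (0 : ℂ) r, Summable (fun n => ‖c n * z ^ n‖))
    (hz : z ∈ Metric.ball (0 : ℂ) r)
    (hT : HasSum (fun n => c' n * z ^ n) T)
    (h0 : c 0 = 0) (h1 : c 1 = 0) (h0' : c' 0 = 0) (h1' : c' 1 = 0) (h3 : 6 * c 3 = e)
    (hrec : ∀ n : ℕ, c (n + 5) = -(c' (n + 2) + ((n : ℂ) + 3) / 2 *
      ∑ p ∈ Finset.HasAntidiagonal.antidiagonal (n + 3), c p.1 * c p.2)
        / (((n : ℂ) + 3) * (n + 1) * (n + 8))) :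
    z ^ 3 * iteratedDeriv 3 S z - 12 * (z * deriv S z) + 24 * S z + z ^ 3 * T + z ^ 3 * e
      + z ^ 3 * (S z * deriv S z) = 0 := by
  have hd1 := hd.deriv Metric.isOpen_ball
  have hd2 := hd1.deriv Metric.isOpen_ball
  have H1 := ps_deriv hr hd hS
  have H2 := ps_deriv hr hd1 H1
  have H3 := ps_deriv hr hd2 H2
  set q : ℕ → ℂ := fun n => ∑ p ∈ Finset.HasAntidiagonal.antidiagonal n, c p.1 * c p.2 with hq
  have HQ : ∀ z ∈ Metric.ball (0 : ℂ) r, HasSum (fun n => q n * z ^ n) (S z * S z) := by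
    intro z hz
    have e1 := tsum_mul_tsum_eq_tsum_sum_antidiagonal_of_summable_norm (hSn z hz) (hSn z hz)
    have e2 := (summable_norm_sum_mul_antidiagonal_of_summable_norm (hSn z hz) (hSn z hz)).of_norm.hasSum
    rw [← e1, (hS z hz).tsum_eq] at e2
    refine e2.congr_funAux fun n => ?_
    rw [hq, Finset.sum_mul]
    apply Finset.sum_congr rfl
    intro p hp
    rw [← Finset.HasAntidiagonal.mem_antidiagonal.1 hp, pow_add]; ring
  have HQ1 := ps_deriv hr (hd.mul hd) HQ z hz
  have dS : DifferentiableAt ℂ S z := hd.differentiableAt (Metric.isOpen_ball.mem_nhds hz)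
  have eQ : deriv (S * S) z = 2 * (S z * deriv S z) := by
    rw [deriv_mul dS dS]; ring
  have HE : HasSum (fun n : ℕ => (if n = 0 then e else 0) * z ^ n) e := by
    convert hasSum_single (f := fun n : ℕ => (if n = 0 then e else 0) * z ^ n) 0 ?_ using 1
    · simp
    · intro n hn; simp [hn]
  have A1 := ps_shift 3 (H3 z hz)
  have A2 := (ps_shift 1 (H1 z hz)).mul_left (-12)
  have A3 := (hS z hz).mul_left 24
  have A4 := ps_shift 3 hT
  have A5 := ps_shift 3 HE
  have A6 := (ps_shift 3 HQ1).mul_left (1 / 2)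
  have tot := ((((A1.add A2).add A3).add A4).add A5).add A6
  have hzero : ∀ n, ((((psShift 3 (fun n : ℕ => ((n : ℂ) + 1) * ((((n + 1 : ℕ) : ℂ) + 1) * ((((n + 1 + 1 : ℕ) : ℂ) + 1) * c (n + 1 + 1 + 1)))) n * z ^ n
      + -12 * (psShift 1 (fun n : ℕ => ((n : ℂ) + 1) * c (n + 1)) n * z ^ n)) + 24 * (c n * z ^ n))
      + psShift 3 c' n * z ^ n) + psShift 3 (fun n : ℕ => if n = 0 then e else 0) n * z ^ n)
      + 1 / 2 * (psShift 3 (fun n : ℕ => ((n : ℂ) + 1) * q (n + 1)) n * z ^ n) = 0 := by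
    intro n
    match n with
    | 0 => simp [psShift, h0]
    | 1 => simp [psShift, h1]
    | 2 => simp [psShift]; ring
    | 3 =>
      have : q 1 = 0 := by simp [hq, Finset.Nat.antidiagonal_succ, h0, h1]
      simp [psShift, h0', this, ← h3]; ring
    | 4 =>
      have : q 2 = 0 := by simp [hq, Finset.Nat.antidiagonal_succ, h0, h1]
      simp [psShift, h1', this]; ring
    | n + 5 =>
      have k1 : (n : ℂ) + 3 ≠ 0 := by exact_mod_cast (by omega : n + 3 ≠ 0)
      have k2 : (n : ℂ) + 1 ≠ 0 := by exact_mod_cast (by omega : n + 1 ≠ 0)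
      have k3 : (n : ℂ) + 8 ≠ 0 := by exact_mod_cast (by omega : n + 8 ≠ 0)
      have hr5 := hrec n
      have e5 : q (n + 3) = ∑ p ∈ Finset.HasAntidiagonal.antidiagonal (n + 3), c p.1 * c p.2 := rfl
      rw [← e5, eq_div_iff (by positivity)] at hr5
      have s1 : n + 5 - 3 = n + 2 := by omega
      have s2 : n + 5 - 1 = n + 4 := by omega
      simp only [psShift, s1, s2, show ¬ (n + 5 < 3) by omega, show ¬ (n + 5 < 1) by omega, if_false,
        show ¬ (n + 2 = 0) by omega, show n + 2 + 1 + 1 + 1 = n + 5 by omega,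
        show n + 2 + 1 = n + 3 by omega]
      push_cast
      linear_combination z ^ (n + 5) * hr5
  have tot0 := tot.unique ((hasSum_zero (α := ℂ) (β := ℕ)).congr_funAux hzero)
  rw [show iteratedDeriv 3 S z = deriv (deriv (deriv S)) z by simp [iteratedDeriv_succ]]
  rw [eQ] at tot0
  linear_combination tot0

noncomputable def serG (g : ℕ → ℂ → ℂ) (p : ℂ × ℂ) : ℂ := ∑' n, g n p.2 * p.1 ^ n

lemma ser_term_bound {u z : ℂ} {B : ℝ} {n : ℕ} (hB : 0 < B) (hu : ‖u‖ ≤ B ^ n)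
    (hz : z ∈ Metric.ball (0 : ℂ) (1 / (2 * B))) : ‖u * z ^ n‖ ≤ (1 / 2) ^ n := by
  have hz' : ‖z‖ < 1 / (2 * B) := by simpa using hz
  rw [norm_mul, norm_pow]
  calc ‖u‖ * ‖z‖ ^ n ≤ B ^ n * (1 / (2 * B)) ^ n := by gcongr
    _ = (1 / 2) ^ n := by rw [← mul_pow]; congr 1; field_simp

lemma summable_half : Summable (fun n : ℕ => ((1 : ℝ) / 2) ^ n) :=
  summable_geometric_of_lt_one (by norm_num) (by norm_num)

section
variable {g : ℕ → ℂ → ℂ} {R B : ℝ}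

lemma serG_summable (hB : 0 < B)
    (hb : ∀ n, ∀ t ∈ Metric.ball (0 : ℂ) R, ‖g n t‖ ≤ B ^ n) {z t : ℂ}
    (ht : t ∈ Metric.ball (0 : ℂ) R) (hz : z ∈ Metric.ball (0 : ℂ) (1 / (2 * B))) :
    Summable (fun n => ‖g n t * z ^ n‖) :=
  Summable.of_nonneg_of_le (fun _ => norm_nonneg _) (fun n => ser_term_bound hB (hb n t ht) hz)
    summable_half

lemma serG_hasSum (hB : 0 < B)
    (hb : ∀ n, ∀ t ∈ Metric.ball (0 : ℂ) R, ‖g n t‖ ≤ B ^ n) {z t : ℂ}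
    (ht : t ∈ Metric.ball (0 : ℂ) R) (hz : z ∈ Metric.ball (0 : ℂ) (1 / (2 * B))) :
    HasSum (fun n => g n t * z ^ n) (serG g (z, t)) :=
  (serG_summable hB hb ht hz).of_norm.hasSum

lemma serG_hasSum_deriv (hB : 0 < B) (hg : ∀ n, DifferentiableOn ℂ (g n) (Metric.ball 0 R))
    (hb : ∀ n, ∀ t ∈ Metric.ball (0 : ℂ) R, ‖g n t‖ ≤ B ^ n) {z t : ℂ}
    (ht : t ∈ Metric.ball (0 : ℂ) R) (hz : z ∈ Metric.ball (0 : ℂ) (1 / (2 * B))) :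
    HasSum (fun n => deriv (g n) t * z ^ n) (deriv (fun t => serG g (z, t)) t) := by
  have h := Complex.hasSum_deriv_of_summable_norm (F := fun n t => g n t * z ^ n) summable_half
    (fun n => (hg n).mul_const _) Metric.isOpen_ball
    (fun n t ht => ser_term_bound hB (hb n t ht) hz) ht
  refine HasSum.congr_funAux h fun n => ?_
  rw [deriv_mul_const]
  exact (hg n).differentiableAt (Metric.isOpen_ball.mem_nhds ht)

lemma serG_diff (hR : 0 < R) (hB : 0 < B) (hg : ∀ n, DifferentiableOn ℂ (g n) (Metric.ball 0 R))
    (hb : ∀ n, ∀ t ∈ Metric.ball (0 : ℂ) R, ‖g n t‖ ≤ B ^ n) {p : ℂ × ℂ}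
    (hp : p ∈ Metric.ball (0 : ℂ) (1 / (2 * B)) ×ˢ Metric.ball (0 : ℂ) (R / 2)) :
    DifferentiableAt ℂ (serG g) p := by
  have hsub : ∀ t ∈ Metric.ball (0 : ℂ) (R / 2), t ∈ Metric.ball (0 : ℂ) R := fun t ht =>
    Metric.ball_subset_ball (by linarith) ht
  have hdg : ∀ n, ∀ t ∈ Metric.ball (0 : ℂ) (R / 2), ‖deriv (g n) t‖ ≤ (2 / R) * B ^ n := by
    intro n t ht
    have ht' : ‖t‖ < R / 2 := by simpa using ht
    have hs : Metric.ball t (R / 2) ⊆ Metric.ball 0 R := by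
      intro y hy
      have h1 : ‖y - t‖ < R / 2 := by simpa [dist_eq_norm] using hy
      have h2 : ‖y‖ ≤ ‖y - t‖ + ‖t‖ := by simpa using norm_add_le (y - t) t
      simp only [Metric.mem_ball, dist_zero_right]
      linarith
    have hs' : Metric.closedBall t (R / 2) ⊆ Metric.ball 0 R := by
      intro y hy
      have h1 : ‖y - t‖ ≤ R / 2 := by simpa [dist_eq_norm] using hy
      have h2 : ‖y‖ ≤ ‖y - t‖ + ‖t‖ := by simpa using norm_add_le (y - t) t
      simp only [Metric.mem_ball, dist_zero_right]
      linarith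
    have := Complex.norm_deriv_le_of_forall_mem_sphere_norm_le (c := t) (R := R / 2) (C := B ^ n) (f := g n)
      (by linarith) (((hg n).mono hs').diffContOnCl_ball (subset_refl _))
      (fun y hy => hb n y (hs' (Metric.sphere_subset_closedBall hy)))
    calc _ ≤ _ := this
      _ = _ := by field_simp
  have hu : Summable (fun n : ℕ => (2 / R) * (1 / 2 : ℝ) ^ n + (2 * B) * ((n : ℝ) * (1 / 2) ^ n)) := by
    apply (summable_half.mul_left _).add
    apply Summable.mul_left
    simpa using summable_pow_mul_geometric_of_norm_lt_one (R := ℝ) 1 (r := 1 / 2) (by norm_num)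
  refine (hasFDerivAt_tsum_of_isPreconnected (𝕜 := ℂ) (f := fun n (p : ℂ × ℂ) => g n p.2 * p.1 ^ n)
    (f' := fun n p => g n p.2 • (((n : ℂ) * p.1 ^ (n - 1)) • ContinuousLinearMap.fst ℂ ℂ ℂ)
      + (p.1 ^ n) • (deriv (g n) p.2 • ContinuousLinearMap.snd ℂ ℂ ℂ)) (x₀ := p)
    hu (Metric.isOpen_ball.prod Metric.isOpen_ball)
    (((convex_ball _ _).prod (convex_ball _ _)).isPreconnected) ?_ ?_ hp ?_ hp).differentiableAt
  · intro n q hq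
    have h1 : HasDerivAt (g n) (deriv (g n) q.2) q.2 :=
      ((hg n).differentiableAt (Metric.isOpen_ball.mem_nhds (hsub _ hq.2))).hasDerivAt
    have h2 := h1.comp_hasFDerivAt q (hasFDerivAt_snd (𝕜 := ℂ) (p := q))
    have h3 := (hasDerivAt_pow n q.1).comp_hasFDerivAt q (hasFDerivAt_fst (𝕜 := ℂ) (p := q))
    exact h2.mul h3
  · intro n q hq
    have hz' : ‖q.1‖ < 1 / (2 * B) := by simpa using hq.1
    have hr0 : (0 : ℝ) < 1 / (2 * B) := by positivity
    have hfst : ‖ContinuousLinearMap.fst ℂ ℂ ℂ‖ ≤ 1 := ContinuousLinearMap.norm_fst_le ..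
    have hsnd : ‖ContinuousLinearMap.snd ℂ ℂ ℂ‖ ≤ 1 := ContinuousLinearMap.norm_snd_le ..
    have e1 : ‖g n q.2 • (((n : ℂ) * q.1 ^ (n - 1)) • ContinuousLinearMap.fst ℂ ℂ ℂ)‖ ≤
        (2 * B) * ((n : ℝ) * (1 / 2) ^ n) := by
      rw [norm_smul, norm_smul, norm_mul, norm_pow, Complex.norm_natCast]
      rcases Nat.eq_zero_or_pos n with h0 | h0
      · subst h0; simp
      calc ‖g n q.2‖ * ((n : ℝ) * ‖q.1‖ ^ (n - 1) * ‖ContinuousLinearMap.fst ℂ ℂ ℂ‖)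
          ≤ B ^ n * ((n : ℝ) * (1 / (2 * B)) ^ (n - 1) * 1) := by
            gcongr
            exact hb n _ (hsub _ hq.2)
        _ = (2 * B) * ((n : ℝ) * (1 / 2) ^ n) := by
            obtain ⟨m, rfl⟩ : ∃ m, n = m + 1 := ⟨n - 1, by omega⟩
            simp only [Nat.add_sub_cancel, one_div, inv_pow, mul_pow]
            rw [pow_succ B, pow_succ 2]; field_simp
    have e2 : ‖(q.1 ^ n) • (deriv (g n) q.2 • ContinuousLinearMap.snd ℂ ℂ ℂ)‖ ≤
        (2 / R) * (1 / 2 : ℝ) ^ n := by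
      rw [norm_smul, norm_smul, norm_pow]
      calc ‖q.1‖ ^ n * (‖deriv (g n) q.2‖ * ‖ContinuousLinearMap.snd ℂ ℂ ℂ‖)
          ≤ (1 / (2 * B)) ^ n * ((2 / R * B ^ n) * 1) := by
            gcongr
            exact hdg n _ hq.2
        _ = (2 / R) * (1 / 2 : ℝ) ^ n := by
            simp only [one_div, inv_pow, mul_pow]; field_simp
    calc _ ≤ _ := norm_add_le _ _
      _ ≤ _ := add_le_add e1 e2
      _ = _ := by ring
  · exact (serG_summable hB hb (hsub _ hp.2) hp.1).of_norm
end

lemma deriv_pole {F : ℂ → ℂ} {O : Set ℂ} (hO : IsOpen O) (hF : DifferentiableOn ℂ F O)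
    (a : ℂ) (k : ℕ) :
    ∀ z ∈ O \ {0}, deriv (fun z => a / z ^ (k + 1) + F z) z
      = (-(a * (k + 1))) / z ^ (k + 1 + 1) + deriv F z := by
  intro z hz
  have hz0 : z ≠ 0 := hz.2
  have h1 : HasDerivAt (fun z : ℂ => a / z ^ (k + 1)) ((-(a * (k + 1))) / z ^ (k + 1 + 1)) z := by
    have := (hasDerivAt_const z a).div (hasDerivAt_pow (k + 1) z) (pow_ne_zero _ hz0)
    refine this.congr_deriv ?_
    push_cast
    field_simp
    ring
  exact (h1.add (hF.differentiableAt (hO.mem_nhds hz.1)).hasDerivAt).deriv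

lemma deriv3_pole {F : ℂ → ℂ} {O : Set ℂ} (hO : IsOpen O) (hF : DifferentiableOn ℂ F O)
    (a : ℂ) : ∀ z ∈ O \ {0}, iteratedDeriv 3 (fun z => a / z ^ 2 + F z) z
      = (-24 * a) / z ^ 5 + iteratedDeriv 3 F z := by
  have hO' : IsOpen (O \ {0}) := hO.sdiff isClosed_singleton
  have k1 : Set.EqOn (deriv (fun z => a / z ^ 2 + F z)) (fun z => (-2 * a) / z ^ 3 + deriv F z) (O \ {0}) := by
    intro z hz; rw [deriv_pole hO hF a 1 z hz]; norm_num; ring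
  have hF1 := hF.deriv hO
  have k2 : Set.EqOn (deriv (deriv (fun z => a / z ^ 2 + F z)))
      (fun z => (6 * a) / z ^ 4 + deriv (deriv F) z) (O \ {0}) := by
    intro z hz; rw [k1.deriv hO' hz, deriv_pole hO hF1 _ 2 z hz]; norm_num; ring
  have hF2 := hF1.deriv hO
  intro z hz
  simp only [iteratedDeriv_succ, iteratedDeriv_zero]
  rw [k2.deriv hO' hz, deriv_pole hO hF2 _ 3 z hz]; norm_num; ring

lemma pole_limit {S : ℂ → ℂ} {c : ℕ → ℂ} {r : ℝ} (hr : 0 < r)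
    (hd : DifferentiableOn ℂ S (Metric.ball 0 r))
    (hS : ∀ z ∈ Metric.ball (0 : ℂ) r, HasSum (fun n => c n * z ^ n) (S z)) (k s : ℂ) (m : ℕ) :
    Tendsto (fun x => iteratedDeriv (m + 3) (fun x' => (x' - s) ^ 2 *
      (-12 / (x' - s) ^ 2 + (k + S (x' - s)))) x) (nhdsWithin s {s}ᶜ)
      (nhds (((m + 3).factorial : ℂ) * c (m + 1))) := by
  set ψ : ℂ → ℂ := fun z => -12 + z ^ 2 * (k + S z) with hψ
  have hdψ : DifferentiableOn ℂ ψ (Metric.ball 0 r) := by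
    rw [hψ]; fun_prop
  have hconst : ∀ e z : ℂ, HasSum (fun n : ℕ => (if n = 0 then e else 0) * z ^ n) e := by
    intro e z
    convert hasSum_single (f := fun n : ℕ => (if n = 0 then e else 0) * z ^ n) 0 ?_ using 1
    · simp
    · intro n hn; simp [hn]
  have hsum : ∀ z ∈ Metric.ball (0 : ℂ) r, HasSum (fun n => ((if n = 0 then -12 else 0) +
      psShift 2 (fun n => (if n = 0 then k else 0) + c n) n) * z ^ n) (ψ z) := by
    intro z hz
    have h1 : HasSum (fun n => ((if n = 0 then k else 0) + c n) * z ^ n) (k + S z) := by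
      simpa only [add_mul] using (hconst k z).add (hS z hz)
    simpa only [add_mul] using (hconst (-12) z).add (ps_shift 2 h1)
  have hcoef := ps_coeff hr hsum (m + 3)
  have han : AnalyticAt ℂ ψ 0 := hdψ.analyticAt (Metric.ball_mem_nhds 0 hr)
  have hcont : ContinuousAt (iteratedDeriv (m + 3) ψ) 0 := by
    rw [iteratedDeriv_eq_iterate]
    exact (han.iterated_deriv (m + 3)).continuousAt
  have hlim : Tendsto (fun x => iteratedDeriv (m + 3) ψ (x - s)) (nhds s) (nhds (iteratedDeriv (m + 3) ψ 0)) := by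
    have : Tendsto (fun x => x - s) (nhds s) (nhds 0) := by
      have : ContinuousAt (fun x : ℂ => x - s) s := by fun_prop
      simpa [ContinuousAt] using this
    exact hcont.tendsto.comp this
  have hval : iteratedDeriv (m + 3) ψ 0 = ((m + 3).factorial : ℂ) * c (m + 1) := by
    rw [hcoef]; simp [psShift]
  rw [hval] at hlim
  refine (hlim.mono_left nhdsWithin_le_nhds).congr' ?_
  filter_upwards [self_mem_nhdsWithin] with x hx
  have hne : ∀ᶠ y in nhds x, y ≠ s := isOpen_ne.mem_nhds hx
  have : (fun x' => (x' - s) ^ 2 * (-12 / (x' - s) ^ 2 + (k + S (x' - s)))) =ᶠ[nhds x]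
      fun x' => ψ (x' - s) := by
    filter_upwards [hne] with y hy
    have : y - s ≠ 0 := sub_ne_zero.2 hy
    simp only [hψ]; field_simp
  rw [this.iteratedDeriv_eq, iteratedDeriv_comp_sub_const]

open Filter

theorem joshi_petersen_wtc_convergence
    (ξ f4 f6 : ℂ → ℂ)
    (hξ : AnalyticAt ℂ ξ 0) (hξ0 : ξ 0 = 0)
    (hf4 : AnalyticAt ℂ f4 0) (hf6 : AnalyticAt ℂ f6 0) :
    ∃ V : Set (ℂ × ℂ), IsOpen V ∧ ((0, 0) : ℂ × ℂ) ∈ V ∧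
    ∃ (h : ℂ × ℂ → ℂ) (w : ℂ → ℂ → ℂ),
      DifferentiableOn ℂ h V ∧
      (∀ x t : ℂ, w x t = -12 / (x - ξ t) ^ 2 + h (x, t)) ∧
      (∀ p ∈ V, p.1 ≠ ξ p.2 →
        deriv (fun t' => w p.1 t') p.2
          + w p.1 p.2 * deriv (fun x' => w x' p.2) p.1
          + iteratedDeriv 3 (fun x' => w x' p.2) p.1 = 0) ∧
      (∀ᶠ t in nhds (0 : ℂ),
        Tendsto (fun x => iteratedDeriv 4 (fun x' => (x' - ξ t) ^ 2 * w x' t) x)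
          (nhdsWithin (ξ t) {ξ t}ᶜ) (nhds (f4 t)) ∧
        Tendsto (fun x => iteratedDeriv 6 (fun x' => (x' - ξ t) ^ 2 * w x' t) x)
          (nhdsWithin (ξ t) {ξ t}ᶜ) (nhds (f6 t))) := by
  set a : ℂ → ℂ := fun t => f4 t / 24 with ha
  set b : ℂ → ℂ := fun t => f6 t / 720 with hb
  set c : ℂ → ℂ := fun t => deriv (deriv ξ) t / 6 with hc
  have ana : AnalyticAt ℂ a 0 := hf4.div analyticAt_const (by norm_num)
  have anb : AnalyticAt ℂ b 0 := hf6.div analyticAt_const (by norm_num)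
  have anc : AnalyticAt ℂ c 0 := hξ.deriv.deriv.div analyticAt_const (by norm_num)
  set K : ℝ := 1 + ‖a 0‖ + ‖b 0‖ + ‖c 0‖ with hK
  have hK1 : 1 ≤ K := by
    have := norm_nonneg (a 0); have := norm_nonneg (b 0); have := norm_nonneg (c 0); linarith
  have bd : ∀ f : ℂ → ℂ, AnalyticAt ℂ f 0 → ‖f 0‖ < K → ∀ᶠ t in nhds (0 : ℂ), ‖f t‖ ≤ K := by
    intro f hf hlt
    filter_upwards [hf.continuousAt.norm.eventually_lt continuousAt_const hlt] with t ht using ht.le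
  have ha0 := norm_nonneg (a 0)
  have hb0 := norm_nonneg (b 0)
  have hc0 := norm_nonneg (c 0)
  have ev := ((((((ana.eventually_analyticAt.and anb.eventually_analyticAt).and
    anc.eventually_analyticAt).and hξ.eventually_analyticAt).and
    (bd a ana (by linarith))).and (bd b anb (by linarith))).and (bd c anc (by linarith)))
  obtain ⟨R0, hR0, hball⟩ := Metric.eventually_nhds_iff_ball.1 ev
  set R := min R0 1 with hRdef
  have hR : 0 < R := lt_min hR0 one_pos
  have hR1 : R ≤ 1 := min_le_right _ _
  have hball' : ∀ t ∈ Metric.ball (0 : ℂ) R, _ := fun t ht =>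
    hball t (Metric.ball_subset_ball (min_le_left _ _) ht)
  have da : DifferentiableOn ℂ a (Metric.ball 0 R) := fun t ht =>
    (hball' t ht).1.1.1.1.1.1.differentiableAt.differentiableWithinAt
  have db : DifferentiableOn ℂ b (Metric.ball 0 R) := fun t ht =>
    (hball' t ht).1.1.1.1.1.2.differentiableAt.differentiableWithinAt
  have dc : DifferentiableOn ℂ c (Metric.ball 0 R) := fun t ht =>
    (hball' t ht).1.1.1.1.2.differentiableAt.differentiableWithinAt
  have aξ : ∀ t ∈ Metric.ball (0 : ℂ) R, AnalyticAt ℂ ξ t := fun t ht => (hball' t ht).1.1.1.2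
  set g : ℕ → ℂ → ℂ := wtcG a c b with hg
  have hbnd := wtcG_bound hR1 hK1 da dc db (fun t ht => (hball' t ht).1.1.2)
    (fun t ht => (hball' t ht).2) (fun t ht => (hball' t ht).1.2)
  have hgd := wtcG_diff da dc db
  rw [← hg] at hbnd hgd
  set R1 := R / 2 with hR1def
  have hR1pos : 0 < R1 := by positivity
  set B : ℝ := K / R1 with hBdef
  have hB : 0 < B := by positivity
  have hsub1 : Metric.ball (0 : ℂ) R1 ⊆ Metric.ball 0 R := Metric.ball_subset_ball (by linarith)
  have hgd1 : ∀ n, DifferentiableOn ℂ (g n) (Metric.ball 0 R1) := fun n => (hgd n).mono hsub1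
  have hgb : ∀ n, ∀ t ∈ Metric.ball (0 : ℂ) R1, ‖g n t‖ ≤ B ^ n := by
    intro n t ht
    have ht' : ‖t‖ < R1 := by simpa using ht
    rw [hBdef, div_pow, le_div_iff₀ (by positivity)]
    refine le_trans ?_ (hbnd n t (hsub1 ht))
    gcongr
    linarith
  set r : ℝ := 1 / (2 * B) with hr
  have hrpos : 0 < r := by positivity
  have hsub2 : Metric.ball (0 : ℂ) (R1 / 2) ⊆ Metric.ball 0 R1 := Metric.ball_subset_ball (by linarith)
  have hSd : ∀ t ∈ Metric.ball (0 : ℂ) (R1 / 2),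
      DifferentiableOn ℂ (fun z => serG g (z, t)) (Metric.ball 0 r) := by
    intro t ht z hz
    have := serG_diff hR1pos hB hgd1 hgb (p := (z, t)) ⟨hz, ht⟩
    exact (this.comp z (f := fun z : ℂ => (z, t)) (by fun_prop)).differentiableWithinAt
  refine ⟨{p | p.2 ∈ Metric.ball (0 : ℂ) (R1 / 2) ∧ p.1 - ξ p.2 ∈ Metric.ball (0 : ℂ) r}, ?_, ?_,
    fun p => deriv ξ p.2 + serG g (p.1 - ξ p.2, p.2),
    fun x t => -12 / (x - ξ t) ^ 2 + (deriv ξ t + serG g (x - ξ t, t)), ?_, fun _ _ => rfl, ?_, ?_⟩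
  · have hco : ContinuousOn (fun p : ℂ × ℂ => p.1 - ξ p.2)
        (Prod.snd ⁻¹' Metric.ball (0 : ℂ) (R1 / 2)) := by
      intro p hp
      have h1 : ContinuousAt ξ p.2 := (aξ _ (hsub1 (hsub2 hp))).continuousAt
      exact (continuousAt_fst.sub (h1.comp continuousAt_snd)).continuousWithinAt
    exact hco.isOpen_inter_preimage (Metric.isOpen_ball.preimage continuous_snd) Metric.isOpen_ball
  · simp [hξ0, hR1pos, hrpos]
  · intro p hp
    have h1 := aξ _ (hsub1 (hsub2 hp.1))
    have hG := serG_diff hR1pos hB hgd1 hgb (p := (p.1 - ξ p.2, p.2)) ⟨hp.2, hp.1⟩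
    have hξp : DifferentiableAt ℂ (fun p : ℂ × ℂ => ξ p.2) p :=
      h1.differentiableAt.comp p differentiableAt_snd
    have hξ'p : DifferentiableAt ℂ (fun p : ℂ × ℂ => deriv ξ p.2) p :=
      h1.deriv.differentiableAt.comp p differentiableAt_snd
    have hin : DifferentiableAt ℂ (fun p : ℂ × ℂ => (p.1 - ξ p.2, p.2)) p :=
      (differentiableAt_fst.sub hξp).prodMk differentiableAt_snd
    exact (hξ'p.add (hG.comp p hin)).differentiableWithinAt
  · rintro ⟨x, t⟩ ⟨ht, hz⟩ hne
    simp only at ht hz hne ⊢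
    have h1 := aξ _ (hsub1 (hsub2 ht))
    have hG := serG_diff hR1pos hB hgd1 hgb (p := (x - ξ t, t)) ⟨hz, ht⟩
    have hz0 : x - ξ t ≠ 0 := sub_ne_zero.2 hne
    set S : ℂ → ℂ := fun z => serG g (z, t) with hS
    have hSd' := hSd t ht
    have hF : DifferentiableOn ℂ (fun z => deriv ξ t + S z) (Metric.ball 0 r) := hSd'.const_add _
    have x1 : deriv (fun x' => -12 / (x' - ξ t) ^ 2 + (deriv ξ t + serG g (x' - ξ t, t))) x
        = 24 / (x - ξ t) ^ 3 + deriv S (x - ξ t) := by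
      rw [deriv_comp_sub_const (f := fun z => -12 / z ^ 2 + (deriv ξ t + S z)),
        deriv_pole Metric.isOpen_ball hF (-12) 1 _ ⟨hz, hz0⟩, deriv_const_add]
      norm_num
    have x3 : iteratedDeriv 3 (fun x' => -12 / (x' - ξ t) ^ 2 + (deriv ξ t + serG g (x' - ξ t, t))) x
        = 288 / (x - ξ t) ^ 5 + iteratedDeriv 3 S (x - ξ t) := by
      rw [iteratedDeriv_comp_sub_const (f := fun z => -12 / z ^ 2 + (deriv ξ t + S z))]
      beta_reduce
      rw [deriv3_pole Metric.isOpen_ball hF (-12) _ ⟨hz, hz0⟩,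
        iteratedDeriv_const_add (by norm_num)]
      norm_num
    set T := deriv (fun t' => serG g (x - ξ t, t')) t with hT
    have t1 : deriv (fun t' => -12 / (x - ξ t') ^ 2 + (deriv ξ t' + serG g (x - ξ t', t'))) t
        = -24 * deriv ξ t / (x - ξ t) ^ 3 + (deriv (deriv ξ) t + (- deriv ξ t * deriv S (x - ξ t) + T)) := by
      have hξt := h1.differentiableAt.hasDerivAt
      have d0 : HasDerivAt (fun t' => x - ξ t') (- deriv ξ t) t := hξt.const_sub x
      have d1 : HasDerivAt (fun t' => -12 / (x - ξ t') ^ 2) (-24 * deriv ξ t / (x - ξ t) ^ 3) t := by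
        have := (hasDerivAt_const t (-12 : ℂ)).div (d0.pow 2) (pow_ne_zero 2 hz0)
        refine this.congr_deriv ?_
        simp only [Pi.pow_apply]
        push_cast
        field_simp
        ring
      have d2 := h1.deriv.differentiableAt.hasDerivAt
      have d3 : HasDerivAt (fun t' => serG g (x - ξ t', t')) (- deriv ξ t * deriv S (x - ξ t) + T) t := by
        have hin := d0.prodMk (hasDerivAt_id t)
        have hc1 := HasFDerivAt.comp_hasDerivAt t
          (f := fun t' => (x - ξ t', t')) hG.hasFDerivAt hin
        refine hc1.congr_deriv ?_
        have p1 : deriv S (x - ξ t) = fderiv ℂ (serG g) (x - ξ t, t) (1, 0) :=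
          (HasFDerivAt.comp_hasDerivAt (x - ξ t) (f := fun z : ℂ => (z, t)) hG.hasFDerivAt
            ((hasDerivAt_id _).prodMk (hasDerivAt_const _ _))).deriv
        have p2 : T = fderiv ℂ (serG g) (x - ξ t, t) (0, 1) :=
          (HasFDerivAt.comp_hasDerivAt t (f := fun t' : ℂ => (x - ξ t, t')) hG.hasFDerivAt
            ((hasDerivAt_const _ _).prodMk (hasDerivAt_id _))).deriv
        rw [p1, p2, ← smul_eq_mul, ← map_smul, ← map_add]
        simp
      exact (d1.add (d2.add d3)).deriv
    rw [x1, x3, t1]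
    have hrec : ∀ n : ℕ, g (n + 5) t = _ := fun n => wtcG_succ a c b n t
    have hg0 : g 0 = fun _ => 0 := by rw [hg, wtcG]
    have hg1 : g 1 = fun _ => 0 := by rw [hg, wtcG]
    have hg3 : g 3 = c := by rw [hg, wtcG]
    have pde := ps_pde (S := S) (c := fun n => g n t) (c' := fun n => deriv (g n) t) (r := r)
      (e := deriv (deriv ξ) t) (T := T) (z := x - ξ t) hrpos hSd'
      (fun z hz => serG_hasSum hB hgb (hsub2 ht) hz)
      (fun z hz => serG_summable hB hgb (hsub2 ht) hz) hz
      (serG_hasSum_deriv hB hgd1 hgb (hsub2 ht) hz)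
      (by simp [hg0]) (by simp [hg1]) (by simp [hg0]) (by simp [hg1])
      (by simp only [hg3, hc]; ring) hrec
    have eS : serG g (x - ξ t, t) = S (x - ξ t) := rfl
    rw [eS]
    generalize x - ξ t = z at *
    have : z ^ 3 ≠ 0 := pow_ne_zero _ hz0
    apply mul_left_cancel₀ this
    rw [mul_zero, ← pde]
    field_simp
    ring
  · filter_upwards [Metric.ball_mem_nhds (0 : ℂ) (half_pos hR1pos)] with t ht
    have L := fun m => pole_limit hrpos (hSd t ht) (fun z hz => serG_hasSum hB hgb (hsub2 ht) hz)
      (deriv ξ t) (ξ t) m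
    have hg2 : g 2 = a := by rw [hg, wtcG]
    have hg4 : g 4 = b := by rw [hg, wtcG]
    constructor
    · convert L 1 using 2
      simp only [hg2, ha, Nat.factorial]; push_cast; ring
    · convert L 3 using 2
      simp only [hg4, hb, Nat.factorial]; push_cast; ring
end

section
/- Let ρ > 0 and ε0 > 0, and let ξ, u4, u6 be holomorphic on the disk {t ∈ ℂ : |t| < 2ρ + ε0} with ξ(0) = 0. Set M = sup_{|t| = 2ρ} max{1, |ξ(t)|, |u4(t)|, |u6(t)|} and R = min{1, ρ}/(10 M). Then there exists a function h, holomorphic on the domain {(x,t) ∈ ℂ² : |t| < ρ and |x - ξ(t)| < R}, such that u(x,t) := -2/(x - ξ(t))² + h(x,t) satisfies the KdV equation u_t + 6uu_x + u_{xxx} = 0 at every point of this domain with x ≠ ξ(t), and for each t the Taylor expansion of x ↦ h(x,t) in powers of (x - ξ(t)) has constant coefficient ξ'(t)/6, vanishing first-order coefficient, second-order coefficient u4(t), and fourth-order coefficient u6(t). -/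
/-- Coefficients of the regular part of the WTC series. -/
noncomputable def wtcSeq (a b c : ℂ → ℂ) : ℕ → ℂ → ℂ
  | 0 => a
  | 1 => b
  | 2 => c
  | n + 3 => fun t => -(deriv (wtcSeq a b c n) t +
      6 * ∑ i : Fin n, (2 + (i.1 : ℂ)) * (wtcSeq a b c i.1 t * wtcSeq a b c (n - 1 - i.1) t)) /
        (((n : ℂ) + 3) * (n + 8) * (n + 1))
  termination_by n => n
  decreasing_by all_goals (try have := i.2); all_goals omega

lemma wtcSeq_succ (a b c : ℂ → ℂ) (n : ℕ) (t : ℂ) :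
    wtcSeq a b c (n + 3) t = -(deriv (wtcSeq a b c n) t +
      6 * ∑ i ∈ Finset.range n,
        (2 + (i : ℂ)) * (wtcSeq a b c i t * wtcSeq a b c (n - 1 - i) t)) /
        (((n : ℂ) + 3) * (n + 8) * (n + 1)) := by
  rw [wtcSeq, Finset.sum_range]

lemma wtcSeq_diff (a b c : ℂ → ℂ) (s : Set ℂ) (hs : IsOpen s)
    (ha : DifferentiableOn ℂ a s) (hb : DifferentiableOn ℂ b s) (hc : DifferentiableOn ℂ c s)
    (n : ℕ) : DifferentiableOn ℂ (wtcSeq a b c n) s := by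
  induction n using Nat.strong_induction_on with
  | _ n ih =>
    match n with
    | 0 => simpa [wtcSeq] using ha
    | 1 => simpa [wtcSeq] using hb
    | 2 => simpa [wtcSeq] using hc
    | n + 3 =>
      have : wtcSeq a b c (n + 3) = _ := funext fun t => wtcSeq_succ a b c n t
      rw [this]
      refine DifferentiableOn.div_const (DifferentiableOn.neg (DifferentiableOn.add
        ((ih n (by omega)).deriv hs) (DifferentiableOn.const_mul (DifferentiableOn.fun_sum ?_) _))) _
      intro i hi
      rw [Finset.mem_range] at hi
      exact ((ih i (by omega)).mul (ih (n - 1 - i) (by omega))).const_mul _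

lemma cauchy_nagumo (r A : ℝ) (N : ℕ) (f : ℂ → ℂ) (hA : 0 ≤ A)
    (hf : DifferentiableOn ℂ f (Metric.ball 0 r))
    (hb : ∀ t : ℂ, ‖t‖ < r → ‖f t‖ ≤ A / (r - ‖t‖) ^ N) (t : ℂ) (ht : ‖t‖ < r) :
    ‖deriv f t‖ ≤ (N + 1) ^ 2 * A / (r - ‖t‖) ^ (N + 1) := by
  set d := r - ‖t‖ with hd
  have hd0 : 0 < d := by linarith
  have main : ∀ s : ℝ, 0 < s → s < d → ‖deriv f t‖ ≤ A / (d - s) ^ N / s := by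
    intro s hs hsd
    have hsub : Metric.closedBall t s ⊆ Metric.ball 0 r := by
      intro z hz
      rw [Metric.mem_closedBall, dist_eq_norm] at hz
      rw [mem_ball_zero_iff]
      have : ‖z‖ ≤ ‖z - t‖ + ‖t‖ := by simpa using norm_add_le (z - t) t
      linarith
    apply Complex.norm_deriv_le_of_forall_mem_sphere_norm_le hs
    · apply DifferentiableOn.diffContOnCl
      rw [closure_ball _ hs.ne']
      exact hf.mono hsub
    · intro z hz
      have hz1 : ‖z - t‖ = s := by simpa [dist_eq_norm] using hz
      have : ‖z‖ ≤ ‖z - t‖ + ‖t‖ := by simpa using norm_add_le (z - t) t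
      refine (hb z (by linarith)).trans ?_
      apply div_le_div_of_nonneg_left hA (pow_pos (by linarith) _)
      apply pow_le_pow_left₀ (by linarith); linarith
  rcases Nat.eq_zero_or_pos N with h0 | h0
  · subst h0
    simp only [pow_zero, div_one] at main
    have : ∀ s ∈ Set.Ioo 0 d, ‖deriv f t‖ * s ≤ A := fun s hs => by
      have := main s hs.1 hs.2
      rwa [le_div_iff₀ hs.1] at this
    have h2 : ‖deriv f t‖ * d ≤ A := by
      have hcl : d ∈ closure (Set.Ioo 0 d) := by
        rw [closure_Ioo hd0.ne]; exact ⟨hd0.le, le_rfl⟩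
      exact le_on_closure (f := fun s => ‖deriv f t‖ * s) (g := fun _ => A) this
        (by fun_prop) (by fun_prop) hcl
    simp
    rwa [le_div_iff₀ hd0]
  · have hN : (1:ℝ) ≤ N := by exact_mod_cast h0
    have h1 := main (d / (N + 1)) (by positivity) (by
      rw [div_lt_iff₀ (by positivity)]; nlinarith)
    have e1 : d - d / (N + 1) = d * (1 + -(1 / ((N:ℝ) + 1))) := by field_simp; ring
    have hB : 1 / ((N:ℝ) + 1) ≤ (1 + -(1 / ((N:ℝ) + 1))) ^ N := by
      refine le_trans (le_of_eq ?_) (one_add_mul_le_pow (a := -(1 / ((N:ℝ) + 1))) ?_ N)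
      · field_simp; ring
      · have : 1 / ((N:ℝ) + 1) ≤ 1 := by rw [div_le_one (by positivity)]; linarith
        linarith
    refine h1.trans ?_
    rw [e1, mul_pow]
    have : A / (d ^ N * (1 + -(1 / ((N:ℝ) + 1))) ^ N) ≤ A / (d ^ N * (1 / ((N:ℝ) + 1))) := by
      gcongr
    calc _ ≤ A / (d ^ N * (1 / ((N:ℝ) + 1))) / (d / (N + 1)) := by gcongr
      _ = _ := by field_simp; ring

lemma wtcSeq_bound (a b c : ℂ → ℂ) (ρ M L : ℝ) (hM : 1 ≤ M)
    (hL1 : 10 * M ≤ L) (hL2 : 10 * M * ρ ≤ L)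
    (hda : DifferentiableOn ℂ a (Metric.ball 0 (2 * ρ)))
    (hdb : DifferentiableOn ℂ b (Metric.ball 0 (2 * ρ)))
    (hdc : DifferentiableOn ℂ c (Metric.ball 0 (2 * ρ)))
    (ha : ∀ t : ℂ, ‖t‖ < 2 * ρ → ‖a t‖ ≤ M)
    (hb : ∀ t : ℂ, ‖t‖ < 2 * ρ → ‖b t‖ ≤ M / (2 * ρ - ‖t‖) ^ 2)
    (hc : ∀ t : ℂ, ‖t‖ < 2 * ρ → ‖c t‖ ≤ M)
    (n : ℕ) : ∀ t : ℂ, ‖t‖ < 2 * ρ → ‖wtcSeq a b c n t‖ ≤ L ^ (n + 4) / (2 * ρ - ‖t‖) ^ (n + 4) := by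
  have hL0 : 0 < L := by linarith
  have hq : ∀ t : ℂ, ‖t‖ < 2 * ρ → 5 * M ≤ L / (2 * ρ - ‖t‖) := by
    intro t ht
    rw [le_div_iff₀ (by linarith)]
    nlinarith [norm_nonneg t]
  induction n using Nat.strong_induction_on with
  | _ n ih =>
    intro t ht
    have hqt := hq t ht
    have hd0 : 0 < 2 * ρ - ‖t‖ := by linarith
    have hMq : ∀ k, k ≠ 0 → M ≤ (L / (2 * ρ - ‖t‖)) ^ k := fun k hk =>
      le_trans (by linarith) (le_self_pow₀ (by linarith) hk)
    match n with
    | 0 => rw [← div_pow, wtcSeq]; exact (ha t ht).trans (hMq _ (by norm_num))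
    | 2 => rw [← div_pow, wtcSeq]; exact (hc t ht).trans (hMq _ (by norm_num))
    | 1 =>
      rw [← div_pow, wtcSeq]
      refine (hb t ht).trans ?_
      have h1 : M / (2 * ρ - ‖t‖) ^ 2 ≤ (L / (2 * ρ - ‖t‖)) ^ 2 := by
        rw [div_pow]; gcongr; nlinarith
      exact h1.trans (pow_le_pow_right₀ (by linarith) (by norm_num))
    | n + 3 =>
      rw [← div_pow, wtcSeq_succ, norm_div, norm_neg]
      have hden : ‖((n : ℂ) + 3) * (n + 8) * (n + 1)‖ = ((n : ℝ) + 3) * (n + 8) * (n + 1) := by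
        have : ((n : ℂ) + 3) * (n + 8) * (n + 1) = (((n + 3) * (n + 8) * (n + 1) : ℕ) : ℂ) := by
          push_cast; ring
        rw [this, Complex.norm_natCast]; push_cast; ring
      rw [hden, div_le_iff₀ (by positivity)]
      set d := 2 * ρ - ‖t‖ with hd
      have hder := cauchy_nagumo (2 * ρ) (L ^ (n + 4)) (n + 4) (wtcSeq a b c n) (by positivity)
        (wtcSeq_diff a b c _ Metric.isOpen_ball hda hdb hdc n) (ih n (by omega)) t ht
      rw [← hd] at hder
      have hder2 : ‖deriv (wtcSeq a b c n) t‖ ≤ (n + 5) ^ 2 / 250 * (L / d) ^ (n + 7) := by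
        refine hder.trans ?_
        have hLd : 5 * d ≤ L := by
          rw [le_div_iff₀ hd0] at hqt; nlinarith
        have h3 : 250 * d ^ 2 ≤ L ^ 3 := by
          have h10 : 10 ≤ L := by linarith
          have h25 : 25 * d ^ 2 ≤ L ^ 2 := by nlinarith
          nlinarith [sq_nonneg d]
        rw [div_pow, div_mul_div_comm, div_le_div_iff₀ (by positivity) (by positivity)]
        have e : ((((n + 4 : ℕ) : ℝ) + 1) ^ 2 * L ^ (n + 4)) * (250 * d ^ (n + 7))
          = ((n : ℝ) + 5) ^ 2 * L ^ (n + 4) * d ^ (n + 4 + 1) * (250 * d ^ 2) := by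
          push_cast; ring
        rw [e]
        calc _ ≤ ((n : ℝ) + 5) ^ 2 * L ^ (n + 4) * d ^ (n + 4 + 1) * L ^ 3 := by gcongr
          _ = _ := by ring
      have hsum : ‖∑ i ∈ Finset.range n,
          (2 + (i : ℂ)) * (wtcSeq a b c i t * wtcSeq a b c (n - 1 - i) t)‖ ≤
          n * ((n + 1) * (L / d) ^ (n + 7)) := by
        refine (norm_sum_le_of_le (n := fun _ => ((n : ℝ) + 1) * (L / d) ^ (n + 7)) _ ?_).trans ?_
        · intro i hi
          rw [Finset.mem_range] at hi
          rw [norm_mul, norm_mul]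
          have h1 := ih i (by omega) t ht
          have h2 := ih (n - 1 - i) (by omega) t ht
          rw [← hd, ← div_pow] at h1 h2
          have h3 : ‖2 + (i : ℂ)‖ ≤ (n : ℝ) + 1 := by
            have : (2 + (i : ℂ)) = ((2 + i : ℕ) : ℂ) := by push_cast; ring
            rw [this, Complex.norm_natCast]
            exact_mod_cast (by omega : 2 + i ≤ n + 1)
          have h4 : (L / d) ^ (n + 7) = (L / d) ^ (i + 4) * (L / d) ^ (n - 1 - i + 4) := by
            rw [← pow_add]; congr 1; omega
          rw [h4]
          gcongr
        · simp
      calc _ ≤ ‖deriv (wtcSeq a b c n) t‖ + ‖6 * ∑ i ∈ Finset.range n,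
          (2 + (i : ℂ)) * (wtcSeq a b c i t * wtcSeq a b c (n - 1 - i) t)‖ := norm_add_le _ _
        _ ≤ (n + 5) ^ 2 / 250 * (L / d) ^ (n + 7) + 6 * (n * ((n + 1) * (L / d) ^ (n + 7))) := by
          rw [norm_mul]; gcongr; simp
        _ = (L / d) ^ (n + 7) * (((n:ℝ) + 5) ^ 2 / 250 + 6 * (n * (n + 1))) := by ring
        _ ≤ (L / d) ^ (n + 7) * (((n : ℝ) + 3) * (n + 8) * (n + 1)) := by
          have hn : (0:ℝ) ≤ n := Nat.cast_nonneg n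
          gcongr
          nlinarith [mul_nonneg hn hn, mul_nonneg (mul_nonneg hn hn) hn]

/-- Polynomial times geometric growth. -/
def PolyGeom (K : ℝ) (a : ℕ → ℂ) : Prop :=
  ∃ (C : ℝ) (p : ℕ), 0 ≤ C ∧ ∀ k, ‖a k‖ ≤ C * ((k : ℝ) + 1) ^ p * K ^ k

/-- Sum of a power series. -/
noncomputable def psum (a : ℕ → ℂ) (z : ℂ) : ℂ := ∑' k, a k * z ^ k

/-- Coefficients of the derivative of a power series. -/
def dshift (a : ℕ → ℂ) (k : ℕ) : ℂ := ((k : ℂ) + 1) * a (k + 1)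

lemma summable_poly_geom (p : ℕ) (q : ℝ) (h0 : 0 ≤ q) (h1 : q < 1) :
    Summable fun k : ℕ => ((k : ℝ) + 1) ^ p * q ^ k := by
  rcases h0.eq_or_lt with h | h
  · subst h
    apply summable_of_ne_finset_zero (s := {0})
    intro b hb
    simp at hb
    simp [hb]
  have := summable_pow_mul_geometric_of_norm_lt_one p (r := q) (by
    rw [Real.norm_eq_abs, abs_of_nonneg h0]; exact h1)
  have h2 := ((summable_nat_add_iff 1).2 this).mul_right q⁻¹
  refine h2.congr fun k => ?_
  push_cast
  field_simp
  ring

lemma PolyGeom.summable {K : ℝ} {a : ℕ → ℂ} (ha : PolyGeom K a) (hK : 0 < K) {r : ℝ}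
    (hr0 : 0 ≤ r) (hr : K * r < 1) : Summable fun k => ‖a k‖ * r ^ k := by
  obtain ⟨C, p, hC, h⟩ := ha
  refine Summable.of_nonneg_of_le (fun k => by positivity) (fun k => ?_)
    ((summable_poly_geom p (K * r) (by positivity) hr).mul_left C)
  calc ‖a k‖ * r ^ k ≤ (C * ((k : ℝ) + 1) ^ p * K ^ k) * r ^ k := by gcongr; exact h k
    _ = _ := by rw [mul_pow]; ring

lemma PolyGeom.summable_norm {K : ℝ} {a : ℕ → ℂ} (ha : PolyGeom K a) (hK : 0 < K) {z : ℂ}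
    (hz : K * ‖z‖ < 1) : Summable fun k => ‖a k * z ^ k‖ := by
  simpa using ha.summable hK (norm_nonneg z) hz

lemma PolyGeom.dshift {K : ℝ} {a : ℕ → ℂ} (ha : PolyGeom K a) (hK : 0 < K) :
    PolyGeom K (dshift a) := by
  obtain ⟨C, p, hC, h⟩ := ha
  refine ⟨C * 2 ^ p * K, p + 1, by positivity, fun k => ?_⟩
  have h1 := h (k + 1)
  have e : ‖(k : ℂ) + 1‖ = (k : ℝ) + 1 := by
    have : (k : ℂ) + 1 = ((k + 1 : ℕ) : ℂ) := by push_cast; ring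
    rw [this, Complex.norm_natCast]; push_cast; ring
  rw [_root_.dshift, norm_mul, e]
  calc ((k : ℝ) + 1) * ‖a (k + 1)‖
      ≤ ((k : ℝ) + 1) * (C * (((k + 1 : ℕ) : ℝ) + 1) ^ p * K ^ (k + 1)) := by gcongr
    _ ≤ ((k : ℝ) + 1) * (C * (2 * ((k : ℝ) + 1)) ^ p * K ^ (k + 1)) := by
      gcongr
      push_cast
      have : (0 : ℝ) ≤ k := Nat.cast_nonneg k
      linarith
    _ = _ := by rw [mul_pow]; ring

lemma exists_between_radius {K : ℝ} (hK : 0 < K) {x : ℝ} (hx : 0 ≤ x) (h : K * x < 1) :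
    ∃ r, x < r ∧ 0 < r ∧ K * r < 1 := by
  have : x < K⁻¹ := by rw [← one_div, lt_div_iff₀ hK]; linarith
  obtain ⟨r, h1, h2⟩ := exists_between this
  refine ⟨r, h1, by linarith, ?_⟩
  calc K * r < K * K⁻¹ := by gcongr
    _ = 1 := mul_inv_cancel₀ hK.ne'

lemma psum_deriv_aux {K : ℝ} {a : ℕ → ℂ} (ha : PolyGeom K a) (hK : 0 < K) {z : ℂ}
    (hz : K * ‖z‖ < 1) : DifferentiableAt ℂ (psum a) z ∧
      HasSum (fun k : ℕ => a k * (k * z ^ (k - 1))) (deriv (psum a) z) := by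
  obtain ⟨r, h1, h2, h3⟩ := exists_between_radius hK (norm_nonneg z) hz
  have hb : ∀ (i : ℕ) (w : ℂ), w ∈ Metric.ball (0:ℂ) r → ‖a i * w ^ i‖ ≤ ‖a i‖ * r ^ i := by
    intro i w hw
    rw [mem_ball_zero_iff] at hw
    rw [norm_mul, norm_pow]
    gcongr
  have hm : z ∈ Metric.ball (0:ℂ) r := by simpa using h1
  have hd : ∀ i : ℕ, DifferentiableOn ℂ (fun w : ℂ => a i * w ^ i) (Metric.ball (0:ℂ) r) :=
    fun i => by fun_prop
  constructor
  · exact (Complex.differentiableOn_tsum_of_summable_norm (ha.summable hK h2.le h3) hd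
      Metric.isOpen_ball hb).differentiableAt (Metric.isOpen_ball.mem_nhds hm)
  · have := Complex.hasSum_deriv_of_summable_norm (ha.summable hK h2.le h3) hd
      Metric.isOpen_ball hb hm
    convert! this using 2 with k
    simp

lemma psum_hasDerivAt {K : ℝ} {a : ℕ → ℂ} (ha : PolyGeom K a) (hK : 0 < K) {z : ℂ}
    (hz : K * ‖z‖ < 1) : HasDerivAt (psum a) (psum (dshift a) z) z := by
  obtain ⟨h1, h2⟩ := psum_deriv_aux ha hK hz
  have h3 := (hasSum_nat_add_iff' 1).2 h2
  simp at h3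
  have : psum (dshift a) z = deriv (psum a) z := by
    rw [← h3.tsum_eq, psum]
    refine tsum_congr fun k => ?_
    rw [dshift]; ring
  rw [this]
  exact h1.hasDerivAt

lemma psum_dshift_hasSum {K : ℝ} {a : ℕ → ℂ} (ha : PolyGeom K a) (hK : 0 < K) {z : ℂ}
    (hz : K * ‖z‖ < 1) : HasSum (fun k : ℕ => (k : ℂ) * a k * z ^ k) (z * psum (dshift a) z) := by
  have h2 := (psum_deriv_aux ha hK hz).2
  rw [(psum_hasDerivAt ha hK hz).deriv] at h2
  convert! h2.mul_left z using 2 with k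
  rcases k with _ | k
  · simp
  · simp; ring

lemma psum_zero (a : ℕ → ℂ) : psum a 0 = a 0 := by
  rw [psum, tsum_eq_single 0]
  · simp
  · intro b hb; simp [hb]

lemma psum_hasSum {K : ℝ} {a : ℕ → ℂ} (ha : PolyGeom K a) (hK : 0 < K) {z : ℂ}
    (hz : K * ‖z‖ < 1) : HasSum (fun k : ℕ => a k * z ^ k) (psum a z) :=
  (ha.summable_norm hK hz).of_norm.hasSum

lemma joint_diff (g : ℕ → ℂ → ℂ) (ρ K C : ℝ) (hK : 0 < K) (hC : 0 ≤ C)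
    (hg : ∀ k, DifferentiableOn ℂ (g k) (Metric.ball 0 ρ))
    (hb : ∀ k t, ‖t‖ < ρ → ‖g k t‖ ≤ C * K ^ k)
    (hb' : ∀ k t, ‖t‖ < ρ → ‖deriv (g k) t‖ ≤ C * ((k : ℝ) + 1) ^ 2 * K ^ k)
    (z t : ℂ) (hz : K * ‖z‖ < 1) (ht : ‖t‖ < ρ) :
    DifferentiableAt ℂ (fun p : ℂ × ℂ => psum (fun k => g k p.2) p.1) (z, t) := by
  obtain ⟨r, h1, h2, h3⟩ := exists_between_radius hK (norm_nonneg z) hz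
  have hbb : ∀ (k : ℕ) (p : ℂ × ℂ), p ∈ Metric.ball (0:ℂ) r ×ˢ Metric.ball (0:ℂ) ρ →
      HasFDerivAt (fun p : ℂ × ℂ => g k p.2 * p.1 ^ k)
        (g k p.2 • ((k * p.1 ^ (k - 1)) • ContinuousLinearMap.fst ℂ ℂ ℂ) +
          p.1 ^ k • (deriv (g k) p.2 • ContinuousLinearMap.snd ℂ ℂ ℂ)) p := by
    intro k p hp
    have hd : HasDerivAt (g k) (deriv (g k) p.2) p.2 :=
      ((hg k).differentiableAt (Metric.isOpen_ball.mem_nhds hp.2)).hasDerivAt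
    have e1 := hd.comp_hasFDerivAt p (hasFDerivAt_snd (𝕜 := ℂ) (E := ℂ) (F := ℂ))
    have e2 := (hasDerivAt_pow k p.1).comp_hasFDerivAt p
      (hasFDerivAt_fst (𝕜 := ℂ) (E := ℂ) (F := ℂ))
    exact e1.mul e2
  have hsum : Summable fun k : ℕ => C * (1 / r + 1) * (((k : ℝ) + 1) ^ 2 * (K * r) ^ k) :=
    (summable_poly_geom 2 (K * r) (by positivity) h3).mul_left _
  have hmem : (z, t) ∈ Metric.ball (0:ℂ) r ×ˢ Metric.ball (0:ℂ) ρ := by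
    constructor <;> simpa
  refine (hasFDerivAt_tsum_of_isPreconnected hsum (Metric.isOpen_ball.prod Metric.isOpen_ball)
    ((convex_ball (0:ℂ) r).prod (convex_ball (0:ℂ) ρ)).isPreconnected hbb ?_
    hmem ?_ hmem).differentiableAt
  · intro k p hp
    have hp1 : ‖p.1‖ < r := by simpa using hp.1
    have hp2 : ‖p.2‖ < ρ := by simpa using hp.2
    have n1 : ‖(k : ℂ) * p.1 ^ (k - 1)‖ ≤ ((k : ℝ) + 1) ^ 2 * r ^ k / r := by
      rw [norm_mul, norm_pow, Complex.norm_natCast]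
      rcases k with _ | k
      · simp; positivity
      · have : ((k + 1 : ℕ) : ℝ) ≤ (((k + 1 : ℕ) : ℝ) + 1) ^ 2 := by
          have : (0:ℝ) ≤ ((k + 1 : ℕ) : ℝ) := Nat.cast_nonneg _
          nlinarith
        rw [pow_succ r k, ← mul_assoc, mul_div_assoc, div_self h2.ne', mul_one]
        simp only [Nat.add_sub_cancel]
        gcongr
    calc _ ≤ ‖g k p.2‖ * (‖(k : ℂ) * p.1 ^ (k - 1)‖ * 1) + ‖p.1‖ ^ k * (‖deriv (g k) p.2‖ * 1) := by
          refine (norm_add_le _ _).trans ?_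
          rw [norm_smul, norm_smul, norm_smul, norm_smul, norm_pow p.1 k]
          gcongr
          · exact ContinuousLinearMap.norm_fst_le ..
          · exact ContinuousLinearMap.norm_snd_le ..
      _ ≤ (C * K ^ k) * (((k : ℝ) + 1) ^ 2 * r ^ k / r * 1) +
          r ^ k * (C * ((k : ℝ) + 1) ^ 2 * K ^ k * 1) := by
          gcongr
          · exact hb k _ hp2
          · exact hb' k _ hp2
      _ = _ := by rw [mul_pow]; field_simp
  · have : PolyGeom K (fun k => g k t) := ⟨C, 0, hC, fun k => by simpa using hb k t ht⟩
    exact (this.summable_norm hK hz).of_norm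

lemma psum_deriv_t (g : ℕ → ℂ → ℂ) (ρ K C : ℝ) (hK : 0 < K) 
    (hg : ∀ k, DifferentiableOn ℂ (g k) (Metric.ball 0 ρ))
    (hb : ∀ k t, ‖t‖ < ρ → ‖g k t‖ ≤ C * K ^ k)
    (z t : ℂ) (hz : K * ‖z‖ < 1) (ht : ‖t‖ < ρ) :
    HasSum (fun k => deriv (g k) t * z ^ k) (deriv (fun s => psum (fun k => g k s) z) t) := by
  have hs : Summable fun k : ℕ => C * (((k : ℝ) + 1) ^ 0 * (K * ‖z‖) ^ k) :=
    (summable_poly_geom 0 (K * ‖z‖) (by positivity) hz).mul_left _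
  have hm : t ∈ Metric.ball (0:ℂ) ρ := by simpa using ht
  have := Complex.hasSum_deriv_of_summable_norm (F := fun k s => g k s * z ^ k) hs
    (fun k => (hg k).mul_const _) Metric.isOpen_ball ?_ hm
  · convert! this using 2 with k
    simp
  · intro k w hw
    rw [mem_ball_zero_iff] at hw
    rw [norm_mul, norm_pow, mul_pow, pow_zero, one_mul, ← mul_assoc]
    gcongr
    exact hb k w hw

lemma psum_curve (g : ℕ → ℂ → ℂ) (ρ K C : ℝ) (hK : 0 < K) (hC : 0 ≤ C)
    (hg : ∀ k, DifferentiableOn ℂ (g k) (Metric.ball 0 ρ))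
    (hb : ∀ k t, ‖t‖ < ρ → ‖g k t‖ ≤ C * K ^ k)
    (hb' : ∀ k t, ‖t‖ < ρ → ‖deriv (g k) t‖ ≤ C * ((k : ℝ) + 1) ^ 2 * K ^ k)
    (t : ℂ) (ht : ‖t‖ < ρ) (φ : ℂ → ℂ) (φ' : ℂ) (hφ : HasDerivAt φ φ' t)
    (hz : K * ‖φ t‖ < 1) :
    HasDerivAt (fun s => psum (fun k => g k s) (φ s))
      (φ' * psum (dshift fun k => g k t) (φ t) +
        deriv (fun s => psum (fun k => g k s) (φ t)) t) t := by
  have hF := (joint_diff g ρ K C hK hC hg hb hb' (φ t) t hz ht).hasFDerivAt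
  set F := fderiv ℂ (fun p : ℂ × ℂ => psum (fun k => g k p.2) p.1) (φ t, t)
  have hPG : PolyGeom K (fun k => g k t) := ⟨C, 0, hC, fun k => by simpa using hb k t ht⟩
  have c1 : HasDerivAt (fun w : ℂ => (w, t)) ((1 : ℂ), (0 : ℂ)) (φ t) :=
    (hasDerivAt_id _).prodMk (hasDerivAt_const _ _)
  have c2 : HasDerivAt (fun s : ℂ => (φ t, s)) ((0 : ℂ), (1 : ℂ)) t :=
    (hasDerivAt_const _ _).prodMk (hasDerivAt_id _)
  have c3 : HasDerivAt (fun s : ℂ => (φ s, s)) (φ', (1 : ℂ)) t :=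
    hφ.prodMk (hasDerivAt_id _)
  have d1 := hF.comp_hasDerivAt (φ t) c1
  have d2 := hF.comp_hasDerivAt t c2
  have d3 := HasFDerivAt.comp_hasDerivAt (f := fun s : ℂ => (φ s, s)) t hF c3
  have u1 : F (1, 0) = psum (dshift fun k => g k t) (φ t) :=
    d1.unique (psum_hasDerivAt hPG hK hz)
  have u2 : F (0, 1) = deriv (fun s => psum (fun k => g k s) (φ t)) t := d2.deriv.symm
  have u3 : F (φ', 1) = φ' * F (1, 0) + F (0, 1) := by
    rw [← smul_eq_mul, ← map_smul, ← map_add]; simp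
  rw [← u1, ← u2, ← u3]
  exact d3

lemma wtc_identity {K : ℝ} {a D : ℕ → ℂ} (ha : PolyGeom K a) (hK : 0 < K) {z T : ℂ}
    (hz : K * ‖z‖ < 1) (hT : HasSum (fun k => D k * z ^ k) T)
    (hrec : ∀ n : ℕ, a (n + 3) = -(D n +
      6 * ∑ i ∈ Finset.range n, (2 + (i : ℂ)) * (a i * a (n - 1 - i))) /
        (((n : ℂ) + 3) * (n + 8) * (n + 1))) :
    6 * a 1 + z ^ 2 * T + 6 * z ^ 3 * ((2 * psum a z + z * psum (dshift a) z) * psum a z) +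
      z ^ 2 * psum (dshift (dshift (dshift a))) z + 6 * z * psum (dshift (dshift a)) z
      - 6 * psum (dshift a) z = 0 := by
  have h1 := psum_hasSum (ha.dshift hK) hK hz
  have h2 := psum_dshift_hasSum (ha.dshift hK) hK hz
  have h3 := (psum_dshift_hasSum ((ha.dshift hK).dshift hK) hK hz).mul_left z
  have h3' : HasSum (fun k : ℕ => ((k : ℂ) - 1) * k * dshift a k * z ^ k)
      (z * (z * psum (dshift (dshift (dshift a))) z)) := by
    rw [← hasSum_nat_add_iff' 1]
    simp only [Finset.sum_range_one]
    convert! h3 using 1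
    · funext k
      simp only [dshift]
      push_cast; ring
    · simp
  have hQ := (h3'.add (h2.mul_left 6)).sub (h1.mul_left 6)
  have hQ' := (hasSum_nat_add_iff' 2).2 hQ
  have hc := psum_dshift_hasSum ha hK hz
  have h0 := psum_hasSum ha hK hz
  have hcs : HasSum (fun k : ℕ => (2 + (k : ℂ)) * a k * z ^ k)
      (2 * psum a z + z * psum (dshift a) z) := by
    convert! (h0.mul_left 2).add hc using 2 with k
    ring
  have hns : Summable fun k : ℕ => ‖(2 + (k : ℂ)) * a k * z ^ k‖ := hcs.summable.norm
  have hP := hasSum_sum_range_mul_of_summable_norm hns (ha.summable_norm hK hz)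
  rw [hcs.tsum_eq, h0.tsum_eq] at hP
  have hP' : HasSum (fun n : ℕ => (∑ i ∈ Finset.range n, (2 + (i : ℂ)) * (a i * a (n - 1 - i)))
      * z ^ (n + 2)) (z ^ 3 * ((2 * psum a z + z * psum (dshift a) z) * psum a z)) := by
    rw [← hasSum_nat_add_iff' 1]
    simp only [Finset.sum_range_one]
    convert! hP.mul_left (z ^ 3) using 1
    · funext n
      rw [Finset.mul_sum, Finset.sum_mul]
      refine Finset.sum_congr rfl fun i hi => ?_
      rw [Finset.mem_range] at hi
      have : z ^ (n + 1 + 2) = z ^ 3 * z ^ i * z ^ (n - i) := by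
        rw [← pow_add, ← pow_add]; congr 1; omega
      rw [this, Nat.add_sub_cancel]; ring
    · simp
  have hfin := (hQ'.add (hT.mul_left (z ^ 2))).add (hP'.mul_left 6)
  have hz0 : ∀ n : ℕ, ((n : ℂ) + 3) * (n + 8) * (n + 1) * a (n + 3) = -(D n +
      6 * ∑ i ∈ Finset.range n, (2 + (i : ℂ)) * (a i * a (n - 1 - i))) := by
    intro n
    rw [hrec n]
    have e1 : ((n : ℂ) + 3) ≠ 0 := by exact_mod_cast Nat.succ_ne_zero (n + 2)
    have e2 : ((n : ℂ) + 8) ≠ 0 := by exact_mod_cast Nat.succ_ne_zero (n + 7)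
    have e3 : ((n : ℂ) + 1) ≠ 0 := by exact_mod_cast Nat.succ_ne_zero n
    field_simp
  have hu := hfin.unique (a₂ := 0) (by
    convert! (hasSum_zero : HasSum (fun _ : ℕ => (0 : ℂ)) 0) using 1
    funext n
    have := hz0 n
    simp only [dshift]
    push_cast
    linear_combination z ^ (n + 2) * this)
  simp [Finset.sum_range_succ, dshift] at hu
  simp only [dshift] at *
  linear_combination hu

lemma iteratedDeriv_step {s : Set ℂ} (hs : IsOpen s) {f f1 : ℂ → ℂ}
    (h : ∀ x ∈ s, HasDerivAt f (f1 x) x) (n : ℕ) {x : ℂ} (hx : x ∈ s) :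
    iteratedDeriv (n + 1) f x = iteratedDeriv n f1 x := by
  rw [iteratedDeriv_succ']
  apply Filter.EventuallyEq.iteratedDeriv_eq
  filter_upwards [hs.mem_nhds hx] with y hy
  exact (h y hy).deriv

/-- `m`-th derivative of the sum of the power series, as a function of `x`. -/
noncomputable def shiftSum (a : ℕ → ℂ) (y : ℂ) (m : ℕ) (x : ℂ) : ℂ :=
  psum (dshift^[m] a) (x - y)

lemma shiftSum_hasDerivAt {K : ℝ} {a : ℕ → ℂ} (ha : PolyGeom K a) (hK : 0 < K) (y : ℂ)
    (m : ℕ) (x : ℂ) (hx : K * ‖x - y‖ < 1) :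
    HasDerivAt (shiftSum a y m) (shiftSum a y (m + 1) x) x := by
  have hPG : PolyGeom K (dshift^[m] a) := by
    induction m with
    | zero => exact ha
    | succ m ih => rw [Function.iterate_succ_apply']; exact ih.dshift hK
  have := (psum_hasDerivAt hPG hK hx).comp x ((hasDerivAt_id x).sub_const y)
  rw [shiftSum, Function.iterate_succ_apply']
  rw [mul_one] at this
  exact this

lemma reg_derivs {K : ℝ} {a : ℕ → ℂ} (ha : PolyGeom K a) (hK : 0 < K) (y c : ℂ)
    (x : ℂ) (hx : K * ‖x - y‖ < 1) :
    HasDerivAt (fun x => c + (x - y) ^ 2 * shiftSum a y 0 x)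
      (2 * (x - y) * shiftSum a y 0 x + (x - y) ^ 2 * shiftSum a y 1 x) x ∧
    HasDerivAt (fun x => 2 * (x - y) * shiftSum a y 0 x + (x - y) ^ 2 * shiftSum a y 1 x)
      (2 * shiftSum a y 0 x + 4 * (x - y) * shiftSum a y 1 x + (x - y) ^ 2 * shiftSum a y 2 x) x ∧
    HasDerivAt (fun x => 2 * shiftSum a y 0 x + 4 * (x - y) * shiftSum a y 1 x +
        (x - y) ^ 2 * shiftSum a y 2 x)
      (6 * shiftSum a y 1 x + 6 * (x - y) * shiftSum a y 2 x + (x - y) ^ 2 * shiftSum a y 3 x) x ∧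
    HasDerivAt (fun x => 6 * shiftSum a y 1 x + 6 * (x - y) * shiftSum a y 2 x +
        (x - y) ^ 2 * shiftSum a y 3 x)
      (12 * shiftSum a y 2 x + 8 * (x - y) * shiftSum a y 3 x + (x - y) ^ 2 * shiftSum a y 4 x) x := by
  have s0 := shiftSum_hasDerivAt ha hK y 0 x hx
  have s1 := shiftSum_hasDerivAt ha hK y 1 x hx
  have s2 := shiftSum_hasDerivAt ha hK y 2 x hx
  have s3 := shiftSum_hasDerivAt ha hK y 3 x hx
  have i1 : HasDerivAt (fun x : ℂ => x - y) 1 x := (hasDerivAt_id x).sub_const y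
  have i2 : HasDerivAt (fun x : ℂ => (x - y) ^ 2) (2 * (x - y)) x := by
    convert! i1.pow 2 using 1; simp
  refine ⟨?_, ?_, ?_, ?_⟩
  · convert! (i2.mul s0).const_add c using 1
  · convert! ((i1.const_mul 2).mul s0).add (i2.mul s1) using 1; ring
  · convert! ((s0.const_mul 2).add ((i1.const_mul 4).mul s1)).add (i2.mul s2) using 1; ring
  · convert! ((s1.const_mul 6).add ((i1.const_mul 6).mul s2)).add (i2.mul s3) using 1; ring

lemma sing_deriv (y A : ℂ) (n : ℕ) (x : ℂ) (hx : x ≠ y) :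
    HasDerivAt (fun x => A / (x - y) ^ n) (-(n * A) / (x - y) ^ (n + 1)) x := by
  have hxy : x - y ≠ 0 := sub_ne_zero.2 hx
  have i1 : HasDerivAt (fun x : ℂ => x - y) 1 x := (hasDerivAt_id x).sub_const y
  convert! (hasDerivAt_const x A).div (i1.pow n) (pow_ne_zero n hxy) using 1
  rcases n with _ | n
  · simp
  · simp only [Nat.add_sub_cancel, Pi.pow_apply]; field_simp; ring

lemma isOpen_reg (K : ℝ) (y : ℂ) : IsOpen {x : ℂ | K * ‖x - y‖ < 1} :=
  isOpen_lt (by fun_prop) continuous_const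

lemma reg_taylor {K : ℝ} {a : ℕ → ℂ} (ha : PolyGeom K a) (hK : 0 < K) (y c : ℂ) :
    deriv (fun x => c + (x - y) ^ 2 * shiftSum a y 0 x) y = 0 ∧
    iteratedDeriv 2 (fun x => c + (x - y) ^ 2 * shiftSum a y 0 x) y / 2 = a 0 ∧
    iteratedDeriv 4 (fun x => c + (x - y) ^ 2 * shiftSum a y 0 x) y / 24 = a 2 := by
  have hs := isOpen_reg K y
  have hy : y ∈ {x : ℂ | K * ‖x - y‖ < 1} := by simp
  have r := fun x (hx : x ∈ {x : ℂ | K * ‖x - y‖ < 1}) => reg_derivs ha hK y c x hx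
  refine ⟨?_, ?_, ?_⟩
  · rw [(r y hy).1.deriv]; simp
  · rw [iteratedDeriv_step hs (fun x hx => (r x hx).1) 1 hy,
      iteratedDeriv_step hs (fun x hx => (r x hx).2.1) 0 hy]
    simp [shiftSum, psum_zero]
  · rw [iteratedDeriv_step hs (fun x hx => (r x hx).1) 3 hy,
      iteratedDeriv_step hs (fun x hx => (r x hx).2.1) 2 hy,
      iteratedDeriv_step hs (fun x hx => (r x hx).2.2.1) 1 hy,
      iteratedDeriv_step hs (fun x hx => (r x hx).2.2.2) 0 hy]
    simp [shiftSum, psum_zero, dshift]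
    ring

lemma u_derivs {K : ℝ} {a : ℕ → ℂ} (ha : PolyGeom K a) (hK : 0 < K) (y c : ℂ)
    (x : ℂ) (hx : K * ‖x - y‖ < 1) (hxy : x ≠ y) :
    deriv (fun x => -2 / (x - y) ^ 2 + (c + (x - y) ^ 2 * shiftSum a y 0 x)) x =
      4 / (x - y) ^ 3 + (2 * (x - y) * shiftSum a y 0 x + (x - y) ^ 2 * shiftSum a y 1 x) ∧
    iteratedDeriv 3 (fun x => -2 / (x - y) ^ 2 + (c + (x - y) ^ 2 * shiftSum a y 0 x)) x =
      48 / (x - y) ^ 5 + (6 * shiftSum a y 1 x + 6 * (x - y) * shiftSum a y 2 x +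
        (x - y) ^ 2 * shiftSum a y 3 x) := by
  have hs : IsOpen ({x : ℂ | K * ‖x - y‖ < 1} ∩ {y}ᶜ) :=
    (isOpen_reg K y).inter isOpen_compl_singleton
  have hm : x ∈ {x : ℂ | K * ‖x - y‖ < 1} ∩ {y}ᶜ := ⟨hx, hxy⟩
  have r := fun x (hx : x ∈ {x : ℂ | K * ‖x - y‖ < 1} ∩ {y}ᶜ) => reg_derivs ha hK y c x hx.1
  have d1 : ∀ x ∈ {x : ℂ | K * ‖x - y‖ < 1} ∩ {y}ᶜ, HasDerivAt
      (fun x => -2 / (x - y) ^ 2 + (c + (x - y) ^ 2 * shiftSum a y 0 x))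
      (4 / (x - y) ^ 3 + (2 * (x - y) * shiftSum a y 0 x + (x - y) ^ 2 * shiftSum a y 1 x)) x := by
    intro x hx
    convert! (sing_deriv y (-2) 2 x hx.2).add (r x hx).1 using 2
    norm_num
  have d2 : ∀ x ∈ {x : ℂ | K * ‖x - y‖ < 1} ∩ {y}ᶜ, HasDerivAt
      (fun x => 4 / (x - y) ^ 3 +
        (2 * (x - y) * shiftSum a y 0 x + (x - y) ^ 2 * shiftSum a y 1 x))
      (-12 / (x - y) ^ 4 + (2 * shiftSum a y 0 x + 4 * (x - y) * shiftSum a y 1 x +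
        (x - y) ^ 2 * shiftSum a y 2 x)) x := by
    intro x hx
    convert! (sing_deriv y 4 3 x hx.2).add (r x hx).2.1 using 2
    norm_num
  have d3 : ∀ x ∈ {x : ℂ | K * ‖x - y‖ < 1} ∩ {y}ᶜ, HasDerivAt
      (fun x => -12 / (x - y) ^ 4 + (2 * shiftSum a y 0 x + 4 * (x - y) * shiftSum a y 1 x +
        (x - y) ^ 2 * shiftSum a y 2 x))
      (48 / (x - y) ^ 5 + (6 * shiftSum a y 1 x + 6 * (x - y) * shiftSum a y 2 x +
        (x - y) ^ 2 * shiftSum a y 3 x)) x := by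
    intro x hx
    convert! (sing_deriv y (-12) 4 x hx.2).add (r x hx).2.2.1 using 2
    norm_num
  refine ⟨(d1 x hm).deriv, ?_⟩
  rw [iteratedDeriv_step hs d1 2 hm, iteratedDeriv_step hs d2 1 hm,
    iteratedDeriv_step hs d3 0 hm, iteratedDeriv_zero]

theorem joshi_srinivasan_radius_bound
    (ρ ε0 : ℝ) (hρ : 0 < ρ) (hε0 : 0 < ε0)
    (ξ u4 u6 : ℂ → ℂ)
    (hξ : DifferentiableOn ℂ ξ (Metric.ball 0 (2 * ρ + ε0)))
    (hu4 : DifferentiableOn ℂ u4 (Metric.ball 0 (2 * ρ + ε0)))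
    (hu6 : DifferentiableOn ℂ u6 (Metric.ball 0 (2 * ρ + ε0)))
    (hξ0 : ξ 0 = 0)
    (M : ℝ)
    (hM : IsLUB ((fun t => max 1 (max ‖ξ t‖ (max ‖u4 t‖ ‖u6 t‖))) ''
      Metric.sphere (0 : ℂ) (2 * ρ)) M)
    (R : ℝ) (hR : R = min 1 ρ / (10 * M)) :
    ∃ (h : ℂ × ℂ → ℂ) (u : ℂ → ℂ → ℂ),
      DifferentiableOn ℂ h {p : ℂ × ℂ | ‖p.2‖ < ρ ∧ ‖p.1 - ξ p.2‖ < R} ∧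
      (∀ x t : ℂ, u x t = -2 / (x - ξ t) ^ 2 + h (x, t)) ∧
      (∀ x t : ℂ, ‖t‖ < ρ → ‖x - ξ t‖ < R → x ≠ ξ t →
        deriv (fun t' => u x t') t
          + 6 * u x t * deriv (fun x' => u x' t) x
          + iteratedDeriv 3 (fun x' => u x' t) x = 0) ∧
      (∀ t : ℂ, ‖t‖ < ρ →
        h (ξ t, t) = deriv ξ t / 6 ∧
        deriv (fun x => h (x, t)) (ξ t) = 0 ∧
        iteratedDeriv 2 (fun x => h (x, t)) (ξ t) / 2 = u4 t ∧
        iteratedDeriv 4 (fun x => h (x, t)) (ξ t) / 24 = u6 t) := by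
  -- bounds on the data
  have hsph : ∀ t : ℂ, ‖t‖ = 2 * ρ → 1 ≤ M ∧ ‖ξ t‖ ≤ M ∧ ‖u4 t‖ ≤ M ∧ ‖u6 t‖ ≤ M := by
    intro t ht
    have := hM.1 ⟨t, by simpa using ht, rfl⟩
    simpa using this
  have hM1 : 1 ≤ M := (hsph ((2 * ρ : ℝ) : ℂ) (by
    rw [Complex.norm_real, Real.norm_eq_abs, abs_of_pos (by positivity)])).1
  have hbd : ∀ f : ℂ → ℂ, DifferentiableOn ℂ f (Metric.ball 0 (2 * ρ + ε0)) →
      (∀ t : ℂ, ‖t‖ = 2 * ρ → ‖f t‖ ≤ M) → ∀ t : ℂ, ‖t‖ < 2 * ρ → ‖f t‖ ≤ M := by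
    intro f hf hfM t ht
    have h2 : (2 * ρ) ≠ 0 := by positivity
    refine Complex.norm_le_of_forall_mem_frontier_norm_le (U := Metric.ball 0 (2 * ρ))
      Metric.isBounded_ball ?_ ?_ (subset_closure (by simpa using ht))
    · apply DifferentiableOn.diffContOnCl
      rw [closure_ball _ h2]
      exact hf.mono (Metric.closedBall_subset_ball (by linarith))
    · intro z hz
      rw [frontier_ball _ h2] at hz
      exact hfM z (by simpa using hz)
  have hξM := hbd ξ hξ fun t ht => (hsph t ht).2.1
  have hu4M := hbd u4 hu4 fun t ht => (hsph t ht).2.2.1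
  have hu6M := hbd u6 hu6 fun t ht => (hsph t ht).2.2.2
  have hsub : Metric.ball (0:ℂ) (2 * ρ) ⊆ Metric.ball 0 (2 * ρ + ε0) :=
    Metric.ball_subset_ball (by linarith)
  have hsub2 : Metric.ball (0:ℂ) ρ ⊆ Metric.ball 0 (2 * ρ) :=
    Metric.ball_subset_ball (by linarith)
  have dξ := hξ.mono hsub
  have dξ1 := dξ.deriv Metric.isOpen_ball
  have dξ2 := dξ1.deriv Metric.isOpen_ball
  have bξ1 : ∀ t : ℂ, ‖t‖ < 2 * ρ → ‖deriv ξ t‖ ≤ M / (2 * ρ - ‖t‖) ^ 1 := by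
    intro t ht
    simpa using cauchy_nagumo (2 * ρ) M 0 ξ (by linarith) dξ (by simpa using hξM) t ht
  have bξ2 : ∀ t : ℂ, ‖t‖ < 2 * ρ → ‖deriv (deriv ξ) t / 36‖ ≤ M / (2 * ρ - ‖t‖) ^ 2 := by
    intro t ht
    have := cauchy_nagumo (2 * ρ) M 1 (deriv ξ) (by linarith) dξ1 bξ1 t ht
    have hp : 0 ≤ M / (2 * ρ - ‖t‖) ^ 2 := by positivity
    have e : (((1 : ℕ) : ℝ) + 1) ^ 2 * M / (2 * ρ - ‖t‖) ^ (1 + 1) = 4 * (M / (2 * ρ - ‖t‖) ^ 2) := by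
      push_cast; ring
    rw [e] at this
    rw [norm_div]
    have e36 : ‖(36 : ℂ)‖ = 36 := by simp
    rw [e36, div_le_iff₀ (by norm_num)]
    linarith
  -- constants
  have hR0 : 0 < R := by rw [hR]; have := lt_min one_pos hρ; positivity
  have hRM : R * (10 * M) = min 1 ρ := by rw [hR]; field_simp
  set K := R⁻¹ with hKdef
  have hK : 0 < K := inv_pos.2 hR0
  have hKR : ∀ x : ℝ, x < R → K * x < 1 := by
    intro x hx
    calc K * x < K * R := by gcongr
      _ = 1 := inv_mul_cancel₀ hR0.ne'
  have hL1 : 10 * M ≤ K * ρ := by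
    rw [hKdef, inv_mul_eq_div, le_div_iff₀ hR0, mul_comm, hRM]; exact min_le_right _ _
  have hL2 : 10 * M * ρ ≤ K * ρ := by
    have : 10 * M ≤ K := by
      rw [hKdef, ← one_div, le_div_iff₀ hR0, mul_comm, hRM]; exact min_le_left _ _
    gcongr
  set g := wtcSeq u4 (fun t => deriv (deriv ξ) t / 36) u6 with hg
  have gdiff := wtcSeq_diff u4 (fun t => deriv (deriv ξ) t / 36) u6 (Metric.ball 0 (2 * ρ))
    Metric.isOpen_ball (hu4.mono hsub) (dξ2.div_const _) (hu6.mono hsub)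
  have gb := wtcSeq_bound u4 (fun t => deriv (deriv ξ) t / 36) u6 ρ M (K * ρ) hM1 hL1 hL2
    (hu4.mono hsub) (dξ2.div_const _) (hu6.mono hsub) hu4M bξ2 hu6M
  rw [← hg] at gdiff gb
  have hKρ : 0 < K * ρ := by positivity
  set C : ℝ := K ^ 4 * (1 + 25 / ρ) with hC
  have hC0 : 0 ≤ C := by positivity
  have gb1 : ∀ k t, ‖t‖ < ρ → ‖g k t‖ ≤ C * K ^ k := by
    intro k t ht
    refine (gb k t (by linarith)).trans ?_
    calc (K * ρ) ^ (k + 4) / (2 * ρ - ‖t‖) ^ (k + 4)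
        ≤ (K * ρ) ^ (k + 4) / ρ ^ (k + 4) := by gcongr; linarith
      _ = K ^ 4 * 1 * K ^ k := by rw [mul_pow]; field_simp; ring
      _ ≤ C * K ^ k := by
        rw [hC]; gcongr
        have : 0 ≤ 25 / ρ := by positivity
        linarith
  have gb2 : ∀ k t, ‖t‖ < ρ → ‖deriv (g k) t‖ ≤ C * ((k : ℝ) + 1) ^ 2 * K ^ k := by
    intro k t ht
    refine (cauchy_nagumo (2 * ρ) ((K * ρ) ^ (k + 4)) (k + 4) (g k) (by positivity) (gdiff k)
      (gb k) t (by linarith)).trans ?_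
    calc (((k + 4 : ℕ) : ℝ) + 1) ^ 2 * (K * ρ) ^ (k + 4) / (2 * ρ - ‖t‖) ^ (k + 4 + 1)
        ≤ (5 * ((k : ℝ) + 1)) ^ 2 * (K * ρ) ^ (k + 4) / ρ ^ (k + 4 + 1) := by
          have : (0:ℝ) ≤ k := Nat.cast_nonneg k
          gcongr
          · push_cast; linarith
          · linarith
      _ = K ^ 4 * (25 / ρ) * ((k : ℝ) + 1) ^ 2 * K ^ k := by rw [mul_pow]; field_simp; ring
      _ ≤ C * ((k : ℝ) + 1) ^ 2 * K ^ k := by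
        rw [hC]; gcongr; linarith
  have gd : ∀ k, DifferentiableOn ℂ (g k) (Metric.ball 0 ρ) := fun k => (gdiff k).mono hsub2
  have hPG : ∀ t, ‖t‖ < ρ → PolyGeom K (fun k => g k t) := fun t ht =>
    ⟨C, 0, hC0, fun k => by simpa using gb1 k t ht⟩
  have hξd : ∀ t : ℂ, ‖t‖ < ρ → HasDerivAt ξ (deriv ξ t) t := fun t ht =>
    (dξ.differentiableAt (Metric.isOpen_ball.mem_nhds (hsub2 (by simpa using ht)))).hasDerivAt
  have hξd1 : ∀ t : ℂ, ‖t‖ < ρ → HasDerivAt (deriv ξ) (deriv (deriv ξ) t) t := fun t ht =>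
    (dξ1.differentiableAt (Metric.isOpen_ball.mem_nhds (hsub2 (by simpa using ht)))).hasDerivAt
  refine ⟨fun p => deriv ξ p.2 / 6 + (p.1 - ξ p.2) ^ 2 * psum (fun k => g k p.2) (p.1 - ξ p.2),
    fun x t => -2 / (x - ξ t) ^ 2 + (deriv ξ t / 6 + (x - ξ t) ^ 2 *
      psum (fun k => g k t) (x - ξ t)), ?_, fun x t => rfl, ?_, ?_⟩
  · rintro ⟨x, t⟩ ⟨ht, hx⟩
    simp only at ht hx
    apply DifferentiableAt.differentiableWithinAt
    have hj := joint_diff g ρ K C hK hC0 gd gb1 gb2 (x - ξ t) t (hKR _ hx) ht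
    have e1 : DifferentiableAt ℂ (fun p : ℂ × ℂ => ξ p.2) (x, t) :=
      DifferentiableAt.comp (x, t) (g := ξ) (hξd t ht).differentiableAt differentiableAt_snd
    have e2 : DifferentiableAt ℂ (fun p : ℂ × ℂ => deriv ξ p.2) (x, t) :=
      DifferentiableAt.comp (x, t) (g := deriv ξ) (hξd1 t ht).differentiableAt differentiableAt_snd
    have e3 : DifferentiableAt ℂ (fun p : ℂ × ℂ => p.1 - ξ p.2) (x, t) :=
      differentiableAt_fst.sub e1
    have e4 : DifferentiableAt ℂ (fun p : ℂ × ℂ => (p.1 - ξ p.2, p.2)) (x, t) :=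
      e3.prodMk differentiableAt_snd
    have e5 := DifferentiableAt.comp (f := fun p : ℂ × ℂ => (p.1 - ξ p.2, p.2)) (x, t) hj e4
    have e6 : DifferentiableAt ℂ (fun p : ℂ × ℂ => deriv ξ p.2 / 6) (x, t) := by
      simp only [div_eq_mul_inv]
      exact e2.mul_const _
    exact e6.add ((e3.pow 2).mul e5)
  · intro x t ht hx hxt
    have hz := hKR _ hx
    have hz0 : x - ξ t ≠ 0 := sub_ne_zero.2 hxt
    obtain ⟨hx1, hx3⟩ := u_derivs (hPG t ht) hK (ξ t) (deriv ξ t / 6) x hz hxt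
    simp only [shiftSum, Function.iterate_zero, id, Function.iterate_succ, Function.comp] at hx1 hx3
    have hT := psum_deriv_t g ρ K C hK gd gb1 (x - ξ t) t hz ht
    have hid := wtc_identity (hPG t ht) hK hz hT (fun n => wtcSeq_succ _ _ _ n t)
    have hφ : HasDerivAt (fun s => x - ξ s) (-deriv ξ t) t := (hξd t ht).const_sub x
    have hcur := psum_curve g ρ K C hK hC0 gd gb1 gb2 t ht (fun s => x - ξ s) _ hφ hz
    have hut := (((hasDerivAt_const t (-2 : ℂ)).div (hφ.pow 2) (pow_ne_zero 2 hz0)).add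
      (((hξd1 t ht).div_const 6).add ((hφ.pow 2).mul hcur))).deriv
    have hg1 : g 1 t = deriv (deriv ξ) t / 36 := by rw [hg, wtcSeq]
    rw [hx1, hx3]
    erw [hut]
    simp only [hg1] at hid
    simp only [Pi.pow_apply]
    generalize psum (fun k => g k t) (x - ξ t) = S0 at *
    generalize psum (dshift fun k => g k t) (x - ξ t) = S1 at *
    generalize psum (dshift (dshift fun k => g k t)) (x - ξ t) = S2 at *
    generalize psum (dshift (dshift (dshift fun k => g k t))) (x - ξ t) = S3 at *
    generalize deriv (fun s => psum (fun k => g k s) (x - ξ t)) t = T at *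
    clear hut hcur hφ hx1 hx3 hT
    generalize x - ξ t = z at *
    field_simp
    linear_combination z ^ 5 * 6 * hid
  · intro t ht
    have hg0 : g 0 t = u4 t := by rw [hg, wtcSeq]
    have hg2 : g 2 t = u6 t := by rw [hg, wtcSeq]
    obtain ⟨h1, h2, h3⟩ := reg_taylor (hPG t ht) hK (ξ t) (deriv ξ t / 6)
    simp only [hg0] at h2
    simp only [hg2] at h3
    exact ⟨by simp, h1, h2, h3⟩
end

section
/- Choose x0, α, β ∈ ℂ. Let Ω ⊆ ℂ be a connected open set containing x0 and let y_I : Ω → ℂ be holomorphic, satisfying the first Painlevé equation y_I''(x) = 6 y_I(x)² + x on Ω with y_I(x0) = α and y_I'(x0) = β. Then for every compact set K ⊆ Ω containing x0 there exists r_K > 0 such that: for every ε ∈ ℂ with 0 < |ε| < r_K there is a function y_ε, holomorphic on an open set containing K, satisfying y_ε''(x) = 6 y_ε(x)² + x + ε⁶(2 y_ε(x)³ + x y_ε(x)) on K with y_ε(x0) = α, y_ε'(x0) = β; moreover sup_{x ∈ K} |y_ε(x) - y_I(x)| → 0 as ε → 0. -/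
open Filter


namespace HJ
open Metric Set Topology

section ODE
variable {E : Type*} [NormedAddCommGroup E] [NormedSpace ℂ E]

lemma ray_hasDerivAt (z0 z : ℂ) (t : ℝ) :
    HasDerivAt (fun t : ℝ => z0 + (t : ℂ) * (z - z0)) (z - z0) t := by
  have h1 : HasDerivAt (fun t : ℝ => (t : ℂ)) 1 t := Complex.ofRealCLM.hasDerivAt
  simpa using (h1.mul_const (z - z0)).const_add z0

lemma ray_mem {z0 z : ℂ} {ρ : ℝ} (hz : z ∈ ball z0 ρ) {t : ℝ} (ht : t ∈ Icc (0:ℝ) 1) :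
    z0 + (t : ℂ) * (z - z0) ∈ ball z0 ρ := by
  rw [mem_ball, dist_eq_norm] at *
  have : ‖(t:ℂ)‖ ≤ 1 := by
    rw [Complex.norm_real, Real.norm_eq_abs, abs_of_nonneg ht.1]; exact ht.2
  calc ‖z0 + (t : ℂ) * (z - z0) - z0‖ = ‖(t:ℂ)‖ * ‖z - z0‖ := by rw [← norm_mul]; congr 1; ring
    _ ≤ 1 * ‖z - z0‖ := by gcongr
    _ < ρ := by linarith

/-- Gronwall estimate for two holomorphic solutions on a disc. -/
lemma gron {G : E → E} {s : Set E} {K : NNReal} (hG : LipschitzOnWith K G s)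
    {z0 : ℂ} {ρ : ℝ} {X₁ X₂ : ℂ → E}
    (h1 : ∀ z ∈ ball z0 ρ, HasDerivAt X₁ (G (X₁ z)) z ∧ X₁ z ∈ s)
    (h2 : ∀ z ∈ ball z0 ρ, HasDerivAt X₂ (G (X₂ z)) z ∧ X₂ z ∈ s)
    {z : ℂ} (hz : z ∈ ball z0 ρ) :
    dist (X₁ z) (X₂ z) ≤ dist (X₁ z0) (X₂ z0) * Real.exp (K * ρ) := by
  have key : ∀ (X : ℂ → E), (∀ z ∈ ball z0 ρ, HasDerivAt X (G (X z)) z ∧ X z ∈ s) →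
      ∀ t ∈ Icc (0:ℝ) 1, HasDerivAt (fun t : ℝ => X (z0 + (t : ℂ) * (z - z0)))
        ((z - z0) • G (X (z0 + (t : ℂ) * (z - z0)))) t := by
    intro X hX t ht
    exact HasDerivAt.scomp_of_eq (h := fun t : ℝ => z0 + (t : ℂ) * (z - z0)) t
      (hX _ (ray_mem hz ht)).1 (ray_hasDerivAt z0 z t) rfl
  have L : LipschitzOnWith (‖z - z0‖₊ * K) (fun x => (z - z0) • G x) s := by
    rw [lipschitzOnWith_iff_dist_le_mul] at *
    intro x hx y hy
    rw [dist_smul₀]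
    push_cast
    rw [mul_assoc]
    exact mul_le_mul_of_nonneg_left (hG x hx y hy) (norm_nonneg _)
  have := dist_le_of_trajectories_ODE_of_mem (a := 0) (b := 1)
    (v := fun _ x => (z - z0) • G x) (s := fun _ => s) (K := ‖z - z0‖₊ * K)
    (f := fun t : ℝ => X₁ (z0 + (t : ℂ) * (z - z0)))
    (g := fun t : ℝ => X₂ (z0 + (t : ℂ) * (z - z0))) (fun _ _ => L)
    (fun t ht => (key X₁ h1 t ht).continuousAt.continuousWithinAt)
    (fun t ht => (key X₁ h1 t (Ico_subset_Icc_self ht)).hasDerivWithinAt)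
    (fun t ht => (h1 _ (ray_mem hz (Ico_subset_Icc_self ht))).2)
    (fun t ht => (key X₂ h2 t ht).continuousAt.continuousWithinAt)
    (fun t ht => (key X₂ h2 t (Ico_subset_Icc_self ht)).hasDerivWithinAt)
    (fun t ht => (h2 _ (ray_mem hz (Ico_subset_Icc_self ht))).2) le_rfl 1 (by simp)
  simp only [Complex.ofReal_one, one_mul, Complex.ofReal_zero, zero_mul, add_zero,
    add_sub_cancel, sub_zero, mul_one] at this
  refine this.trans ?_
  gcongr
  push_cast
  rw [mul_comm]
  gcongr
  rw [← dist_eq_norm]; exact (mem_ball.1 hz).le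

/-- germ uniqueness -/
lemma germ_unique {G : E → E} (hG : ContDiff ℂ 1 G) {z0 : ℂ} {X₁ X₂ : ℂ → E}
    (h1 : ∀ᶠ z in 𝓝 z0, HasDerivAt X₁ (G (X₁ z)) z)
    (h2 : ∀ᶠ z in 𝓝 z0, HasDerivAt X₂ (G (X₂ z)) z) (h0 : X₁ z0 = X₂ z0) :
    X₁ =ᶠ[𝓝 z0] X₂ := by
  obtain ⟨K, t, ht, hL⟩ := (hG.contDiffAt (x := X₁ z0)).exists_lipschitzOnWith
  have c1 : ∀ᶠ z in 𝓝 z0, X₁ z ∈ t := h1.self_of_nhds.continuousAt ht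
  have c2 : ∀ᶠ z in 𝓝 z0, X₂ z ∈ t := h2.self_of_nhds.continuousAt (h0 ▸ ht)
  obtain ⟨ρ, hρ, h⟩ := eventually_nhds_iff_ball.1 ((h1.and c1).and (h2.and c2))
  refine eventually_nhds_iff_ball.2 ⟨ρ, hρ, fun z hz => ?_⟩
  have := gron hL (fun z hz => (h z hz).1) (fun z hz => (h z hz).2) hz
  rw [h0, dist_self, zero_mul] at this
  exact dist_le_zero.1 this

variable [CompleteSpace E]

/-- Holomorphic Picard theorem, quantitative form. -/
lemma picard_aux {G : E → E} (hGd : Differentiable ℂ G) {s : Set E} {K : NNReal}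
    (hL : LipschitzOnWith K G s) {B r ρ : ℝ} (hr : 0 < r) (hρ : 0 < ρ)
    (hB : ∀ x ∈ s, ‖G x‖ ≤ B) (hBρ : B * ρ ≤ r) (hK : K * ρ ≤ 1/2) (X0 : E)
    (hs : closedBall X0 r ⊆ s) (z0 : ℂ) :
    ∃ X : ℂ → E, X z0 = X0 ∧ ∀ z ∈ ball z0 ρ, HasDerivAt X (G (X z)) z ∧ X z ∈ s := by
  have hz0 : z0 ∈ ball z0 ρ := mem_ball_self hρ
  let Good : (ℂ → E) → Prop := fun X => X z0 = X0 ∧ DifferentiableOn ℂ X (ball z0 ρ) ∧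
    ∀ z ∈ ball z0 ρ, X z ∈ closedBall X0 r
  have step : ∀ X : {X // Good X}, ∃ X' : {X // Good X}, ∀ z ∈ ball z0 ρ,
      HasDerivAt X'.1 (G (X.1 z)) z := by
    rintro ⟨X, hX0, hXd, hXm⟩
    have hd : DifferentiableOn ℂ (fun z => G (X z)) (ball z0 ρ) :=
      hGd.comp_differentiableOn hXd
    obtain ⟨g, hg0, hg⟩ := hd.isExactOn_ball.with_val_at z0 X0
    refine ⟨⟨g, hg0, fun z hz => (hg z hz).differentiableAt.differentiableWithinAt,
      fun z hz => ?_⟩, hg⟩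
    have := (convex_ball z0 ρ).norm_image_sub_le_of_norm_hasDerivWithin_le
      (fun x hx => (hg x hx).hasDerivWithinAt) (fun x hx => hB _ (hs (hXm x hx))) hz0 hz
    rw [mem_closedBall, dist_eq_norm, ← hg0]
    refine this.trans (le_trans ?_ hBρ)
    have hB0 : 0 ≤ B := (norm_nonneg _).trans (hB _ (hs (hXm z0 hz0)))
    gcongr
    rw [← dist_eq_norm]; exact (mem_ball.1 hz).le
  choose N hN using step
  let X00 : {X // Good X} := ⟨fun _ => X0, rfl, differentiableOn_const _,
    fun z hz => mem_closedBall_self hr.le⟩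
  let S : ℕ → {X // Good X} := fun n => N^[n] X00
  have hS : ∀ n, ∀ z ∈ ball z0 ρ, HasDerivAt (S (n+1)).1 (G ((S n).1 z)) z := by
    intro n z hz
    have : S (n+1) = N (S n) := Function.iterate_succ_apply' _ _ _
    rw [this]; exact hN _ z hz
  have hdist : ∀ n, ∀ z ∈ ball z0 ρ, dist ((S n).1 z) ((S (n+1)).1 z) ≤ (2*r) * (1/2)^n := by
    intro n
    induction n with
    | zero =>
      intro z hz
      have h1 := (S 0).2.2.2 z hz
      have h2 := (S 1).2.2.2 z hz
      rw [mem_closedBall] at h1 h2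
      have := dist_triangle_right ((S 0).1 z) ((S 1).1 z) X0
      simp only [pow_zero, mul_one, zero_add]; linarith
    | succ n ih =>
      intro z hz
      have := (convex_ball z0 ρ).norm_image_sub_le_of_norm_hasDerivWithin_le
        (f := fun z => (S (n+1)).1 z - (S (n+2)).1 z) (C := K * ((2*r) * (1/2)^n))
        (f' := fun z => G ((S n).1 z) - G ((S (n+1)).1 z))
        (fun x hx => ((hS n x hx).sub (hS (n+1) x hx)).hasDerivWithinAt)
        (fun x hx => by
          rw [← dist_eq_norm]
          refine (hL.dist_le_mul _ (hs ((S n).2.2.2 x hx)) _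
            (hs ((S (n+1)).2.2.2 x hx))).trans ?_
          gcongr
          exact ih x hx) hz0 hz
      have e1 : (S (n+1)).1 z0 = X0 := (S (n+1)).2.1
      have e2 : (S (n+2)).1 z0 = X0 := (S (n+2)).2.1
      simp only [e1, e2, sub_self, sub_zero] at this
      rw [dist_eq_norm]
      refine this.trans ?_
      have hzz : ‖z - z0‖ ≤ ρ := by rw [← dist_eq_norm]; exact (mem_ball.1 hz).le
      calc K * ((2*r) * (1/2)^n) * ‖z - z0‖ ≤ K * ((2*r) * (1/2)^n) * ρ := by gcongr
        _ = (K * ρ) * ((2*r) * (1/2)^n) := by ring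
        _ ≤ (1/2) * ((2*r) * (1/2)^n) := by gcongr
        _ = _ := by ring
  have hlim : ∀ z, ∃ x, z ∈ ball z0 ρ → Tendsto (fun n => (S n).1 z) atTop (𝓝 x) := by
    intro z
    by_cases hz : z ∈ ball z0 ρ
    · obtain ⟨x, hx⟩ := cauchySeq_tendsto_of_complete
        (cauchySeq_of_le_geometric (1/2) (2*r) (by norm_num) (fun n => hdist n z hz))
      exact ⟨x, fun _ => hx⟩
    · exact ⟨0, fun h => absurd h hz⟩
  choose X hX using hlim
  have hunif : TendstoUniformlyOn (fun n => (S n).1) X atTop (ball z0 ρ) := by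
    rw [Metric.tendstoUniformlyOn_iff]
    intro ε hε
    have ht : Tendsto (fun n : ℕ => (2*r) * (1/2:ℝ)^n / (1 - 1/2)) atTop (𝓝 0) := by
      have := (tendsto_pow_atTop_nhds_zero_of_lt_one (r := (1/2:ℝ)) (by norm_num)
        (by norm_num)).const_mul (2*r)
      simpa using this.div_const (1 - 1/2)
    filter_upwards [ht.eventually (gt_mem_nhds hε)] with n hn z hz
    rw [dist_comm]
    exact (dist_le_of_le_geometric_of_tendsto (1/2) (2*r) (by norm_num)
      (fun n => hdist n z hz) (hX z hz) n).trans_lt hn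
  have hXs : ∀ z ∈ ball z0 ρ, X z ∈ closedBall X0 r := fun z hz =>
    isClosed_closedBall.mem_of_tendsto (hX z hz) (Eventually.of_forall
      (fun n => (S n).2.2.2 z hz))
  have hdiff : DifferentiableOn ℂ X (ball z0 ρ) :=
    hunif.tendstoLocallyUniformlyOn.differentiableOn
      (Eventually.of_forall (fun n => (S n).2.2.1)) isOpen_ball
  have hder := (hunif.tendstoLocallyUniformlyOn.deriv
      (Eventually.of_forall (fun n => (S n).2.2.1)) isOpen_ball)
  refine ⟨X, ?_, fun z hz => ⟨?_, hs (hXs z hz)⟩⟩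
  · refine tendsto_nhds_unique (hX z0 hz0) ?_
    have : (fun n => (S n).1 z0) = fun _ => X0 := funext fun n => (S n).2.1
    rw [this]; exact tendsto_const_nhds
  · have h1 := (hdiff.differentiableAt (isOpen_ball.mem_nhds hz)).hasDerivAt
    have h2 : Tendsto (fun n => deriv (S (n+1)).1 z) atTop (𝓝 (deriv X z)) :=
      (tendsto_add_atTop_iff_nat (f := fun n => deriv (S n).1 z) 1).2 (hder.tendsto_at hz)
    have h3 : Tendsto (fun n => deriv (S (n+1)).1 z) atTop (𝓝 (G (X z))) := by
      have : (fun n => deriv (S (n+1)).1 z) = fun n => G ((S n).1 z) :=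
        funext fun n => (hS n z hz).deriv
      rw [this]
      exact (hGd.continuous.tendsto _).comp (hX z hz)
    rwa [tendsto_nhds_unique h2 h3] at h1

lemma picard {G : E → E} (hG : ContDiff ℂ 1 G) (P : E) :
    ∃ ρ > 0, ∃ K : NNReal, ∃ s ∈ 𝓝 P, LipschitzOnWith K G s ∧ ∀ X0 ∈ ball P ρ, ∀ z0 : ℂ,
      ∃ X : ℂ → E, X z0 = X0 ∧ ∀ z ∈ ball z0 ρ, HasDerivAt X (G (X z)) z ∧ X z ∈ s := by
  obtain ⟨K, t, ht, hL⟩ := (hG.contDiffAt (x := P)).exists_lipschitzOnWith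
  obtain ⟨R, hR, hRt⟩ := Metric.mem_nhds_iff.1 ht
  set r := R / 3 with hr
  have hr0 : 0 < r := by positivity
  set B : ℝ := ‖G P‖ + K * R + 1 with hB
  have hB0 : 0 < B := by positivity
  set ρ := min r (min (r / B) (1 / (2 * (K + 1)))) with hρ
  have hρ0 : 0 < ρ := by positivity
  refine ⟨ρ, hρ0, K, ball P R, ball_mem_nhds _ hR, hL.mono hRt, fun X0 hX0 z0 => ?_⟩
  have hPt : P ∈ t := hRt (mem_ball_self hR)
  refine picard_aux (hG.differentiable (by norm_num)) (hL.mono hRt) (B := B) hr0 hρ0 ?_ ?_ ?_ X0 ?_ z0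
  · intro x hx
    have h1 := hL.dist_le_mul x (hRt hx) P hPt
    have h2 : ‖G x‖ ≤ ‖G P‖ + dist (G x) (G P) := by
      rw [dist_eq_norm]
      calc ‖G x‖ = ‖G P + (G x - G P)‖ := by congr 1; abel
        _ ≤ _ := norm_add_le _ _
    have h3 : (K:ℝ) * dist x P ≤ K * R := by gcongr; exact (mem_ball.1 hx).le
    linarith
  · have : ρ ≤ r / B := (min_le_right _ _).trans (min_le_left _ _)
    calc B * ρ ≤ B * (r / B) := by gcongr
      _ = r := by field_simp
  · have : ρ ≤ 1 / (2 * (K + 1)) := (min_le_right _ _).trans (min_le_right _ _)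
    have hK : (0:ℝ) ≤ K := K.2
    calc (K:ℝ) * ρ ≤ K * (1 / (2 * (K + 1))) := by gcongr
      _ ≤ (K+1) * (1 / (2 * (K + 1))) := by gcongr; linarith
      _ = 1/2 := by field_simp
  · intro x hx
    have : ρ ≤ r := min_le_left _ _
    have h1 := mem_ball.1 hX0
    have h2 := mem_closedBall.1 hx
    have := dist_triangle x X0 P
    rw [mem_ball]; linarith

lemma picard_compact {G : E → E} (hG : ContDiff ℂ 1 G) {C : Set E} (hC : IsCompact C) :
    ∃ ρ > 0, ∀ X0 ∈ C, ∀ z0 : ℂ,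
      ∃ X : ℂ → E, X z0 = X0 ∧ ∀ z ∈ ball z0 ρ, HasDerivAt X (G (X z)) z := by
  refine hC.induction_on (p := fun C => ∃ ρ > 0, ∀ X0 ∈ C, ∀ z0 : ℂ,
      ∃ X : ℂ → E, X z0 = X0 ∧ ∀ z ∈ ball z0 ρ, HasDerivAt X (G (X z)) z) ?_ ?_ ?_ ?_
  · exact ⟨1, one_pos, fun X0 h => absurd h (notMem_empty _)⟩
  · rintro s t hst ⟨ρ, hρ, h⟩
    exact ⟨ρ, hρ, fun X0 hX => h X0 (hst hX)⟩
  · rintro s t ⟨ρ, hρ, h⟩ ⟨ρ', hρ', h'⟩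
    refine ⟨min ρ ρ', lt_min hρ hρ', ?_⟩
    rintro X0 (hX | hX) z0
    · obtain ⟨X, h0, h1⟩ := h X0 hX z0
      exact ⟨X, h0, fun z hz => h1 z (ball_subset_ball (min_le_left _ _) hz)⟩
    · obtain ⟨X, h0, h1⟩ := h' X0 hX z0
      exact ⟨X, h0, fun z hz => h1 z (ball_subset_ball (min_le_right _ _) hz)⟩
  · intro P _
    obtain ⟨ρ, hρ, K, s, hs, hL, h⟩ := picard hG P
    refine ⟨ball P ρ, mem_nhdsWithin_of_mem_nhds (ball_mem_nhds _ hρ), ρ, hρ, fun X0 hX z0 => ?_⟩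
    obtain ⟨X, h0, h1⟩ := h X0 hX z0
    exact ⟨X, h0, fun z hz => (h1 z hz).1⟩

end ODE
end HJ

namespace HJ
open Metric Set Topology

/-- identity theorem for meromorphic functions in normal form -/
lemma mero_id {f g : ℂ → ℂ} {U : Set ℂ} (hU : IsPreconnected U)
    (hf : ∀ x ∈ U, MeromorphicNFAt f x) (hg : ∀ x ∈ U, MeromorphicNFAt g x) {c : ℂ} (hc : c ∈ U)
    (h : f =ᶠ[𝓝 c] g) {x : ℂ} (hx : x ∈ U) : f =ᶠ[𝓝 x] g := by
  rw [← (hf x hx).eventuallyEq_nhdsNE_iff_eventuallyEq_nhds (hg x hx)]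
  have hm : MeromorphicOn (f - g) U := fun y hy =>
    (hf y hy).meromorphicAt.sub (hg y hy).meromorphicAt
  by_contra hne
  have h1 : meromorphicOrderAt (f - g) x ≠ ⊤ := by
    intro h2
    apply hne
    rw [meromorphicOrderAt_eq_top_iff] at h2
    filter_upwards [h2] with y hy
    exact sub_eq_zero.1 hy
  have h2 := hm.meromorphicOrderAt_ne_top_of_isPreconnected hU hx hc h1
  apply h2
  rw [meromorphicOrderAt_eq_top_iff]
  filter_upwards [h.filter_mono nhdsWithin_le_nhds] with y hy
  simp [hy]

/-- `w` is (the germ of) a meromorphic solution of `P_II` at `x`, in normal form. -/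
def Sol (A : ℂ) (w : ℂ → ℂ) (x : ℂ) : Prop :=
  MeromorphicNFAt w x ∧ ∀ᶠ y in 𝓝[≠] x, deriv (deriv w) y = 2 * w y ^ 3 + y * w y + A

lemma Sol.congr {A : ℂ} {w w' : ℂ → ℂ} {x : ℂ} (h : w =ᶠ[𝓝 x] w') (hs : Sol A w x) :
    Sol A w' x := by
  refine ⟨(meromorphicNFAt_congr h).1 hs.1, ?_⟩
  have h2 : deriv (deriv w) =ᶠ[𝓝 x] deriv (deriv w') := h.deriv.deriv
  filter_upwards [hs.2, h.filter_mono nhdsWithin_le_nhds, h2.filter_mono nhdsWithin_le_nhds]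
    with y h1 h2 h3
  rw [← h3, ← h2, h1]

lemma Sol.ode {A : ℂ} {w : ℂ → ℂ} {x : ℂ} (h : Sol A w x) (ha : AnalyticAt ℂ w x) :
    ∀ᶠ y in 𝓝 x, AnalyticAt ℂ w y ∧ deriv (deriv w) y = 2 * w y ^ 3 + y * w y + A := by
  refine ha.eventually_analyticAt.and ?_
  have h1 : AnalyticAt ℂ (deriv (deriv w)) x := ha.deriv.deriv
  have h2 : AnalyticAt ℂ (fun y => 2 * w y ^ 3 + y * w y + A) x := by fun_prop
  exact (h1.frequently_eq_iff_eventually_eq h2).1 h.2.frequently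

lemma sol_of_analytic {A : ℂ} {w : ℂ → ℂ} {x : ℂ} (ha : AnalyticAt ℂ w x)
    (h : ∀ᶠ y in 𝓝 x, deriv (deriv w) y = 2 * w y ^ 3 + y * w y + A) : Sol A w x :=
  ⟨ha.meromorphicNFAt, h.filter_mono nhdsWithin_le_nhds⟩

/-- `P_II` as an autonomous system -/
def G2 (A : ℂ) : ℂ × ℂ × ℂ → ℂ × ℂ × ℂ :=
  fun X => (1, X.2.2, 2 * X.2.1 ^ 3 + X.1 * X.2.1 + A)

/-- `P_II` in the charts near infinity -/
noncomputable def Gs (A s : ℂ) : ℂ × ℂ × ℂ → ℂ × ℂ × ℂ :=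
  fun X => (1, s + s * X.1 * X.2.1 ^ 2 / 2 + (1/2 + s * A) * X.2.1 ^ 3 + X.2.2 * X.2.1 ^ 4,
    - (s * X.1 * (1/2 + s * A) / 2) - ((1/2 + s * A) ^ 2 + s * X.1 * X.2.2) * X.2.1
      - 3 * (1/2 + s * A) * X.2.2 * X.2.1 ^ 2 - 2 * X.2.2 ^ 2 * X.2.1 ^ 3)

lemma G2_contDiff (A : ℂ) : ContDiff ℂ 1 (G2 A) := by
  unfold G2; fun_prop

lemma Gs_contDiff (A s : ℂ) : ContDiff ℂ 1 (Gs A s) := by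
  unfold Gs; fun_prop

lemma affine_of_deriv {f : ℂ → ℂ} {c k : ℂ} {ρ : ℝ}
    (h : ∀ z ∈ ball c ρ, HasDerivAt f k z) {z : ℂ} (hz : z ∈ ball c ρ) :
    f z = f c + k * (z - c) := by
  have hc : c ∈ ball c ρ := mem_ball_self (pos_of_mem_ball hz)
  have := (convex_ball c ρ).norm_image_sub_le_of_norm_hasDerivWithin_le (C := 0)
    (f := fun z => f z - k * z) (f' := fun _ => 0)
    (fun x hx => by
      have := (h x hx).sub ((hasDerivAt_id x).const_mul k)
      simp only [mul_one, sub_self] at this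
      exact this.hasDerivWithinAt) (fun x hx => by simp) hc hz
  rw [zero_mul, norm_le_zero_iff] at this
  linear_combination this

lemma analytic_of_hasDeriv {f f' : ℂ → ℂ} {c : ℂ} {ρ : ℝ}
    (h : ∀ z ∈ ball c ρ, HasDerivAt f (f' z) z) {z : ℂ} (hz : z ∈ ball c ρ) :
    AnalyticAt ℂ f z :=
  DifferentiableOn.analyticAt (s := ball c ρ)
    (fun x hx => (h x hx).differentiableAt.differentiableWithinAt) (isOpen_ball.mem_nhds hz)

lemma comp1 {E F : Type*} [NormedAddCommGroup E] [NormedSpace ℂ E] [NormedAddCommGroup F]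
    [NormedSpace ℂ F] {X : ℂ → E × F} {X' : E × F} {z : ℂ} (h : HasDerivAt X X' z) :
    HasDerivAt (fun z => (X z).1) X'.1 z :=
  HasFDerivAt.comp_hasDerivAt (l := Prod.fst) z (hasFDerivAt_fst (𝕜 := ℂ) (p := X z)) h

lemma comp2 {E F : Type*} [NormedAddCommGroup E] [NormedSpace ℂ E] [NormedAddCommGroup F]
    [NormedSpace ℂ F] {X : ℂ → E × F} {X' : E × F} {z : ℂ} (h : HasDerivAt X X' z) :
    HasDerivAt (fun z => (X z).2) X'.2 z :=
  HasFDerivAt.comp_hasDerivAt (l := Prod.snd) z (hasFDerivAt_snd (𝕜 := ℂ) (p := X z)) h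

lemma sol_of_G2 {A c : ℂ} {ρ : ℝ} {X : ℂ → ℂ × ℂ × ℂ}
    (hX : ∀ z ∈ ball c ρ, HasDerivAt X (G2 A (X z)) z) (h0 : (X c).1 = c) {z : ℂ}
    (hz : z ∈ ball c ρ) :
    Sol A (fun z => (X z).2.1) z ∧ AnalyticAt ℂ (fun z => (X z).2.1) z ∧
      deriv (fun z => (X z).2.1) z = (X z).2.2 := by
  have d1 : ∀ z ∈ ball c ρ, HasDerivAt (fun z => (X z).1) 1 z := fun z hz => comp1 (hX z hz)
  have d2 : ∀ z ∈ ball c ρ, HasDerivAt (fun z => (X z).2.1) (X z).2.2 z :=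
    fun z hz => comp1 (comp2 (hX z hz))
  have d3 : ∀ z ∈ ball c ρ, HasDerivAt (fun z => (X z).2.2) (G2 A (X z)).2.2 z :=
    fun z hz => comp2 (comp2 (hX z hz))
  have e1 : ∀ z ∈ ball c ρ, (X z).1 = z := fun z hz => by
    rw [affine_of_deriv d1 hz, h0]; ring
  have an := analytic_of_hasDeriv d2 hz
  refine ⟨sol_of_analytic an ?_, an, (d2 z hz).deriv⟩
  filter_upwards [isOpen_ball.mem_nhds hz] with y hy
  have : deriv (fun z => (X z).2.1) =ᶠ[𝓝 y] fun z => (X z).2.2 := by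
    filter_upwards [isOpen_ball.mem_nhds hy] with x hx using (d2 x hx).deriv
  rw [this.deriv_eq, (d3 y hy).deriv]
  simp only [G2, e1 y hy]

lemma sol_of_Gs {A s c : ℂ} (hs : s ^ 2 = 1) {ρ : ℝ} {X : ℂ → ℂ × ℂ × ℂ}
    (hX : ∀ z ∈ ball c ρ, HasDerivAt X (Gs A s (X z)) z) (h0 : (X c).1 = c) {z : ℂ}
    (hz : z ∈ ball c ρ) :
    Sol A (fun z => (X z).2.1)⁻¹ z ∧ ((X z).2.1 ≠ 0 →
      HasDerivAt (fun z => (X z).2.1)⁻¹ (- (Gs A s (X z)).2.1 / (X z).2.1 ^ 2) z) := by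
  have d1 : ∀ z ∈ ball c ρ, HasDerivAt (fun z => (X z).1) 1 z := fun z hz => comp1 (hX z hz)
  have d2 : ∀ z ∈ ball c ρ, HasDerivAt (fun z => (X z).2.1) (Gs A s (X z)).2.1 z :=
    fun z hz => comp1 (comp2 (hX z hz))
  have d3 : ∀ z ∈ ball c ρ, HasDerivAt (fun z => (X z).2.2) (Gs A s (X z)).2.2 z :=
    fun z hz => comp2 (comp2 (hX z hz))
  have e1 : ∀ z ∈ ball c ρ, (X z).1 = z := fun z hz => by
    rw [affine_of_deriv d1 hz, h0]; ring
  have an := analytic_of_hasDeriv d2 hz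
  have dw : ∀ z ∈ ball c ρ, (X z).2.1 ≠ 0 →
      HasDerivAt (fun z => (X z).2.1)⁻¹ (- (Gs A s (X z)).2.1 / (X z).2.1 ^ 2) z :=
    fun z hz hne => (d2 z hz).inv hne
  refine ⟨⟨an.meromorphicNFAt.inv, ?_⟩, dw z hz⟩
  have hne : ∀ᶠ y in 𝓝[≠] z, (X y).2.1 ≠ 0 := by
    by_cases hu : (X z).2.1 = 0
    · have h1 := d2 z hz
      have h2 : (Gs A s (X z)).2.1 = s := by simp [Gs, hu]
      rw [h2] at h1
      have hs0 : s ≠ 0 := by rintro rfl; norm_num at hs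
      exact h1.eventually_ne hs0
    · exact ((d2 z hz).continuousAt.eventually_ne hu).filter_mono nhdsWithin_le_nhds
  filter_upwards [hne, nhdsWithin_le_nhds (isOpen_ball.mem_nhds hz)] with y hu hy
  have : deriv (fun z => (X z).2.1)⁻¹ =ᶠ[𝓝 y] fun z => - (s + s * (X z).1 * (X z).2.1 ^ 2 / 2 +
      (1/2 + s * A) * (X z).2.1 ^ 3 + (X z).2.2 * (X z).2.1 ^ 4) / (X z).2.1 ^ 2 := by
    filter_upwards [isOpen_ball.mem_nhds hy, (d2 y hy).continuousAt.eventually_ne hu] with x hx hux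
      using (dw x hx hux).deriv
  rw [this.deriv_eq]
  have D1 := d1 y hy
  have D2 := d2 y hy
  have D3 := d3 y hy
  have DD := ((((((D1.const_mul s).mul (D2.pow 2)).div_const 2).const_add s).add
    ((D2.pow 3).const_mul (1/2 + s * A))).add (D3.mul (D2.pow 4))).neg.div (D2.pow 2)
      (pow_ne_zero 2 hu)
  have ey := e1 y hy
  simp only [Gs, ey] at DD
  refine Eq.trans (show deriv _ y = _ from DD.deriv) ?_
  simp only [Pi.pow_apply, Pi.neg_apply, Pi.add_apply, Pi.mul_apply, Pi.inv_apply, ey]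
  generalize (X y).2.1 = u at hu ⊢
  generalize (X y).2.2 = v
  rcases (show s = 1 ∨ s = -1 from by simpa using hs) with rfl | rfl
  · field_simp
    ring
  · field_simp
    ring

end HJ

namespace HJ
open Metric Set Topology

/-- The regularised Hamiltonian. -/
noncomputable def En (A z w p : ℂ) : ℂ :=
  p ^ 2 - w ^ 4 - z * w ^ 2 - 2 * A * w + p * (starRingEnd ℂ w / (1 + w * starRingEnd ℂ w))

/-- basic facts on `n = 1 + w w̄`. -/
lemma n_norm (w : ℂ) : ‖1 + w * starRingEnd ℂ w‖ = 1 + ‖w‖ ^ 2 := by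
  rw [Complex.mul_conj, Complex.normSq_eq_norm_sq, ← Complex.ofReal_one, ← Complex.ofReal_add,
    Complex.norm_real, Real.norm_eq_abs, abs_of_pos (by positivity)]

lemma n_ne (w : ℂ) : (1 + w * starRingEnd ℂ w) ≠ 0 := by
  rw [← norm_pos_iff, n_norm]; positivity

lemma theta_le (w : ℂ) : ‖starRingEnd ℂ w / (1 + w * starRingEnd ℂ w)‖ ≤ 1 := by
  rw [norm_div, n_norm, RCLike.norm_conj, div_le_one (by positivity)]
  nlinarith [sq_nonneg (‖w‖ - 1)]

lemma p_bound {A z w p : ℂ} {Z : ℝ} (hz : ‖z‖ ≤ Z) (hA : ‖A‖ ≤ Z) :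
    ‖p‖ ^ 2 ≤ 2 * ‖En A z w p‖ + 1 + (2 + 6 * Z) * (1 + ‖w‖ ^ 2) ^ 2 := by
  have hZ : 0 ≤ Z := (norm_nonneg _).trans hz
  have e : p ^ 2 = En A z w p + w ^ 4 + z * w ^ 2 + 2 * A * w -
      p * (starRingEnd ℂ w / (1 + w * starRingEnd ℂ w)) := by unfold En; ring
  have h1 : ‖p‖ ^ 2 ≤ ‖En A z w p‖ + ‖w‖ ^ 4 + ‖z‖ * ‖w‖ ^ 2 + 2 * ‖A‖ * ‖w‖ + ‖p‖ := by
    rw [← norm_pow, e]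
    have t1 := norm_sub_le (En A z w p + w ^ 4 + z * w ^ 2 + 2 * A * w)
      (p * (starRingEnd ℂ w / (1 + w * starRingEnd ℂ w)))
    have t2 := norm_add_le (En A z w p + w ^ 4 + z * w ^ 2) (2 * A * w)
    have t3 := norm_add_le (En A z w p + w ^ 4) (z * w ^ 2)
    have t4 := norm_add_le (En A z w p) (w ^ 4)
    have t5 : ‖p * (starRingEnd ℂ w / (1 + w * starRingEnd ℂ w))‖ ≤ ‖p‖ := by
      rw [norm_mul]
      exact mul_le_of_le_one_right (norm_nonneg _) (theta_le w)
    have t6 : ‖2 * A * w‖ = 2 * ‖A‖ * ‖w‖ := by simp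
    have t7 : ‖z * w ^ 2‖ = ‖z‖ * ‖w‖ ^ 2 := by simp
    have t8 : ‖w ^ 4‖ = ‖w‖ ^ 4 := by simp
    linarith
  have hw := norm_nonneg w
  generalize ‖w‖ = a at *
  have h2 : ‖z‖ * a ^ 2 ≤ Z * a ^ 2 := by gcongr
  have h3 : 2 * ‖A‖ * a ≤ 2 * Z * (1 + a ^ 2) ^ 2 := by
    have : a ≤ (1 + a ^ 2) ^ 2 := by nlinarith [sq_nonneg (a - 1), sq_nonneg (a^2)]
    gcongr
  have h4 : Z * a ^ 2 ≤ Z * (1 + a ^ 2) ^ 2 := by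
    gcongr
    nlinarith [sq_nonneg a, sq_nonneg (a ^ 2)]
  have h5 : a ^ 4 ≤ (1 + a ^ 2) ^ 2 := by nlinarith [sq_nonneg a]
  nlinarith [sq_nonneg (‖p‖ - 1)]

/-- derivative of the energy along a segment in direction `h` -/
noncomputable def DEn (A z w p h : ℂ) : ℂ :=
  h * (- w ^ 2 + (2 * w ^ 3 + z * w + A) * (starRingEnd ℂ w / (1 + w * starRingEnd ℂ w))) +
    p * ((starRingEnd ℂ (p * h) - starRingEnd ℂ w ^ 2 * (p * h)) / (1 + w * starRingEnd ℂ w) ^ 2)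

lemma DEn_eq (A z w p h : ℂ) : DEn A z w p h =
    h * (- w ^ 2 / (1 + w * starRingEnd ℂ w) ^ 2 +
      (z * w + A) * (starRingEnd ℂ w / (1 + w * starRingEnd ℂ w))
      - (starRingEnd ℂ w / (1 + w * starRingEnd ℂ w)) ^ 2 * (En A z w p + z * w ^ 2 + 2 * A * w
        - p * (starRingEnd ℂ w / (1 + w * starRingEnd ℂ w)))) +
      p * starRingEnd ℂ (p * h) / (1 + w * starRingEnd ℂ w) ^ 2 := by
  have hn := n_ne w
  unfold DEn En
  field_simp
  ring

lemma DEn_bound {A z w p h : ℂ} {Z : ℝ} (hz : ‖z‖ ≤ Z) (hA : ‖A‖ ≤ Z) :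
    ‖DEn A z w p h‖ ≤ ‖h‖ * ((10 + 20 * Z) * (1 + ‖En A z w p‖)) := by
  have hZ : 0 ≤ Z := (norm_nonneg _).trans hz
  rw [DEn_eq]
  have hp := p_bound (w := w) (p := p) hz hA
  have hth := theta_le w
  have hnn := n_norm w
  have hthw : ‖w‖ * ‖starRingEnd ℂ w / (1 + w * starRingEnd ℂ w)‖ ≤ 1 := by
    rw [norm_div, n_norm, RCLike.norm_conj, mul_div_assoc', div_le_one (by positivity)]
    nlinarith
  have hthn : ‖starRingEnd ℂ w / (1 + w * starRingEnd ℂ w)‖ * (1 + ‖w‖ ^ 2) = ‖w‖ := by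
    rw [norm_div, n_norm, RCLike.norm_conj]
    have : (1 + ‖w‖ ^ 2) ≠ 0 := by positivity
    field_simp
  set θ := starRingEnd ℂ w / (1 + w * starRingEnd ℂ w) with hθ
  set n := 1 + w * starRingEnd ℂ w with hn
  set V := En A z w p with hV
  set a := ‖w‖ with ha
  have ha0 : 0 ≤ a := norm_nonneg w
  set N : ℝ := 1 + a ^ 2 with hN
  have hN1 : 1 ≤ N := by nlinarith [sq_nonneg a]
  have hN0 : 0 < N := by linarith
  -- bound of p / n
  set b := ‖p‖ / N with hb
  have hb0 : 0 ≤ b := by positivity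
  have hb2 : b ^ 2 ≤ 2 * ‖V‖ + 3 + 6 * Z := by
    rw [hb, div_pow, div_le_iff₀ (by positivity)]
    have : (1:ℝ) ≤ N ^ 2 := one_le_pow₀ hN1
    nlinarith [norm_nonneg V]
  have t0 : ‖p * starRingEnd ℂ (p * h) / n ^ 2‖ = ‖h‖ * b ^ 2 := by
    rw [norm_div, norm_mul, RCLike.norm_conj, norm_mul, norm_pow, hnn, hb]
    field_simp
  have t1 : ‖- w ^ 2 / n ^ 2‖ ≤ 1 := by
    rw [norm_div, norm_neg, norm_pow, norm_pow, hnn, div_le_one (by positivity)]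
    have : a ≤ N := by nlinarith [sq_nonneg (a-1)]
    gcongr
  have t2 : ‖(z * w + A) * θ‖ ≤ 2 * Z := by
    have e : (z * w + A) * θ = z * (w * θ) + A * θ := by ring
    rw [e]
    refine (norm_add_le _ _).trans ?_
    rw [norm_mul, norm_mul, norm_mul]
    have u1 : ‖z‖ * (a * ‖θ‖) ≤ Z * 1 := by gcongr
    have u2 : ‖A‖ * ‖θ‖ ≤ Z * 1 := by gcongr
    linarith
  have t3 : ‖θ ^ 2 * (V + z * w ^ 2 + 2 * A * w - p * θ)‖ ≤ ‖V‖ + 3 * Z + b := by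
    have e : θ ^ 2 * (V + z * w ^ 2 + 2 * A * w - p * θ) =
      θ ^ 2 * V + z * (w * θ) ^ 2 + 2 * A * θ * (w * θ) - p * θ ^ 3 := by ring
    rw [e]
    have v1 := norm_sub_le (θ ^ 2 * V + z * (w * θ) ^ 2 + 2 * A * θ * (w * θ)) (p * θ ^ 3)
    have v2 := norm_add_le (θ ^ 2 * V + z * (w * θ) ^ 2) (2 * A * θ * (w * θ))
    have v3 := norm_add_le (θ ^ 2 * V) (z * (w * θ) ^ 2)
    have u1 : ‖θ ^ 2 * V‖ ≤ 1 * ‖V‖ := by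
      rw [norm_mul, norm_pow]
      gcongr
      exact pow_le_one₀ (norm_nonneg _) hth
    have u2 : ‖z * (w * θ) ^ 2‖ ≤ Z * 1 := by
      rw [norm_mul, norm_pow, norm_mul]
      gcongr
      exact pow_le_one₀ (by positivity) hthw
    have u3 : ‖2 * A * θ * (w * θ)‖ ≤ 2 * Z * 1 * 1 := by
      rw [norm_mul, norm_mul, norm_mul, norm_mul]
      have : ‖(2:ℂ)‖ = 2 := by simp
      rw [this]
      gcongr
    have u4 : ‖p * θ ^ 3‖ ≤ b := by
      rw [norm_mul, norm_pow, hb, le_div_iff₀ hN0]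
      have : ‖θ‖ ^ 3 * N ≤ 1 := by
        have : ‖θ‖ ^ 3 * N = ‖θ‖ * (‖θ‖ * (‖θ‖ * N)) := by ring
        rw [this, hthn, mul_comm ‖θ‖ a]
        exact mul_le_one₀ hth (by positivity) hthw
      calc ‖p‖ * ‖θ‖ ^ 3 * N = ‖p‖ * (‖θ‖ ^ 3 * N) := by ring
        _ ≤ ‖p‖ * 1 := by gcongr
        _ = ‖p‖ := mul_one _
    linarith
  refine (norm_add_le _ _).trans ?_
  rw [t0, norm_mul, ← mul_add]
  gcongr
  have w1 := norm_sub_le (- w ^ 2 / n ^ 2 + (z * w + A) * θ)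
    (θ ^ 2 * (V + z * w ^ 2 + 2 * A * w - p * θ))
  have w2 := norm_add_le (- w ^ 2 / n ^ 2) ((z * w + A) * θ)
  nlinarith [sq_nonneg (b - 1), norm_nonneg V, mul_nonneg hZ (norm_nonneg V)]

/-- bounded chart: bound for the derivative -/
lemma small_chart {A z w p : ℂ} {Z M : ℝ} (hz : ‖z‖ ≤ Z) (hA : ‖A‖ ≤ Z)
    (hV : ‖En A z w p‖ ≤ M) (hw : ‖w‖ ≤ 1) : ‖p‖ ≤ 10 + 24 * Z + 2 * M := by
  have hZ : 0 ≤ Z := (norm_nonneg _).trans hz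
  have hM : 0 ≤ M := (norm_nonneg _).trans hV
  have hp := p_bound (w := w) (p := p) hz hA
  have h1 : (1 + ‖w‖ ^ 2) ^ 2 ≤ 4 := by
    have : ‖w‖ ^ 2 ≤ 1 := pow_le_one₀ (norm_nonneg _) hw
    nlinarith [sq_nonneg ‖w‖]
  have h2 : ‖p‖ ^ 2 ≤ 9 + 24 * Z + 2 * M := by nlinarith
  nlinarith [norm_nonneg p]

lemma large_chart {A z w p : ℂ} {Z M : ℝ} (hz : ‖z‖ ≤ Z) (hA : ‖A‖ ≤ Z)
    (hV : ‖En A z w p‖ ≤ M) (hw : 1 ≤ ‖w‖) :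
    ∃ s v : ℂ, (s = 1 ∨ s = -1) ∧ ‖v‖ ≤ (10 + 10 * Z + 10 * M) ^ 2 ∧
      p = - (s + s * z * w⁻¹ ^ 2 / 2 + (1/2 + s * A) * w⁻¹ ^ 3 + v * w⁻¹ ^ 4) / w⁻¹ ^ 2 := by
  have hZ : 0 ≤ Z := (norm_nonneg _).trans hz
  have hM : 0 ≤ M := (norm_nonneg _).trans hV
  have hw0 : w ≠ 0 := by rintro rfl; norm_num at hw
  set u := w⁻¹ with hu
  have hu0 : u ≠ 0 := inv_ne_zero hw0
  have hwu : w = u⁻¹ := by rw [hu, inv_inv]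
  have hu1 : ‖u‖ ≤ 1 := by rw [hu, norm_inv]; exact inv_le_one_of_one_le₀ hw
  set q := - p * u ^ 2 with hq
  set κ := w / (1 + w * starRingEnd ℂ w) with hκ
  have hκ1 : ‖κ‖ ≤ 1 := by
    have := theta_le w
    rw [norm_div, RCLike.norm_conj] at this
    rwa [hκ, norm_div]
  set V := En A z w p with hVd
  have hq2 : q ^ 2 - 1 = z * u ^ 2 + 2 * A * u ^ 3 + q * u ^ 3 + (V - q * κ) * u ^ 4 := by
    have hn := n_ne w
    rw [hq, hVd, hκ, hu]
    unfold En
    field_simp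
    ring
  have hup : ∀ k : ℕ, ‖u‖ ^ (k + 2) ≤ ‖u‖ ^ 2 := fun k =>
    pow_le_pow_of_le_one (norm_nonneg _) hu1 (by omega)
  have hqb : ‖q ^ 2 - 1‖ ≤ ‖u‖ ^ 2 * (3 * Z + M + 2 * ‖q‖) := by
    rw [hq2]
    have v1 := norm_add_le (z * u ^ 2 + 2 * A * u ^ 3 + q * u ^ 3) ((V - q * κ) * u ^ 4)
    have v2 := norm_add_le (z * u ^ 2 + 2 * A * u ^ 3) (q * u ^ 3)
    have v3 := norm_add_le (z * u ^ 2) (2 * A * u ^ 3)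
    have u1 : ‖z * u ^ 2‖ ≤ Z * ‖u‖ ^ 2 := by rw [norm_mul, norm_pow]; gcongr
    have u2 : ‖2 * A * u ^ 3‖ ≤ 2 * Z * ‖u‖ ^ 2 := by
      rw [norm_mul, norm_pow, norm_mul]
      have : ‖(2:ℂ)‖ = 2 := by simp
      rw [this]
      gcongr 2 * ?_ * ?_
      exact hup 1
    have u3 : ‖q * u ^ 3‖ ≤ ‖q‖ * ‖u‖ ^ 2 := by
      rw [norm_mul, norm_pow]
      exact mul_le_mul_of_nonneg_left (hup 1) (norm_nonneg _)
    have u4 : ‖(V - q * κ) * u ^ 4‖ ≤ (M + ‖q‖) * ‖u‖ ^ 2 := by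
      rw [norm_mul, norm_pow]
      have : ‖V - q * κ‖ ≤ M + ‖q‖ := by
        refine (norm_sub_le _ _).trans ?_
        rw [norm_mul]
        have : ‖q‖ * ‖κ‖ ≤ ‖q‖ := mul_le_of_le_one_right (norm_nonneg _) hκ1
        linarith
      have h4 := hup 2
      gcongr
    linarith
  set Q := 3 + 3 * Z + M with hQ
  have hqQ : ‖q‖ ≤ Q := by
    by_contra hcon
    push Not at hcon
    have h1 : ‖q‖ ^ 2 ≤ 1 + (3 * Z + M + 2 * ‖q‖) := by
      have e : q ^ 2 = 1 + (q ^ 2 - 1) := by ring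
      rw [← norm_pow, e]
      refine (norm_add_le _ _).trans ?_
      rw [norm_one]
      have : ‖u‖ ^ 2 ≤ 1 := pow_le_one₀ (norm_nonneg _) hu1
      have h3 : ‖u‖ ^ 2 * (3 * Z + M + 2 * ‖q‖) ≤ 1 * (3 * Z + M + 2 * ‖q‖) := by gcongr
      linarith
    nlinarith [norm_nonneg q]
  obtain ⟨s, hs, hsq⟩ : ∃ s : ℂ, (s = 1 ∨ s = -1) ∧ 1 ≤ ‖q + s‖ := by
    by_cases h : 1 ≤ ‖q + 1‖
    · exact ⟨1, Or.inl rfl, h⟩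
    · refine ⟨-1, Or.inr rfl, ?_⟩
      push Not at h
      have : ‖(2:ℂ)‖ ≤ ‖q + 1‖ + ‖q + -1‖ := by
        have e : (2:ℂ) = (q + 1) - (q + -1) := by ring
        rw [e]; exact norm_sub_le _ _
      have h2 : ‖(2:ℂ)‖ = 2 := by simp
      linarith
  have hs2 : s ^ 2 = 1 := by rcases hs with rfl | rfl <;> norm_num
  have hsn : ‖s‖ = 1 := by rcases hs with rfl | rfl <;> simp
  set r := q - s with hr
  set C := 3 * Z + M + 2 * Q with hC
  have hrb : ‖r‖ ≤ ‖u‖ ^ 2 * C := by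
    have e : q ^ 2 - 1 = r * (q + s) := by rw [hr]; linear_combination hs2
    rw [e, norm_mul] at hqb
    calc ‖r‖ ≤ ‖r‖ * ‖q + s‖ := le_mul_of_one_le_right (norm_nonneg _) hsq
      _ ≤ ‖u‖ ^ 2 * (3 * Z + M + 2 * ‖q‖) := hqb
      _ ≤ ‖u‖ ^ 2 * C := by rw [hC]; gcongr
  set v := (q - s - s * z * u ^ 2 / 2 - (1/2 + s * A) * u ^ 3) / u ^ 4 with hv
  have hvu : v * u ^ 4 = q - s - s * z * u ^ 2 / 2 - (1/2 + s * A) * u ^ 3 := by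
    rw [hv]; field_simp
  refine ⟨s, v, hs, ?_, ?_⟩
  · have key : 2 * s * (v * u ^ 4) = r * u ^ 3 + (V - q * κ) * u ^ 4 - r ^ 2 := by
      rw [hvu, hr]
      linear_combination hq2 - (1 + z * u ^ 2 + 2 * A * u ^ 3) * hs2
    have k1 : 2 * ‖v‖ * ‖u‖ ^ 4 ≤ (C + (M + Q) + C ^ 2) * ‖u‖ ^ 4 := by
      have e : 2 * ‖v‖ * ‖u‖ ^ 4 = ‖2 * s * (v * u ^ 4)‖ := by
        rw [norm_mul, norm_mul, norm_mul, norm_pow, hsn]; simp; ring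
      rw [e, key]
      have v1 := norm_sub_le (r * u ^ 3 + (V - q * κ) * u ^ 4) (r ^ 2)
      have v2 := norm_add_le (r * u ^ 3) ((V - q * κ) * u ^ 4)
      have hC0 : 0 ≤ C := by positivity
      have u1 : ‖r * u ^ 3‖ ≤ C * ‖u‖ ^ 4 := by
        rw [norm_mul, norm_pow]
        calc ‖r‖ * ‖u‖ ^ 3 ≤ (‖u‖ ^ 2 * C) * ‖u‖ ^ 3 := by gcongr
          _ = (C * ‖u‖ ^ 4) * ‖u‖ := by ring
          _ ≤ (C * ‖u‖ ^ 4) * 1 := by gcongr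
          _ = _ := mul_one _
      have u2 : ‖(V - q * κ) * u ^ 4‖ ≤ (M + Q) * ‖u‖ ^ 4 := by
        rw [norm_mul, norm_pow]
        gcongr
        refine (norm_sub_le _ _).trans ?_
        rw [norm_mul]
        have : ‖q‖ * ‖κ‖ ≤ ‖q‖ := mul_le_of_le_one_right (norm_nonneg _) hκ1
        linarith
      have u3 : ‖r ^ 2‖ ≤ C ^ 2 * ‖u‖ ^ 4 := by
        rw [norm_pow]
        calc ‖r‖ ^ 2 ≤ (‖u‖ ^ 2 * C) ^ 2 := by gcongr
          _ = _ := by ring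
      linarith
    have k2 : 2 * ‖v‖ ≤ C + (M + Q) + C ^ 2 :=
      le_of_mul_le_mul_right k1 (by positivity)
    nlinarith [mul_nonneg hZ hM, sq_nonneg Z, sq_nonneg M]
  · have : s + s * z * u ^ 2 / 2 + (1/2 + s * A) * u ^ 3 + v * u ^ 4 = q := by
      rw [hvu]; ring
    rw [this, hq]
    field_simp

end HJ

namespace HJ
open Metric Set Topology

lemma en_deriv {A z0 z1 : ℂ} {w : ℂ → ℂ} {t : ℝ}
    (ha : AnalyticAt ℂ w (z0 + (t : ℂ) * (z1 - z0)))
    (hs : Sol A w (z0 + (t : ℂ) * (z1 - z0))) :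
    HasDerivAt (fun t : ℝ => En A (z0 + (t : ℂ) * (z1 - z0)) (w (z0 + (t : ℂ) * (z1 - z0)))
      (deriv w (z0 + (t : ℂ) * (z1 - z0))))
      (DEn A (z0 + (t : ℂ) * (z1 - z0)) (w (z0 + (t : ℂ) * (z1 - z0)))
      (deriv w (z0 + (t : ℂ) * (z1 - z0))) (z1 - z0)) t := by
  have hode := (hs.ode ha).self_of_nhds.2
  have hγ := ray_hasDerivAt z0 z1 t
  have hw : HasDerivAt (fun t : ℝ => w (z0 + (t : ℂ) * (z1 - z0)))
      ((z1 - z0) * deriv w (z0 + (t : ℂ) * (z1 - z0))) t :=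
    HasDerivAt.scomp_of_eq (h := fun t : ℝ => z0 + (t : ℂ) * (z1 - z0)) t
      ha.differentiableAt.hasDerivAt hγ rfl
  have hp : HasDerivAt (fun t : ℝ => deriv w (z0 + (t : ℂ) * (z1 - z0)))
      ((z1 - z0) * deriv (deriv w) (z0 + (t : ℂ) * (z1 - z0))) t :=
    HasDerivAt.scomp_of_eq (h := fun t : ℝ => z0 + (t : ℂ) * (z1 - z0)) t
      ha.deriv.differentiableAt.hasDerivAt hγ rfl
  have hc : HasDerivAt (fun t : ℝ => starRingEnd ℂ (w (z0 + (t : ℂ) * (z1 - z0))))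
      (starRingEnd ℂ ((z1 - z0) * deriv w (z0 + (t : ℂ) * (z1 - z0)))) t := hw.star
  rw [hode] at hp
  have hn := n_ne (w (z0 + (t : ℂ) * (z1 - z0)))
  have key := ((((hp.pow 2).sub (hw.pow 4)).sub (hγ.mul (hw.pow 2))).sub (hw.const_mul (2 * A))).add
    (hp.mul (hc.div ((hw.mul hc).const_add 1) hn))
  refine key.congr_deriv ?_
  simp only [Pi.pow_apply, Pi.mul_apply, Pi.div_apply]
  generalize hW : w (z0 + (t : ℂ) * (z1 - z0)) = W at *
  generalize hP : deriv w (z0 + (t : ℂ) * (z1 - z0)) = P at *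
  generalize (z0 + (t : ℂ) * (z1 - z0)) = Zt at *
  unfold DEn
  simp only [map_mul, map_sub]
  generalize starRingEnd ℂ W = Wc at *
  generalize starRingEnd ℂ P = Pc at *
  field_simp
  push_cast
  ring

lemma en_bound {A z0 z1 : ℂ} {w : ℂ → ℂ} {Z R : ℝ} (hA : ‖A‖ ≤ Z)
    (hz : ∀ t ∈ Icc (0:ℝ) 1, ‖z0 + (t : ℂ) * (z1 - z0)‖ ≤ Z) (hR : ‖z1 - z0‖ ≤ R)
    (ha : ∀ t ∈ Icc (0:ℝ) 1, AnalyticAt ℂ w (z0 + (t : ℂ) * (z1 - z0)))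
    (hs : ∀ t ∈ Icc (0:ℝ) 1, Sol A w (z0 + (t : ℂ) * (z1 - z0))) :
    ‖En A z1 (w z1) (deriv w z1)‖ ≤
      gronwallBound ‖En A z0 (w z0) (deriv w z0)‖ ((10 + 20 * Z) * R) ((10 + 20 * Z) * R) 1 := by
  have hZ : 0 ≤ Z := (norm_nonneg _).trans hA
  have h := norm_le_gronwallBound_of_norm_deriv_right_le (a := 0) (b := 1)
    (f := fun t : ℝ => En A (z0 + (t : ℂ) * (z1 - z0)) (w (z0 + (t : ℂ) * (z1 - z0)))
      (deriv w (z0 + (t : ℂ) * (z1 - z0))))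
    (K := (10 + 20 * Z) * R) (ε := (10 + 20 * Z) * R)
    (δ := ‖En A z0 (w z0) (deriv w z0)‖)
    (fun t ht => (en_deriv (ha t ht) (hs t ht)).continuousAt.continuousWithinAt)
    (fun t ht => (en_deriv (ha t (Ico_subset_Icc_self ht))
      (hs t (Ico_subset_Icc_self ht))).hasDerivWithinAt)
    (by simp)
    (fun t ht => by
      refine (DEn_bound (hz t (Ico_subset_Icc_self ht)) hA).trans ?_
      rw [← mul_add_one, mul_comm _ R, mul_assoc, add_comm _ (1:ℝ)]
      gcongr)
    1 (by simp)
  simpa using h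

end HJ

namespace HJ
open Metric Set Topology

lemma sol_traj {A c : ℂ} {w : ℂ → ℂ} (hs : Sol A w c) (ha : AnalyticAt ℂ w c) :
    ∀ᶠ z in 𝓝 c, HasDerivAt (fun z => ((z, w z, deriv w z) : ℂ × ℂ × ℂ))
      (G2 A (z, w z, deriv w z)) z := by
  filter_upwards [hs.ode ha] with z hz
  have h1 := hz.1.differentiableAt.hasDerivAt
  have h2 := hz.1.deriv.differentiableAt.hasDerivAt
  rw [hz.2] at h2
  exact (hasDerivAt_id z).prodMk (h1.prodMk h2)

lemma sol_unique {A c : ℂ} {f w : ℂ → ℂ} (hs : Sol A w c) (ha : AnalyticAt ℂ w c)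
    (hs' : Sol A f c) (ha' : AnalyticAt ℂ f c) (h0 : f c = w c) (h1 : deriv f c = deriv w c) :
    f =ᶠ[𝓝 c] w := by
  have := germ_unique (G2_contDiff A) (sol_traj hs' ha') (sol_traj hs ha) (by simp [h0, h1])
  filter_upwards [this] with z hz
  exact congrArg (fun X => X.2.1) hz

lemma local_ext {A : ℂ} {Z : ℝ} (M : ℝ) (hA : ‖A‖ ≤ Z) : ∃ δ > 0, ∀ (c : ℂ) (w : ℂ → ℂ),
    ‖c‖ ≤ Z → Sol A w c → AnalyticAt ℂ w c → ‖En A c (w c) (deriv w c)‖ ≤ M →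
    ∃ f : ℂ → ℂ, f =ᶠ[𝓝 c] w ∧ ∀ x ∈ ball c δ, Sol A f x := by
  obtain ⟨δ0, hδ0, H0⟩ := picard_compact (G2_contDiff A)
    (C := closedBall (0:ℂ) Z ×ˢ (closedBall (0:ℂ) 1 ×ˢ closedBall (0:ℂ) (10 + 24 * Z + 2 * M)))
    ((isCompact_closedBall _ _).prod ((isCompact_closedBall _ _).prod (isCompact_closedBall _ _)))
  have Hs : ∀ s : ℂ, ∃ ρ > 0, ∀ X0 ∈ closedBall (0:ℂ) Z ×ˢ (closedBall (0:ℂ) 1 ×ˢ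
      closedBall (0:ℂ) ((10 + 10 * Z + 10 * M) ^ 2)), ∀ z0 : ℂ,
      ∃ X : ℂ → ℂ × ℂ × ℂ, X z0 = X0 ∧ ∀ z ∈ ball z0 ρ, HasDerivAt X (Gs A s (X z)) z :=
    fun s => picard_compact (Gs_contDiff A s)
      ((isCompact_closedBall _ _).prod ((isCompact_closedBall _ _).prod (isCompact_closedBall _ _)))
  obtain ⟨δ1, hδ1, H1⟩ := Hs 1
  obtain ⟨δ2, hδ2, H2⟩ := Hs (-1)
  clear Hs
  set δ := min δ0 (min δ1 δ2) with hδ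
  have hδp : 0 < δ := by positivity
  have Hs : ∀ s : ℂ, (s = 1 ∨ s = -1) → ∀ X0 ∈ closedBall (0:ℂ) Z ×ˢ (closedBall (0:ℂ) 1 ×ˢ
      closedBall (0:ℂ) ((10 + 10 * Z + 10 * M) ^ 2)), ∀ z0 : ℂ,
      ∃ X : ℂ → ℂ × ℂ × ℂ, X z0 = X0 ∧ ∀ z ∈ ball z0 δ, HasDerivAt X (Gs A s (X z)) z := by
    rintro s (rfl | rfl) X0 hX0 z0
    · obtain ⟨X, h, h'⟩ := H1 X0 hX0 z0
      exact ⟨X, h, fun z hz => h' z (ball_subset_ball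
        ((min_le_right _ _).trans (min_le_left _ _)) hz)⟩
    · obtain ⟨X, h, h'⟩ := H2 X0 hX0 z0
      exact ⟨X, h, fun z hz => h' z (ball_subset_ball
        ((min_le_right _ _).trans (min_le_right _ _)) hz)⟩
  refine ⟨δ, hδp, fun c w hc hs ha hE => ?_⟩
  rcases le_total ‖w c‖ 1 with hw | hw
  · have hp := small_chart hc hA hE hw
    obtain ⟨X, hX0, hX⟩ := H0 (c, w c, deriv w c) (by simp [hc, hw, hp]) c
    have hX' : ∀ z ∈ ball c δ, HasDerivAt X (G2 A (X z)) z := fun z hz =>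
      hX z (ball_subset_ball (min_le_left _ _) hz)
    have h0 : (X c).1 = c := by rw [hX0]
    obtain ⟨k1, k2, k3⟩ := sol_of_G2 hX' h0 (mem_ball_self hδp)
    refine ⟨fun z => (X z).2.1, sol_unique hs ha k1 k2 ?_ ?_, fun x hx => (sol_of_G2 hX' h0 hx).1⟩
    · simp [hX0]
    · rw [k3, hX0]
  · obtain ⟨s, v, hs1, hv, hp⟩ := large_chart hc hA hE hw
    have hw0 : w c ≠ 0 := by intro h; rw [h] at hw; norm_num at hw
    have hs2 : s ^ 2 = 1 := by rcases hs1 with rfl | rfl <;> norm_num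
    obtain ⟨X, hX0, hX⟩ := Hs s hs1 (c, (w c)⁻¹, v) (by
      simp only [mem_prod, mem_closedBall, dist_zero_right]
      exact ⟨hc, by rw [norm_inv]; exact inv_le_one_of_one_le₀ hw, hv⟩) c
    have h0 : (X c).1 = c := by rw [hX0]
    have hu : (X c).2.1 = (w c)⁻¹ := by rw [hX0]
    have hu0 : (X c).2.1 ≠ 0 := by rw [hu]; exact inv_ne_zero hw0
    obtain ⟨k1, k2⟩ := sol_of_Gs hs2 hX h0 (mem_ball_self hδp)
    have k3 : AnalyticAt ℂ (fun z => (X z).2.1) c :=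
      analytic_of_hasDeriv (fun z hz => comp1 (comp2 (hX z hz))) (mem_ball_self hδp)
    refine ⟨(fun z => (X z).2.1)⁻¹, sol_unique hs ha k1 (k3.inv hu0) ?_ ?_,
      fun x hx => (sol_of_Gs hs2 hX h0 hx).1⟩
    · simp [hX0]
    · rw [(k2 hu0).deriv, hp, hX0]
      rfl

/-- density of centres whose segment to `z0` avoids the poles -/
lemma good_center {A z0 : ℂ} {w : ℂ → ℂ} {r : ℝ} (hs : ∀ x ∈ ball z0 r, Sol A w x)
    {x : ℂ} (hx : x ∈ ball z0 r) (hx0 : x ≠ z0) (ha0 : AnalyticAt ℂ w z0) {η : ℝ} (hη : 0 < η) :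
    ∃ c ∈ ball x η, c ∈ ball z0 r ∧
      ∀ t ∈ Icc (0:ℝ) 1, AnalyticAt ℂ w (z0 + (t : ℂ) * (c - z0)) := by
  have hcount : ({z | AnalyticAt ℂ w z}ᶜ ∩ ball z0 r).Countable :=
    MeromorphicOn.countable_compl_analyticAt_inter (fun x hx => (hs x hx).1.meromorphicAt)
  set h := x - z0 with hh
  have hh0 : h ≠ 0 := sub_ne_zero.2 hx0
  have hbad := (hcount.image (fun p => ((p - z0) / h).im / ((p - z0) / h).re))
  have hdense := hbad.dense_compl ℝ
  have hcont : Continuous (fun τ : ℝ => z0 + h * (1 + τ * Complex.I)) := by fun_prop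
  have hnear : ∀ᶠ τ : ℝ in 𝓝 0, z0 + h * (1 + τ * Complex.I) ∈ ball x η ∩ ball z0 r := by
    apply hcont.continuousAt
    apply (isOpen_ball.inter isOpen_ball).mem_nhds
    simp only [Complex.ofReal_zero, zero_mul, add_zero, mul_one]
    rw [hh, add_sub_cancel]
    exact ⟨mem_ball_self hη, hx⟩
  obtain ⟨τ, hτ2, hτ1⟩ := hdense.inter_nhds_nonempty hnear
  refine ⟨_, hτ1.1, hτ1.2, fun t ht => ?_⟩
  by_contra hna
  have hmem := ray_mem hτ1.2 ht
  have ht0 : t ≠ 0 := by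
    rintro rfl
    apply hna
    simpa using ha0
  apply hτ2
  refine ⟨_, ⟨hna, hmem⟩, ?_⟩
  have e : (z0 + (t:ℂ) * (z0 + h * (1 + τ * Complex.I) - z0) - z0) / h =
      t * (1 + τ * Complex.I) := by
    field_simp; ring
  simp only [e]
  simp
  field_simp

end HJ

namespace HJ
open Metric Set Topology

lemma ext_step {A z0 : ℂ} {w : ℂ → ℂ} {r δ : ℝ} (hr : 0 < r) (hδ : 0 < δ)
    (hs : ∀ x ∈ ball z0 r, Sol A w x) (ha : AnalyticAt ℂ w z0)
    (loc : ∀ c ∈ ball z0 r, (∀ t ∈ Icc (0:ℝ) 1, AnalyticAt ℂ w (z0 + (t : ℂ) * (c - z0))) →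
      ∃ f : ℂ → ℂ, f =ᶠ[𝓝 c] w ∧ ∀ x ∈ ball c δ, Sol A f x) :
    ∃ w' : ℂ → ℂ, w' =ᶠ[𝓝 z0] w ∧ ∀ x ∈ ball z0 (r + δ / 2), Sol A w' x := by
  have claim : ∀ x : ℂ, ∃ c : ℂ, ∃ f : ℂ → ℂ, x ∈ ball z0 (r + δ / 2) →
      c ∈ ball z0 r ∧ f =ᶠ[𝓝 c] w ∧ (∀ y ∈ ball c δ, Sol A f y) ∧ x ∈ ball c δ := by
    intro x
    by_cases hx : x ∈ ball z0 (r + δ / 2)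
    swap
    · exact ⟨0, 0, fun h => absurd h hx⟩
    have key : ∃ c ∈ ball x δ, c ∈ ball z0 r ∧
        ∀ t ∈ Icc (0:ℝ) 1, AnalyticAt ℂ w (z0 + (t : ℂ) * (c - z0)) := by
      by_cases hx0 : x = z0
      · subst hx0
        exact ⟨x, mem_ball_self hδ, mem_ball_self hr, fun t _ => by simpa using ha⟩
      by_cases hxr : x ∈ ball z0 r
      · exact good_center hs hxr hx0 ha hδ
      · set d := ‖x - z0‖ with hd
        have hd1 : r ≤ d := by
          rw [mem_ball, dist_eq_norm] at hxr
          exact not_lt.1 hxr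
        have hd2 : d < r + δ / 2 := by
          rw [mem_ball, dist_eq_norm] at hx
          exact hx
        have hdp : 0 < d := by linarith
        set κ := min (r / 2) (δ / 4) with hκ
        have hκ0 : 0 < κ := by positivity
        have hκ1 : κ ≤ r / 2 := min_le_left _ _
        have hκ2 : κ ≤ δ / 4 := min_le_right _ _
        set q := (r - κ) / d with hq
        have hqd : q * d = r - κ := by rw [hq]; field_simp
        have hq0 : 0 < q := by rw [hq]; apply div_pos <;> linarith
        have n1 : ‖(q : ℂ) * (x - z0)‖ = r - κ := by
          rw [norm_mul, Complex.norm_real, Real.norm_eq_abs, abs_of_pos hq0, hqd]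
        have n2 : ‖x - (z0 + (q : ℂ) * (x - z0))‖ = d - (r - κ) := by
          have e : x - (z0 + (q : ℂ) * (x - z0)) = ((1 - q : ℝ) : ℂ) * (x - z0) := by
            push_cast; ring
          have hq1 : 0 ≤ 1 - q := by
            rw [hq, sub_nonneg, div_le_one hdp]; linarith
          rw [e, norm_mul, Complex.norm_real, Real.norm_eq_abs, abs_of_nonneg hq1, sub_mul, hqd,
            one_mul]
        obtain ⟨c, h1, h2, h3⟩ := good_center (x := z0 + (q : ℂ) * (x - z0)) hs
          (by rw [mem_ball, dist_eq_norm, add_sub_cancel_left, n1]; linarith)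
          (by
            intro h
            have : (q : ℂ) * (x - z0) = 0 := by simpa using h
            rw [this, norm_zero] at n1
            linarith) ha (η := δ / 4) (by positivity)
        refine ⟨c, ?_, h2, h3⟩
        have t := dist_triangle c (z0 + (q : ℂ) * (x - z0)) x
        rw [dist_comm (z0 + (q : ℂ) * (x - z0)) x, dist_eq_norm x (z0 + (q : ℂ) * (x - z0)), n2] at t
        rw [mem_ball] at h1 ⊢
        linarith
    obtain ⟨c, h1, h2, h3⟩ := key
    obtain ⟨f, hf, hf'⟩ := loc c h2 h3
    exact ⟨c, f, fun _ => ⟨h2, hf, hf', by rwa [mem_ball_comm] at h1⟩⟩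
  choose c f H using claim
  -- each piece agrees with `w` on the old ball
  have agree0 : ∀ x ∈ ball z0 (r + δ / 2), ∀ y ∈ ball (c x) δ ∩ ball z0 r, f x =ᶠ[𝓝 y] w := by
    intro x hx y hy
    obtain ⟨h1, h2, h3, h4⟩ := H x hx
    exact mero_id (((convex_ball _ _).inter (convex_ball _ _)).isPreconnected)
      (fun y hy => (h3 y hy.1).1) (fun y hy => (hs y hy.2).1)
      ⟨mem_ball_self hδ, h1⟩ h2 hy
  have agree : ∀ x ∈ ball z0 (r + δ / 2), ∀ y ∈ ball z0 (r + δ / 2), y ∈ ball (c x) δ →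
      f y y = f x y := by
    intro x hx y hy hyx
    obtain ⟨h1, h2, h3, h4⟩ := H x hx
    obtain ⟨g1, g2, g3, g4⟩ := H y hy
    have hdist : dist (c x) (c y) < 2 * δ := by
      have := dist_triangle_left (c x) (c y) y
      rw [mem_ball] at hyx g4
      linarith
    set m := midpoint ℝ (c x) (c y) with hm
    have m1 : m ∈ ball (c x) δ := by
      rw [mem_ball, hm, dist_midpoint_left]
      norm_num
      linarith
    have m2 : m ∈ ball (c y) δ := by
      rw [mem_ball, hm, dist_midpoint_right]
      norm_num
      linarith
    have m3 : m ∈ ball z0 r := (convex_ball z0 r).midpoint_mem h1 g1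
    have e : f y =ᶠ[𝓝 m] f x := (agree0 y hy m ⟨m2, m3⟩).trans (agree0 x hx m ⟨m1, m3⟩).symm
    exact (mero_id (((convex_ball _ _).inter (convex_ball _ _)).isPreconnected)
      (fun y hy => (g3 y hy.1).1) (fun y hy => (h3 y hy.2).1)
      ⟨m2, m1⟩ e ⟨g4, hyx⟩).self_of_nhds
  have loceq : ∀ x ∈ ball z0 (r + δ / 2), (fun y => f y y) =ᶠ[𝓝 x] f x := by
    intro x hx
    filter_upwards [isOpen_ball.mem_nhds hx, isOpen_ball.mem_nhds (H x hx).2.2.2] with y h1 h2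
    exact agree x hx y h1 h2
  refine ⟨fun y => f y y, ?_, fun x hx => ?_⟩
  · have hz : z0 ∈ ball z0 (r + δ / 2) := mem_ball_self (by positivity)
    exact (loceq z0 hz).trans (agree0 z0 hz z0 ⟨(H z0 hz).2.2.2, mem_ball_self hr⟩)
  · exact ((H x hx).2.2.1 x (H x hx).2.2.2).congr (loceq x hx).symm

lemma sol_ball (A z0 a b : ℂ) (R : ℝ) (hR : 0 < R) : ∃ w : ℂ → ℂ, AnalyticAt ℂ w z0 ∧ w z0 = a ∧
    deriv w z0 = b ∧ ∀ x ∈ ball z0 R, Sol A w x := by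
  obtain ⟨ρ, hρ, K, s, hs, -, HP⟩ := picard (G2_contDiff A) (z0, a, b)
  obtain ⟨X, hX0, hX⟩ := HP _ (mem_ball_self hρ) z0
  have hX' := fun z hz => (hX z hz).1
  have h0 : (X z0).1 = z0 := by rw [hX0]
  set w1 : ℂ → ℂ := fun z => (X z).2.1 with hw1
  obtain ⟨-, ha1, hd1⟩ := sol_of_G2 hX' h0 (mem_ball_self hρ)
  have hv1 : w1 z0 = a := by simp [hw1, hX0]
  have hd1 : deriv w1 z0 = b := by rw [hd1, hX0]
  set Z := ‖A‖ + ‖z0‖ + R with hZ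
  have hA : ‖A‖ ≤ Z := by rw [hZ]; linarith [norm_nonneg z0]
  have hzZ : ∀ x ∈ ball z0 R, ‖x‖ ≤ Z := by
    intro x hx
    rw [mem_ball, dist_eq_norm] at hx
    have := norm_add_le z0 (x - z0)
    rw [add_sub_cancel] at this
    rw [hZ]; linarith [norm_nonneg A]
  obtain ⟨δ, hδ, hloc⟩ := local_ext
    (gronwallBound ‖En A z0 a b‖ ((10 + 20 * Z) * R) ((10 + 20 * Z) * R) 1) hA
  have ind : ∀ n : ℕ, ∃ w : ℂ → ℂ, w =ᶠ[𝓝 z0] w1 ∧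
      ∀ x ∈ ball z0 (min R (ρ + n * (δ / 2))), Sol A w x := by
    intro n
    induction n with
    | zero =>
      refine ⟨w1, EventuallyEq.rfl, fun x hx => (sol_of_G2 hX' h0 ?_).1⟩
      refine ball_subset_ball ((min_le_right _ _).trans ?_) hx
      simp
    | succ n ih =>
      obtain ⟨w, hw, hwS⟩ := ih
      have hr : 0 < min R (ρ + n * (δ / 2)) := by positivity
      have ha : AnalyticAt ℂ w z0 := ha1.congr hw.symm
      obtain ⟨w', h1, h2⟩ := ext_step hr hδ hwS ha (by
        intro c hc hseg
        have hcR : c ∈ ball z0 R := ball_subset_ball (min_le_left _ _) hc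
        have hcA : AnalyticAt ℂ w c := by simpa using hseg 1 (by simp)
        refine hloc c w (hzZ c hcR) (hwS c hc) hcA ?_
        have := en_bound (w := w) (R := R) hA (fun t ht => hzZ _ (ray_mem hcR ht))
          (by rw [mem_ball, dist_eq_norm] at hcR; exact hcR.le) hseg
          (fun t ht => hwS _ (ray_mem hc ht))
        rwa [hw.deriv.self_of_nhds, hw.self_of_nhds, hv1, hd1] at this)
      refine ⟨w', h1.trans hw, fun x hx => h2 x (ball_subset_ball ?_ hx)⟩
      push_cast
      rcases le_total R (ρ + n * (δ / 2)) with h | h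
      · rw [min_eq_left h]
        exact (min_le_left _ _).trans (by linarith)
      · rw [min_eq_right h]
        exact (min_le_right _ _).trans (by linarith)
  obtain ⟨n, hn⟩ := exists_nat_gt (R / (δ / 2))
  obtain ⟨w, hw, hwS⟩ := ind n
  rw [div_lt_iff₀ (by positivity)] at hn
  refine ⟨w, ha1.congr hw.symm, by rw [hw.self_of_nhds, hv1], by rw [hw.deriv.self_of_nhds, hd1], ?_⟩
  rwa [min_eq_left (by linarith)] at hwS

/-- The Painlevé property of `P_II`. -/
lemma sol_global (A z0 a b : ℂ) : ∃ w : ℂ → ℂ, AnalyticAt ℂ w z0 ∧ w z0 = a ∧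
    deriv w z0 = b ∧ ∀ x, Sol A w x := by
  have h := fun n : ℕ => sol_ball A z0 a b (n + 1) (by positivity)
  choose W h1 h2 h3 h4 using h
  have agree : ∀ n m : ℕ, n ≤ m → ∀ x ∈ ball z0 ((n : ℝ) + 1), W n =ᶠ[𝓝 x] W m := by
    intro n m hnm x hx
    have hsub : ball z0 ((n : ℝ) + 1) ⊆ ball z0 ((m : ℝ) + 1) :=
      ball_subset_ball (by have : (n : ℝ) ≤ m := by exact_mod_cast hnm
                           linarith)
    have hz : z0 ∈ ball z0 ((n : ℝ) + 1) := mem_ball_self (by positivity)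
    refine mero_id (convex_ball z0 ((n : ℝ) + 1)).isPreconnected (fun y hy => (h4 n y hy).1)
      (fun y hy => (h4 m y (hsub hy)).1) hz ?_ hx
    exact sol_unique (h4 m z0 (hsub hz)) (h1 m) (h4 n z0 hz) (h1 n) (by rw [h2, h2])
      (by rw [h3, h3])
  set F : ℂ → ℂ := fun x => W (⌈dist x z0⌉₊) x with hF
  have loc : ∀ n : ℕ, ∀ x ∈ ball z0 (n : ℝ), F =ᶠ[𝓝 x] W n := by
    intro n x hx
    filter_upwards [isOpen_ball.mem_nhds hx] with y hy
    rw [mem_ball] at hy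
    exact (agree _ n (Nat.ceil_le.2 hy.le) y (by
      rw [mem_ball]; have := Nat.le_ceil (dist y z0); linarith)).self_of_nhds
  have e0 := loc 1 z0 (by simp)
  refine ⟨F, (h1 1).congr e0.symm, by rw [e0.self_of_nhds, h2], by rw [e0.deriv.self_of_nhds, h3],
    fun x => ?_⟩
  obtain ⟨n, hn⟩ := exists_nat_gt (dist x z0)
  exact (h4 n x (by rw [mem_ball]; linarith)).congr (loc n x hn).symm

end HJ

namespace HJ
open Metric Set Topology

lemma transfer {ε : ℂ} (hε : ε ≠ 0) (x0 α β : ℂ) : ∃ Y : ℂ → ℂ, (∀ x, MeromorphicNFAt Y x) ∧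
    AnalyticAt ℂ Y x0 ∧ Y x0 = α ∧ deriv Y x0 = β ∧ ∀ᶠ x in 𝓝 x0,
      deriv (deriv Y) x = 6 * Y x ^ 2 + x + ε ^ 6 * (2 * Y x ^ 3 + x * Y x) := by
  obtain ⟨w, hwa, hw0, hw1, hwS⟩ := sol_global (4 * (ε⁻¹) ^ 15)
    (ε ^ 2 * x0 - 6 * (ε⁻¹) ^ 10) (ε * α + (ε⁻¹) ^ 5) (β / ε)
  set L : ℂ → ℂ := fun x => ε ^ 2 * x - 6 * (ε⁻¹) ^ 10 with hL
  set Y0 : ℂ → ℂ := fun x => (w (L x) - (ε⁻¹) ^ 5) / ε with hY0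
  have hLd : ∀ x, HasDerivAt L (ε ^ 2) x := fun x => by
    exact (((hasDerivAt_id x).const_mul (ε ^ 2)).sub_const (6 * (ε⁻¹) ^ 10)).congr_deriv (mul_one _)
  have hLa : ∀ x, AnalyticAt ℂ L x := fun x => by fun_prop
  have hd : ∀ᶠ x in 𝓝 x0, HasDerivAt Y0 (ε * deriv w (L x)) x ∧
      HasDerivAt (fun x => ε * deriv w (L x)) (ε ^ 3 * deriv (deriv w) (L x)) x ∧
      deriv (deriv w) (L x) = 2 * w (L x) ^ 3 + L x * w (L x) + 4 * (ε⁻¹) ^ 15 := by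
    filter_upwards [(hLa x0).continuousAt.eventually ((hwS (L x0)).ode hwa)] with x hx
    refine ⟨?_, ?_, hx.2⟩
    · refine (((hx.1.differentiableAt.hasDerivAt.comp x (hLd x)).sub_const ((ε⁻¹) ^ 5)).div_const
        ε).congr_deriv ?_
      field_simp
    · refine ((hx.1.deriv.differentiableAt.hasDerivAt.comp x (hLd x)).const_mul ε).congr_deriv ?_
      ring
  have hY0a : AnalyticAt ℂ Y0 x0 := by
    have h : AnalyticAt ℂ (fun x => w (L x)) x0 := AnalyticAt.comp hwa (hLa x0)
    have h2 : AnalyticAt ℂ (fun x => (w (L x) - (ε⁻¹) ^ 5) / ε) x0 :=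
      (h.sub analyticAt_const).div analyticAt_const hε
    exact h2
  have hY0m : MeromorphicOn Y0 univ := by
    intro x _
    have h : MeromorphicAt (fun x => w (L x)) x :=
      MeromorphicAt.comp_analyticAt (hwS (L x)).1.meromorphicAt (hLa x)
    exact (h.sub (MeromorphicAt.const _ _)).div (MeromorphicAt.const _ _)
  have heq : toMeromorphicNFOn Y0 univ =ᶠ[𝓝 x0] Y0 := by
    have := toMeromorphicNFOn_eq_toMeromorphicNFAt_on_nhds hY0m (mem_univ x0)
    rwa [toMeromorphicNFAt_eq_self.2 hY0a.meromorphicNFAt] at this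
  have hd1 : deriv Y0 =ᶠ[𝓝 x0] fun x => ε * deriv w (L x) := hd.mono fun x hx => hx.1.deriv
  refine ⟨toMeromorphicNFOn Y0 univ,
    fun x => meromorphicNFOn_toMeromorphicNFOn Y0 univ (mem_univ x), hY0a.congr heq.symm, ?_, ?_, ?_⟩
  · rw [heq.self_of_nhds, hY0]
    simp only
    rw [hw0]; field_simp; ring
  · rw [heq.deriv.self_of_nhds, hd1.self_of_nhds]
    simp only [hL]
    rw [hw1]; field_simp
  · filter_upwards [heq, heq.deriv.deriv, hd1.deriv, hd] with x h1 h2 h3 h4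
    rw [h1, h2, h3, h4.2.1.deriv, h4.2.2, hY0, hL]
    simp only
    generalize w (ε ^ 2 * x - 6 * (ε⁻¹) ^ 10) = u
    field_simp
    ring

end HJ

namespace HJ
open Metric Set Topology

/-- right-hand side of the transformed equation -/
def rhs (δ x y : ℂ) : ℂ := 6 * y ^ 2 + x + δ * (2 * y ^ 3 + x * y)

/-- the transformed equation as an autonomous system, with the parameter as a state variable -/
def G4 : ℂ × ℂ × ℂ × ℂ → ℂ × ℂ × ℂ × ℂ :=
  fun X => (1, X.2.2.1, rhs X.2.2.2 X.1 X.2.1, 0)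

lemma G4_contDiff : ContDiff ℂ 1 G4 := by
  unfold G4 rhs; fun_prop

lemma traj4 {δ z : ℂ} {y : ℂ → ℂ} (ha : AnalyticAt ℂ y z)
    (h : deriv (deriv y) z = rhs δ z (y z)) :
    HasDerivAt (fun z => ((z, y z, deriv y z, δ) : ℂ × ℂ × ℂ × ℂ))
      (G4 (z, y z, deriv y z, δ)) z := by
  have h1 := ha.differentiableAt.hasDerivAt
  have h2 := ha.deriv.differentiableAt.hasDerivAt
  rw [h] at h2
  exact (hasDerivAt_id z).prodMk (h1.prodMk (h2.prodMk (hasDerivAt_const z δ)))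

lemma of_G4 {c δ : ℂ} {ρ : ℝ} {X : ℂ → ℂ × ℂ × ℂ × ℂ}
    (hX : ∀ z ∈ ball c ρ, HasDerivAt X (G4 (X z)) z) (h0 : (X c).1 = c) (h1 : (X c).2.2.2 = δ)
    {z : ℂ} (hz : z ∈ ball c ρ) :
    AnalyticAt ℂ (fun z => (X z).2.1) z ∧ deriv (fun z => (X z).2.1) z = (X z).2.2.1 ∧
      deriv (deriv (fun z => (X z).2.1)) z = rhs δ z (X z).2.1 := by
  have d1 : ∀ z ∈ ball c ρ, HasDerivAt (fun z => (X z).1) 1 z := fun z hz => comp1 (hX z hz)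
  have d2 : ∀ z ∈ ball c ρ, HasDerivAt (fun z => (X z).2.1) (X z).2.2.1 z :=
    fun z hz => comp1 (comp2 (hX z hz))
  have d3 : ∀ z ∈ ball c ρ, HasDerivAt (fun z => (X z).2.2.1) (G4 (X z)).2.2.1 z :=
    fun z hz => comp1 (comp2 (comp2 (hX z hz)))
  have d4 : ∀ z ∈ ball c ρ, HasDerivAt (fun z => (X z).2.2.2) 0 z :=
    fun z hz => comp2 (comp2 (comp2 (hX z hz)))
  have e1 : (X z).1 = z := by
    have := affine_of_deriv d1 hz
    rw [this, h0]; ring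
  have e4 : (X z).2.2.2 = δ := by
    have := affine_of_deriv d4 hz
    rw [this, h1]; ring
  refine ⟨analytic_of_hasDeriv d2 hz, (d2 z hz).deriv, ?_⟩
  have : deriv (fun z => (X z).2.1) =ᶠ[𝓝 z] fun z => (X z).2.2.1 := by
    filter_upwards [isOpen_ball.mem_nhds hz] with y hy using (d2 y hy).deriv
  rw [this.deriv_eq, (d3 z hz).deriv]
  simp only [G4, e1, e4]

/-- pointwise closeness of the family to `y_I` -/
def Pt (Y : ℂ → ℂ → ℂ) (yI : ℂ → ℂ) (η : ℝ) (ε x : ℂ) : Prop :=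
  (∀ᶠ z in 𝓝 x, AnalyticAt ℂ (Y ε) z ∧ deriv (deriv (Y ε)) z = rhs (ε ^ 6) z (Y ε z)) ∧
    ‖Y ε x - yI x‖ ≤ η ∧ ‖deriv (Y ε) x - deriv yI x‖ ≤ η

def QQ (Y : ℂ → ℂ → ℂ) (yI : ℂ → ℂ) (S : Set ℂ) : Prop :=
  ∀ η > 0, ∀ᶠ ε in 𝓝[≠] (0:ℂ), ∀ x ∈ S, Pt Y yI η ε x

lemma QQ.mono {Y : ℂ → ℂ → ℂ} {yI : ℂ → ℂ} {S T : Set ℂ} (hST : S ⊆ T) (h : QQ Y yI T) :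
    QQ Y yI S := fun η hη => (h η hη).mono fun _ hε x hx => hε x (hST hx)

lemma QQ.union {Y : ℂ → ℂ → ℂ} {yI : ℂ → ℂ} {S T : Set ℂ} (h : QQ Y yI S) (h' : QQ Y yI T) :
    QQ Y yI (S ∪ T) := fun η hη => by
  filter_upwards [h η hη, h' η hη] with ε h1 h2 x hx
  exact hx.elim (h1 x) (h2 x)

lemma propagate {Ω : Set ℂ} (hΩ : IsOpen Ω) {yI : ℂ → ℂ} (hyI : DifferentiableOn ℂ yI Ω)
    (hode : ∀ x ∈ Ω, deriv (deriv yI) x = 6 * (yI x) ^ 2 + x) {Y : ℂ → ℂ → ℂ}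
    (hY : ∀ ε ≠ 0, ∀ x, MeromorphicNFAt (Y ε) x) {x1 : ℂ} (hx1 : x1 ∈ Ω) :
    ∃ ρ > 0, ball x1 ρ ⊆ Ω ∧ ∀ x ∈ ball x1 ρ, QQ Y yI {x} → QQ Y yI (ball x1 ρ) := by
  have hyA : ∀ x ∈ Ω, AnalyticAt ℂ yI x := fun x hx => hyI.analyticAt (hΩ.mem_nhds hx)
  set T : ℂ → ℂ × ℂ × ℂ × ℂ := fun z => (z, yI z, deriv yI z, 0) with hT
  have hTd : ∀ x ∈ Ω, HasDerivAt T (G4 (T x)) x := fun x hx =>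
    traj4 (hyA x hx) (by rw [hode x hx]; unfold rhs; ring)
  obtain ⟨ρ0, hρ0, K, s, hs, hL, HP⟩ := picard G4_contDiff (T x1)
  have hTc := (hTd x1 hx1).continuousAt
  have f1 : ∀ᶠ z in 𝓝 x1, T z ∈ s := hTc hs
  have f2 : ∀ᶠ z in 𝓝 x1, T z ∈ ball (T x1) (ρ0 / 2) := hTc (ball_mem_nhds (T x1) (half_pos hρ0))
  have f3 : ∀ᶠ z in 𝓝 x1, z ∈ Ω := hΩ.mem_nhds hx1
  obtain ⟨r, hr, hrball⟩ := eventually_nhds_iff_ball.1 (f1.and (f2.and f3))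
  set ρ := min r ρ0 / 3 with hρ
  have hρp : 0 < ρ := by positivity
  have hρr : 3 * ρ ≤ r := by rw [hρ]; linarith [min_le_left r ρ0]
  have hρ0' : 3 * ρ ≤ ρ0 := by rw [hρ]; linarith [min_le_right r ρ0]
  refine ⟨ρ, hρp, fun x hx => (hrball x (ball_subset_ball (by linarith) hx)).2.2, ?_⟩
  intro x hx hQ η hη
  have hxd : dist x x1 < ρ := hx
  have hsub : ∀ z ∈ ball x (2 * ρ), z ∈ ball x1 r := by
    intro z hz
    rw [mem_ball] at *
    linarith [dist_triangle z x x1]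
  have hsub' : ball x (2 * ρ) ⊆ ball x ρ0 := ball_subset_ball (by linarith)
  have hsub1 : ball x1 ρ ⊆ ball x (2 * ρ) := by
    intro z hz
    rw [mem_ball] at *
    linarith [dist_triangle_right z x x1]
  set η' := min (ρ0 / 3) (η * Real.exp (-(K * (2 * ρ)))) with hη'
  have hη'p : 0 < η' := by positivity
  have hη'1 : η' < ρ0 / 2 := by rw [hη']; linarith [min_le_left (ρ0 / 3) (η * Real.exp (-(K * (2 * ρ))))]
  have hη'2 : η' * Real.exp (K * (2 * ρ)) ≤ η := by
    calc η' * Real.exp (K * (2 * ρ)) ≤ η * Real.exp (-(K * (2 * ρ))) * Real.exp (K * (2 * ρ)) := by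
          gcongr; exact min_le_right _ _
      _ = η := by rw [mul_assoc, ← Real.exp_add]; simp
  have hsmall : ∀ᶠ ε in 𝓝[≠] (0:ℂ), ‖ε ^ 6‖ < η' := by
    have hc : Continuous fun ε : ℂ => ‖ε ^ 6‖ := by fun_prop
    have := (hc.tendsto 0).eventually (gt_mem_nhds
      (by simpa using hη'p) : ∀ᶠ y in 𝓝 ‖(0:ℂ) ^ 6‖, y < η')
    exact this.filter_mono nhdsWithin_le_nhds
  filter_upwards [hQ η' hη'p, hsmall, self_mem_nhdsWithin] with ε hε hε6 hε0
  obtain ⟨p1, p2, p3⟩ := hε x rfl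
  have hdT : dist (x, Y ε x, deriv (Y ε) x, ε ^ 6) (T x) ≤ η' := by
    simp only [hT, Prod.dist_eq, dist_self]
    simp only [dist_eq_norm, sub_zero]
    exact max_le hη'p.le (max_le p2 (max_le p3 hε6.le))
  obtain ⟨X, hX0, hX⟩ := HP (x, Y ε x, deriv (Y ε) x, ε ^ 6) (by
    have h1 := (hrball x (hsub x (mem_ball_self (by positivity)))).2.1
    rw [mem_ball]
    have h2 : dist (T x) (T x1) < ρ0 / 2 := h1
    linarith [dist_triangle (x, Y ε x, deriv (Y ε) x, ε ^ 6) (T x) (T x1)]) x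
  have hXd := fun z hz => (hX z hz).1
  have c1 : (X x).1 = x := by rw [hX0]
  have c2 : (X x).2.2.2 = ε ^ 6 := by rw [hX0]
  have hfacts := fun z (hz : z ∈ ball x ρ0) => of_G4 hXd c1 c2 hz
  have hgerm : Y ε =ᶠ[𝓝 x] fun z => (X z).2.1 := by
    have h1 : ∀ᶠ z in 𝓝 x, HasDerivAt (fun z => ((z, Y ε z, deriv (Y ε) z, ε ^ 6) : ℂ × ℂ × ℂ × ℂ))
        (G4 (z, Y ε z, deriv (Y ε) z, ε ^ 6)) z := p1.mono fun z hz => traj4 hz.1 hz.2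
    have h2 : ∀ᶠ z in 𝓝 x, HasDerivAt X (G4 (X z)) z :=
      mem_of_superset (isOpen_ball.mem_nhds (mem_ball_self hρ0)) hXd
    filter_upwards [germ_unique G4_contDiff h1 h2 hX0.symm] with z hz
    exact congrArg (fun X => X.2.1) hz
  have heq : ∀ z ∈ ball x ρ0, Y ε =ᶠ[𝓝 z] fun z => (X z).2.1 := fun z hz =>
    mero_id (convex_ball x ρ0).isPreconnected (fun y _ => hY ε hε0 y)
      (fun y hy => (hfacts y hy).1.meromorphicNFAt) (mem_ball_self hρ0) hgerm hz
  intro z hz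
  have hz2 := hsub1 hz
  have hz0 := hsub' hz2
  have hclose : dist (X z) (T z) ≤ η := by
    have := gron hL (fun y hy => hX y (hsub' hy))
      (fun y hy => ⟨hTd y (hrball y (hsub y hy)).2.2, (hrball y (hsub y hy)).1⟩) hz2
    rw [hX0] at this
    refine this.trans (le_trans ?_ hη'2)
    gcongr
  simp only [hT, Prod.dist_eq, max_le_iff] at hclose
  simp only [dist_eq_norm] at hclose
  refine ⟨?_, ?_, ?_⟩
  · filter_upwards [isOpen_ball.mem_nhds hz0] with y hy
    refine ⟨(hfacts y hy).1.congr (heq y hy).symm, ?_⟩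
    rw [(heq y hy).deriv.deriv.self_of_nhds, (heq y hy).self_of_nhds]
    exact (hfacts y hy).2.2
  · rw [(heq z hz0).self_of_nhds]; exact hclose.2.1
  · rw [(heq z hz0).deriv.self_of_nhds, (hfacts z hz0).2.1]; exact hclose.2.2.1

end HJ

theorem halburd_joshi_PII_to_PI_limit
    (x0 α β : ℂ) (Ω : Set ℂ) (hΩopen : IsOpen Ω) (hΩconn : IsConnected Ω)
    (hx0 : x0 ∈ Ω)
    (yI : ℂ → ℂ) (hyI : DifferentiableOn ℂ yI Ω)
    (hode : ∀ x ∈ Ω, deriv (deriv yI) x = 6 * (yI x) ^ 2 + x)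
    (hinit : yI x0 = α) (hinit' : deriv yI x0 = β) :
    ∀ K : Set ℂ, IsCompact K → K ⊆ Ω → x0 ∈ K →
      ∃ rK > (0 : ℝ), ∃ Y : ℂ → ℂ → ℂ,
        (∀ ε : ℂ, 0 < ‖ε‖ → ‖ε‖ < rK →
          ∃ W : Set ℂ, IsOpen W ∧ K ⊆ W ∧
            DifferentiableOn ℂ (Y ε) W ∧
            (∀ x ∈ K, deriv (deriv (Y ε)) x
              = 6 * (Y ε x) ^ 2 + x + ε ^ 6 * (2 * (Y ε x) ^ 3 + x * Y ε x)) ∧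
            Y ε x0 = α ∧ deriv (Y ε) x0 = β) ∧
        Tendsto (fun ε : ℂ => ⨆ x ∈ K, ‖Y ε x - yI x‖)
          (nhdsWithin 0 {(0 : ℂ)}ᶜ) (nhds 0) := by
  intro K hK hKΩ hxK
  have hex : ∀ ε : ℂ, ∃ Y : ℂ → ℂ, ε ≠ 0 → (∀ x, MeromorphicNFAt Y x) ∧
      AnalyticAt ℂ Y x0 ∧ Y x0 = α ∧ deriv Y x0 = β ∧ ∀ᶠ x in nhds x0,
        deriv (deriv Y) x = 6 * Y x ^ 2 + x + ε ^ 6 * (2 * Y x ^ 3 + x * Y x) := by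
    intro ε
    by_cases hε : ε = 0
    · exact ⟨0, fun h => absurd hε h⟩
    · obtain ⟨Y, hY⟩ := HJ.transfer hε x0 α β
      exact ⟨Y, fun _ => hY⟩
  choose Y hY using hex
  have hprop := fun x1 (hx1 : x1 ∈ Ω) => HJ.propagate hΩopen hyI hode (Y := Y)
    (fun ε hε x => (hY ε hε).1 x) hx1
  -- the starting point
  have hQ0 : HJ.QQ Y yI {x0} := by
    intro η hη
    filter_upwards [self_mem_nhdsWithin] with ε hε x hx
    obtain rfl : x = x0 := hx
    obtain ⟨-, h2, h3, h4, h5⟩ := hY ε hε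
    refine ⟨h2.eventually_analyticAt.and h5, ?_, ?_⟩
    · rw [h3, hinit, sub_self, norm_zero]; exact hη.le
    · rw [h4, hinit', sub_self, norm_zero]; exact hη.le
  -- propagation through the connected domain
  have hall : Ω ⊆ {x | x ∈ Ω ∧ HJ.QQ Y yI {x}} := by
    refine hΩconn.isPreconnected.subset_of_closure_inter_subset ?_ ⟨x0, hx0, hx0, hQ0⟩ ?_
    · rw [Metric.isOpen_iff]
      rintro x ⟨hxΩ, hxQ⟩
      obtain ⟨ρ, hρ, hsub, h⟩ := hprop x hxΩ
      refine ⟨ρ, hρ, fun z hz => ⟨hsub hz, ?_⟩⟩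
      exact (h x (Metric.mem_ball_self hρ) hxQ).mono (Set.singleton_subset_iff.2 hz)
    · rintro x ⟨hxc, hxΩ⟩
      obtain ⟨ρ, hρ, hsub, h⟩ := hprop x hxΩ
      obtain ⟨z, hz, hzd⟩ := Metric.mem_closure_iff.1 hxc ρ hρ
      refine ⟨hxΩ, (h z (by rwa [Metric.mem_ball_comm]) hz.2).mono
        (Set.singleton_subset_iff.2 (Metric.mem_ball_self hρ))⟩
  have hQK : HJ.QQ Y yI K := by
    refine hK.induction_on (p := HJ.QQ Y yI) ?_ (fun s t hst ht => ht.mono hst)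
      (fun s t hs ht => hs.union ht) ?_
    · intro η hη
      exact Eventually.of_forall fun ε x hx => absurd hx (Set.notMem_empty x)
    · intro x hx
      obtain ⟨ρ, hρ, hsub, h⟩ := hprop x (hKΩ hx)
      exact ⟨_, mem_nhdsWithin_of_mem_nhds (Metric.ball_mem_nhds x hρ),
        h x (Metric.mem_ball_self hρ) (hall (hKΩ hx)).2⟩
  obtain ⟨rK, hrK, hr⟩ := Metric.mem_nhdsWithin_iff.1 (hQK 1 one_pos)
  refine ⟨rK, hrK, Y, ?_, ?_⟩
  · intro ε hε1 hε2
    have hε0 : ε ≠ 0 := norm_pos_iff.1 hε1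
    have hP := hr ⟨by simpa using hε2, hε0⟩
    refine ⟨{x | AnalyticAt ℂ (Y ε) x}, isOpen_analyticAt ℂ (Y ε),
      fun x hx => (hP x hx).1.self_of_nhds.1,
      fun x hx => AnalyticAt.differentiableWithinAt hx, fun x hx => (hP x hx).1.self_of_nhds.2,
      (hY ε hε0).2.2.1, (hY ε hε0).2.2.2.1⟩
  · rw [Metric.tendsto_nhds]
    intro η hη
    filter_upwards [hQK (η / 2) (half_pos hη)] with ε hε
    have h0 : 0 ≤ ⨆ x ∈ K, ‖Y ε x - yI x‖ :=
      Real.iSup_nonneg fun x => Real.iSup_nonneg fun _ => norm_nonneg _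
    have h1 : ⨆ x ∈ K, ‖Y ε x - yI x‖ ≤ η / 2 :=
      Real.iSup_le (fun x => Real.iSup_le (fun hx => (hε x hx).2.1) (half_pos hη).le)
        (half_pos hη).le
    rw [Real.dist_eq, sub_zero, abs_of_nonneg h0]
    linarith
end
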